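/- Let Ω ⊂ ℂ be a bounded set. There exists h₀ > 0 such that for all C > 0 and L ≥ 1 there exists A > 0 with the following property: for all h ∈ (0, h₀], all z ∈ Ω with dist(z, Λ_h) ≥ h^L/C, and all Schwartz functions u on ℝⁿ, one has ‖u‖_{L²(ℝⁿ)} ≤ A exp(A h^{-1} log(1/h)) ‖(q^w(x,hD_x) − z)u‖_{L²(ℝⁿ)}. (Since Λ_h is exactly the spectrum of q^w(x,hD_x), this is an a priori form of the resolvent bound ‖(q^w(x,hD_x) − z)^{-1}‖ ≤ A exp(A h^{-1} log(1/h)).) -/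

import Mathlib

open MeasureTheory

/-- The quadratic form `q(x,ξ) = ⟨Ax,x⟩ + 2⟨Bx,ξ⟩ + ⟨Cξ,ξ⟩` on ℂⁿ×ℂⁿ. -/
noncomputable def qForm {n : ℕ} (A B C : Matrix (Fin n) (Fin n) ℂ)
    (x ξ : Fin n → ℂ) : ℂ :=
  (∑ j, ∑ k, A j k * x k * x j) + 2 * ∑ k, (∑ l, B k l * x l) * ξ k
    + ∑ j, ∑ k, C j k * ξ k * ξ j

/-- The symmetric bilinear polarization `q(X,Y)` of `q`, on `ℂ^{2n} = ℂⁿ ⊕ ℂⁿ`. -/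
noncomputable def qPolar {n : ℕ} (A B C : Matrix (Fin n) (Fin n) ℂ)
    (X Y : (Fin n ⊕ Fin n) → ℂ) : ℂ :=
  (∑ j, ∑ k, A j k * X (Sum.inl k) * Y (Sum.inl j))
    + (∑ k, (∑ l, B k l * X (Sum.inl l)) * Y (Sum.inr k))
    + (∑ k, (∑ l, B k l * Y (Sum.inl l)) * X (Sum.inr k))
    + ∑ j, ∑ k, C j k * X (Sum.inr k) * Y (Sum.inr j)

/-- The complex symplectic form `σ((x,ξ),(y,η)) = ⟨ξ,y⟩ − ⟨x,η⟩` on `ℂ^{2n}`. -/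
noncomputable def sympForm {n : ℕ} (X Y : (Fin n ⊕ Fin n) → ℂ) : ℂ :=
  (∑ j, X (Sum.inr j) * Y (Sum.inl j)) - ∑ j, X (Sum.inl j) * Y (Sum.inr j)

/-- The semiclassical Weyl quantization
`q^w(x,hD_x)u = ⟨Ax,x⟩u − h² Σ_{j,k} C_{jk} ∂²u/∂x_j∂x_k
 + (2h/i) Σ_k (Bx)_k ∂u/∂x_k + (h/i)(tr B)u`. -/
noncomputable def weylQuant {n : ℕ} (A B C : Matrix (Fin n) (Fin n) ℂ) (h : ℝ)
    (u : EuclideanSpace ℝ (Fin n) → ℂ) (x : EuclideanSpace ℝ (Fin n)) : ℂ :=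
  (∑ j, ∑ k, A j k * (x j : ℂ) * (x k : ℂ)) * u x
    - (h : ℂ) ^ 2 * ∑ j, ∑ k, C j k *
        fderiv ℝ (fun y => fderiv ℝ u y (EuclideanSpace.single k 1)) x
          (EuclideanSpace.single j 1)
    + (2 * (h : ℂ) / Complex.I) * ∑ k, (∑ l, B k l * (x l : ℂ)) *
        fderiv ℝ u x (EuclideanSpace.single k 1)
    + ((h : ℂ) / Complex.I) * (∑ j, B j j) * u x

/-- The `L²(ℝⁿ)`-norm of a function. -/
noncomputable def l2Norm {n : ℕ} (f : EuclideanSpace ℝ (Fin n) → ℂ) : ℝ :=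
  Real.sqrt (∫ x : EuclideanSpace ℝ (Fin n), ‖f x‖ ^ 2)

/-- The set `Λ_h = {(h/i) Σ_j λ_j(2ν_j+1) : ν ∈ ℕⁿ}`, which is the spectrum of
`q^w(x,hD_x)`. -/
noncomputable def specSet {n : ℕ} (lam : Fin n → ℂ) (h : ℝ) : Set ℂ :=
  {w | ∃ ν : Fin n → ℕ, w = (h : ℂ) / Complex.I * ∑ j, lam j * (2 * (ν j : ℂ) + 1)}


set_option maxHeartbeats 1000000 in
theorem tri_lemma : ∀ (m : ℕ) (F : Matrix (Fin m) (Fin m) ℂ) (a : Fin m → ℂ),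
    F.charpoly = ∏ i, (Polynomial.X - Polynomial.C (a i)) →
    ∃ S U : Matrix (Fin m) (Fin m) ℂ, IsUnit S.det ∧ (∀ i j, j < i → U i j = 0) ∧
      (∀ i, U i i = a i) ∧ F * S = S * U := by
  intro m
  induction m with
  | zero =>
    intro F a _
    exact ⟨1, 1, by simp, fun i => i.elim0, fun i => i.elim0, by ext i; exact i.elim0⟩
  | succ m ih =>
    intro F a hF
    have hdet : (Matrix.scalar (Fin (m+1)) (a 0) - F).det = 0 := by
      rw [← Matrix.eval_charpoly, hF, Polynomial.eval_prod]
      apply Finset.prod_eq_zero (Finset.mem_univ 0)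
      simp
    obtain ⟨v, hv0, hv⟩ := Matrix.exists_mulVec_eq_zero_iff.mpr hdet
    have hFv : F.mulVec v = a 0 • v := by
      rw [Matrix.sub_mulVec, sub_eq_zero] at hv
      rw [← hv]; ext i; simp [Matrix.scalar_apply, Matrix.mulVec_diagonal]
    obtain ⟨i, hi⟩ : ∃ i, v i ≠ 0 := by
      by_contra h; push Not at h; exact hv0 (funext h)
    set S0 : Matrix (Fin (m+1)) (Fin (m+1)) ℂ := (1 : Matrix _ _ ℂ).updateCol i v with hS0
    have hS0d : S0.det = v i := by
      rw [hS0, ← Matrix.cramer_apply]; simp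
    set S1 := S0.submatrix id (Equiv.swap 0 i) with hS1
    have hS1u : IsUnit S1.det := by
      rw [hS1, Matrix.det_permute', hS0d, isUnit_iff_ne_zero]
      refine mul_ne_zero ?_ hi
      rcases Int.units_eq_one_or (Equiv.Perm.sign (Equiv.swap 0 i)) with h | h <;> simp [h]
    have hcol : ∀ k, S1 k 0 = v k := by
      intro k; simp [hS1, hS0]
    set A := S1⁻¹ * F * S1 with hA
    have hS1A : S1 * A = F * S1 := by
      rw [hA, ← Matrix.mul_assoc, ← Matrix.mul_assoc, Matrix.mul_nonsing_inv _ hS1u, Matrix.one_mul]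
    have hSe : S1.mulVec (Pi.single 0 1) = v := by
      ext k; simp [hcol]
    have hAe : A.mulVec (Pi.single 0 1) = a 0 • Pi.single 0 1 := by
      have h2 : S1⁻¹.mulVec v = Pi.single 0 1 := by
        rw [← hSe, Matrix.mulVec_mulVec, Matrix.nonsing_inv_mul _ hS1u, Matrix.one_mulVec]
      rw [hA, ← Matrix.mulVec_mulVec, hSe, ← Matrix.mulVec_mulVec, hFv, Matrix.mulVec_smul, h2]
    have hA0 : ∀ k, A k 0 = if k = 0 then a 0 else 0 := by
      intro k
      have := congrFun hAe k
      simpa [Pi.single_apply] using this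
    have hAc : A.charpoly = F.charpoly := by
      obtain ⟨W, hW⟩ : ∃ W : (Matrix (Fin (m+1)) (Fin (m+1)) ℂ)ˣ, (W : Matrix _ _ ℂ) = S1 :=
        (Matrix.isUnit_iff_isUnit_det _).mpr hS1u
      have h3 := Matrix.charpoly_units_conj' W F
      rw [hW] at h3
      exact h3
    set A' := A.submatrix Fin.succ Fin.succ with hA'
    have hexp : A.charpoly = (Polynomial.X - Polynomial.C (a 0)) * A'.charpoly := by
      rw [Matrix.charpoly, Matrix.det_succ_column_zero, Finset.sum_eq_single 0]
      · have : (A.charmatrix.submatrix (Fin.succAbove 0) Fin.succ) = A'.charmatrix := by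
          ext1 p q
          simp [Matrix.charmatrix_apply, hA', Matrix.diagonal_apply]
        rw [this]
        simp [Matrix.charmatrix_apply, hA0, Matrix.charpoly]
      · intro b _ hb
        simp [Matrix.charmatrix_apply, hA0, hb, Matrix.diagonal_apply]
      · simp
    have hA'c : A'.charpoly = ∏ i : Fin m, (Polynomial.X - Polynomial.C (a i.succ)) := by
      have := hexp.symm.trans (hAc.trans hF)
      rw [Fin.prod_univ_succ] at this
      exact mul_left_cancel₀ (Polynomial.X_sub_C_ne_zero _) this
    obtain ⟨S', U', hS'u, hU't, hU'd, hS'⟩ := ih A' (fun i => a i.succ) hA'c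
    let S2 : Matrix (Fin (m+1)) (Fin (m+1)) ℂ :=
      Matrix.of (Fin.cons (Fin.cons 1 0) (fun i => Fin.cons 0 (S' i)))
    let U : Matrix (Fin (m+1)) (Fin (m+1)) ℂ :=
      Matrix.of (Fin.cons (Fin.cons (a 0) (fun j => ∑ k, A 0 (Fin.succ k) * S' k j)) (fun i => Fin.cons 0 (U' i)))
    refine ⟨S1 * S2, U, ?_, ?_, ?_, ?_⟩
    · rw [Matrix.det_mul]
      refine hS1u.mul ?_
      have : S2.det = S'.det := by
        rw [Matrix.det_succ_column_zero, Finset.sum_eq_single 0]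
        · have : (S2.submatrix (Fin.succAbove 0) Fin.succ) = S' := by
            ext p q; simp [S2]
          rw [this]; simp [S2]
        · intro b _ hb
          obtain ⟨c, rfl⟩ := Fin.exists_succ_eq.mpr hb
          simp [S2]
        · simp
      rw [this]; exact hS'u
    · intro i j
      refine Fin.cases ?_ (fun i => ?_) i
      · intro h; exact absurd h (Fin.not_lt_zero _)
      · refine Fin.cases ?_ (fun j => ?_) j
        · intro _; simp [U]
        · intro h; simp only [U, Matrix.of_apply, Fin.cons_succ]; exact hU't _ _ (Fin.succ_lt_succ_iff.mp h)
    · intro i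
      refine Fin.cases ?_ (fun i => ?_) i
      · simp [U]
      · simp [U, hU'd]
    · suffices hkey : A * S2 = S2 * U by
        rw [← Matrix.mul_assoc, ← hS1A, Matrix.mul_assoc, hkey, Matrix.mul_assoc]
      ext i j
      rw [Matrix.mul_apply, Matrix.mul_apply, Fin.sum_univ_succ, Fin.sum_univ_succ]
      refine Fin.cases ?_ (fun i => ?_) i
      · refine Fin.cases ?_ (fun j => ?_) j
        · simp [S2, U, hA0]
        · simp [S2, U]
      · refine Fin.cases ?_ (fun j => ?_) j
        · simp [S2, U, hA0]
        · have := congrFun (congrFun hS' i) j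
          simpa [S2, U, Matrix.mul_apply, hA'] using this


theorem herm_swap {n : ℕ} (H : Matrix (Fin n) (Fin n) ℂ) (hH : H.IsHermitian) (a b : Fin n → ℂ) :
    star a ⬝ᵥ (H.mulVec b) = star (star b ⬝ᵥ H.mulVec a) := by
  rw [Matrix.star_dotProduct, Matrix.star_mulVec, hH.eq, ← Matrix.dotProduct_mulVec]

theorem lyap {n : ℕ} (H M : Matrix (Fin n) (Fin n) ℂ) (hH : H.IsHermitian)
    (hM : ∀ i j, j < i → M i j = 0) (hd : ∀ i, (M i i).re < 0)
    (hpos : ∀ b : Fin n → ℂ, b ≠ 0 → 0 < (star b ⬝ᵥ H.mulVec (M.mulVec b)).re) :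
    ∀ b : Fin n → ℂ, b ≠ 0 → (star b ⬝ᵥ H.mulVec b).re < 0 := by
  suffices h : ∀ k : ℕ, ∀ b : Fin n → ℂ, b ≠ 0 → (∀ i : Fin n, k ≤ i.val → b i = 0) →
      (star b ⬝ᵥ H.mulVec b).re < 0 by
    intro b hb
    exact h n b hb (fun i hi => absurd i.isLt (not_lt.mpr hi))
  intro k
  induction k with
  | zero => intro b hb h; exact absurd (funext fun i => h i (Nat.zero_le _)) hb
  | succ k ih =>
    intro b hb hbk
    by_cases hkn : k < n
    swap
    · exact ih b hb (fun i hi => absurd i.isLt (by omega))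
    set κ : Fin n := ⟨k, hkn⟩ with hκ
    by_cases hbκ : b κ = 0
    · apply ih b hb
      intro i hi
      rcases Nat.lt_or_ge k i.val with h | h
      · exact hbk i h
      · have : i = κ := Fin.ext (by simp [hκ]; omega)
        rw [this, hbκ]
    let V : Submodule ℂ (Fin n → ℂ) :=
      { carrier := {v | ∀ i : Fin n, k ≤ i.val → v i = 0}
        add_mem' := fun {a b} ha hb i hi => by simp [ha i hi, hb i hi]
        zero_mem' := fun i _ => rfl
        smul_mem' := fun c a ha i hi => by simp [ha i hi] }
    let φ0 : (Fin n → ℂ) →ₗ[ℂ] V :=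
      { toFun := fun v => ⟨fun i => if i.val < k then v i else 0, fun i hi => by
          simp [not_lt.mpr hi]⟩
        map_add' := fun a b => by ext i; by_cases h : i.val < k <;> simp [h]
        map_smul' := fun c a => by ext i; by_cases h : i.val < k <;> simp [h] }
    let φ : V →ₗ[ℂ] V := φ0 ∘ₗ (Matrix.mulVecLin H) ∘ₗ V.subtype
    have hφ : ∀ v : V, ∀ i : Fin n, i.val < k → (φ v : Fin n → ℂ) i = H.mulVec v i := by
      intro v i hi; simp [φ, φ0, hi]
    have hinj : Function.Injective φ := by
      rw [← LinearMap.ker_eq_bot, LinearMap.ker_eq_bot']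
      intro v hv
      by_contra hne
      have h1 : (star (v : Fin n → ℂ) ⬝ᵥ H.mulVec v) = 0 := by
        apply Finset.sum_eq_zero
        intro i _
        by_cases hi : i.val < k
        · rw [← hφ v i hi, hv]; simp
        · have : (v : Fin n → ℂ) i = 0 := v.2 i (not_lt.mp hi)
          simp [this]
      have h2 := ih v (fun h => hne (Subtype.ext h)) v.2
      rw [h1] at h2; simp at h2
    obtain ⟨v, hv⟩ := (LinearMap.injective_iff_surjective.mp hinj) (φ0 (H.mulVec b))
    have hvH : ∀ i : Fin n, i.val < k → H.mulVec (v : Fin n → ℂ) i = H.mulVec b i := by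
      intro i hi
      rw [← hφ v i hi, hv]; simp [φ0, hi]
    set w : Fin n → ℂ := b - v with hw
    have hHw : ∀ i : Fin n, i.val < k → H.mulVec w i = 0 := by
      intro i hi
      rw [hw, Matrix.mulVec_sub, Pi.sub_apply, hvH i hi, sub_self]
    have hwκ : w κ = b κ := by
      have : (v : Fin n → ℂ) κ = 0 := v.2 κ le_rfl
      simp [hw, this]
    have hwg : ∀ i : Fin n, k < i.val → w i = 0 := by
      intro i hi
      have : (v : Fin n → ℂ) i = 0 := v.2 i hi.le
      simp [hw, this, hbk i hi]
    have hw0 : w ≠ 0 := fun h => hbκ (by rw [← hwκ, h]; rfl)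
    -- generic: pairing with Hw only sees κ
    have hpair : ∀ c : Fin n → ℂ, (∀ i : Fin n, k < i.val → c i = 0) →
        star c ⬝ᵥ H.mulVec w = star (c κ) * H.mulVec w κ := by
      intro c hc
      rw [dotProduct, Finset.sum_eq_single κ]
      · rfl
      · intro i _ hi
        rcases lt_trichotomy i.val k with h | h | h
        · rw [hHw i h, mul_zero]
        · exact absurd (Fin.ext h) hi
        · simp [hc i h]
      · simp
    have hMw : ∀ i : Fin n, k < i.val → M.mulVec w i = 0 := by
      intro i hi
      rw [Matrix.mulVec, dotProduct]
      apply Finset.sum_eq_zero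
      intro j _
      by_cases hj : k < j.val
      · rw [hwg j hj, mul_zero]
      · have : M i j = 0 := hM i j (by rw [Fin.lt_def]; omega)
        simp [this]
    have hMwκ : M.mulVec w κ = M κ κ * w κ := by
      rw [Matrix.mulVec, dotProduct, Finset.sum_eq_single κ]
      · intro j _ hj
        rcases lt_trichotomy j.val k with h | h | h
        · have : M κ j = 0 := hM κ j (by rw [Fin.lt_def]; exact h)
          simp [this]
        · exact absurd (Fin.ext h) hj
        · rw [hwg j h, mul_zero]
      · simp
    have hww := hpair w hwg
    have hreal : ∀ a : Fin n → ℂ, (star a ⬝ᵥ H.mulVec a).im = 0 := by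
      intro a
      have := congrArg Complex.im (herm_swap H hH a a)
      simp only [Complex.star_def, Complex.conj_im] at this
      linarith
    have hneg : (star w ⬝ᵥ H.mulVec w).re < 0 := by
      have h1 := hpos w hw0
      rw [herm_swap H hH, hpair _ hMw, hMwκ] at h1
      have h2 : star (star (M κ κ * w κ) * H.mulVec w κ)
          = M κ κ * star (star w ⬝ᵥ H.mulVec w) := by
        rw [hww]; simp only [star_mul', star_star]; ring
      rw [h2] at h1
      simp only [Complex.mul_re, Complex.star_def, Complex.conj_re, Complex.conj_im, hreal] at h1
      have := hd κ
      nlinarith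
    have hvw : star (v : Fin n → ℂ) ⬝ᵥ H.mulVec w = 0 := by
      rw [hpair _ (fun i hi => v.2 i hi.le)]
      have : (v : Fin n → ℂ) κ = 0 := v.2 κ le_rfl
      simp [this]
    have hwv : star w ⬝ᵥ H.mulVec (v : Fin n → ℂ) = 0 := by
      rw [herm_swap H hH, hvw, star_zero]
    have hvv : (star (v : Fin n → ℂ) ⬝ᵥ H.mulVec (v : Fin n → ℂ)).re ≤ 0 := by
      by_cases h : (v : Fin n → ℂ) = 0
      · rw [h]; simp
      · exact (ih v h v.2).le
    have hb : b = w + v := by rw [hw]; simp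
    rw [hb, star_add, Matrix.mulVec_add, add_dotProduct, dotProduct_add, dotProduct_add, hvw, hwv]
    simp only [Complex.add_re, Complex.zero_re]
    linarith


theorem sylv_zero {n : ℕ} (M W : Matrix (Fin n) (Fin n) ℂ) (hM : ∀ i j, j < i → M i j = 0)
    (hd : ∀ i j, M i i + M j j ≠ 0) (hW : M.transpose * W + W * M = 0) : W = 0 := by
  suffices h : ∀ s : ℕ, ∀ i j : Fin n, i.val + j.val = s → W i j = 0 by
    ext i j; exact h _ i j rfl
  intro s
  induction s using Nat.strong_induction_on with
  | _ s ih =>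
    intro i j hs
    have h := congrFun (congrFun hW i) j
    simp only [Matrix.add_apply, Matrix.mul_apply, Matrix.transpose_apply, Matrix.zero_apply] at h
    rw [Finset.sum_eq_single i, Finset.sum_eq_single j] at h
    · have h2 : (M i i + M j j) * W i j = 0 := by linear_combination h
      exact (mul_eq_zero.mp h2).resolve_left (hd i j)
    · intro k _ hk
      rcases lt_or_gt_of_ne hk with h1 | h1
      · rw [ih (i.val + k.val) (by rw [Fin.lt_def] at h1; omega) i k rfl, zero_mul]
      · rw [hM k j h1, mul_zero]
    · simp
    · intro k _ hk
      rcases lt_or_gt_of_ne hk with h1 | h1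
      · rw [ih (k.val + j.val) (by rw [Fin.lt_def] at h1; omega) k j rfl, mul_zero]
      · rw [hM k i h1, zero_mul]
    · simp

theorem la_cols {n : ℕ} (A B C : Matrix (Fin n) (Fin n) ℂ)
    (F : Matrix (Fin n ⊕ Fin n) (Fin n ⊕ Fin n) ℂ)
    (hF : ∀ X Y, sympForm X (F.mulVec Y) = qPolar A B C X Y)
    (hAs : A.IsSymm) (hCs : C.IsSymm)
    (lam : Fin n → ℂ)
    (hchar : F.charpoly =
      ∏ j, ((Polynomial.X - Polynomial.C (lam j)) * (Polynomial.X + Polynomial.C (lam j)))) :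
    ∃ Y1 Y2 M : Matrix (Fin n) (Fin n) ℂ, (∀ i j, j < i → M i j = 0) ∧ (∀ i, M i i = - lam i) ∧
      (∀ b, Y1.mulVec b = 0 → Y2.mulVec b = 0 → b = 0) ∧
      B * Y1 + C * Y2 = Y1 * M ∧ - (A * Y1) - B.transpose * Y2 = Y2 * M := by
  set e : Fin n ⊕ Fin n ≃ Fin (n + n) := finSumFinEquiv with he
  obtain ⟨S, U, hS, hU, hUd, hFS⟩ := tri_lemma (n + n) (Matrix.reindex e e F)
    (Fin.append (fun i => - lam i) lam) (by
      rw [Matrix.charpoly_reindex, hchar, Fin.prod_univ_add, Finset.prod_mul_distrib, mul_comm]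
      simp only [Fin.append_left, Fin.append_right, Polynomial.C_neg, sub_neg_eq_add])
  -- F applied to vectors
  have hFl : ∀ Y : Fin n ⊕ Fin n → ℂ, ∀ i, F.mulVec Y (Sum.inl i) =
      (∑ l, B i l * Y (Sum.inl l)) + ∑ l, C i l * Y (Sum.inr l) := by
    intro Y i
    have h := hF (Pi.single (Sum.inr i) 1) Y
    simp [sympForm, qPolar, Pi.single_apply] at h
    rw [h]
    congr 1
    apply Finset.sum_congr rfl
    intro l _
    rw [← hCs.apply]
  have hFr : ∀ Y : Fin n ⊕ Fin n → ℂ, ∀ i, F.mulVec Y (Sum.inr i) =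
      - (∑ l, A i l * Y (Sum.inl l)) - ∑ l, B l i * Y (Sum.inr l) := by
    intro Y i
    have h := hF (Pi.single (Sum.inl i) 1) Y
    simp [sympForm, qPolar, Pi.single_apply] at h
    have h3 : ∀ l, A i l = A l i := fun l => (hAs.apply l i)
    simp only [h3]
    linear_combination -h
  have hcol : ∀ (s : Fin n ⊕ Fin n) (j : Fin n),
      F.mulVec (fun t => S (e t) (Fin.castAdd n j)) s =
        ∑ k : Fin n, S (e s) (Fin.castAdd n k) * U (Fin.castAdd n k) (Fin.castAdd n j) := by
    intro s j
    have h := congrFun (congrFun hFS (e s)) (Fin.castAdd n j)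
    rw [Matrix.mul_apply, Matrix.mul_apply] at h
    have hz : ∑ i : Fin n, S (e s) (Fin.natAdd n i) * U (Fin.natAdd n i) (Fin.castAdd n j) = 0 := by
      apply Finset.sum_eq_zero
      intro i _
      rw [hU _ _ (by rw [Fin.lt_def]; simp; omega), mul_zero]
    rw [Fin.sum_univ_add (fun i => S (e s) i * _), hz, add_zero] at h
    rw [← h, Matrix.mulVec, dotProduct, ← e.sum_comp]
    simp
  refine ⟨S.submatrix (Fin.castAdd n) (Fin.castAdd n), S.submatrix (Fin.natAdd n) (Fin.castAdd n),
    U.submatrix (Fin.castAdd n) (Fin.castAdd n), ?_, ?_, ?_, ?_, ?_⟩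
  · intro i j hij
    exact hU _ _ (by rw [Fin.lt_def] at hij ⊢; simpa using hij)
  · intro i
    rw [Matrix.submatrix_apply, hUd]; simp
  · intro b h1 h2
    have hz : S.mulVec (Fin.append b 0) = 0 := by
      ext i
      rw [Matrix.mulVec, dotProduct, Fin.sum_univ_add]
      simp only [Fin.append_left, Fin.append_right, Pi.zero_apply, mul_zero, Finset.sum_const_zero,
        add_zero]
      refine Fin.addCases (fun i => ?_) (fun i => ?_) i
      · exact congrFun h1 i
      · exact congrFun h2 i
    have hz2 := Matrix.eq_zero_of_mulVec_eq_zero hS.ne_zero hz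
    ext i
    have := congrFun hz2 (Fin.castAdd n i)
    simpa using this
  · ext i j
    have h := hcol (Sum.inl i) j
    rw [hFl] at h
    simpa [Matrix.mul_apply, e, -Fin.natAdd_eq_addNat] using h
  · ext i j
    have h := hcol (Sum.inr i) j
    rw [hFr] at h
    simpa [Matrix.mul_apply, e, -Fin.natAdd_eq_addNat] using h

/-- The sesquilinear form attached to `q` in terms of real and imaginary parts. -/
theorem sesq_eq {n : ℕ} (A B C : Matrix (Fin n) (Fin n) ℂ) (hAs : A.IsSymm) (hCs : C.IsSymm)
    (X : Fin n ⊕ Fin n → ℂ) : (qPolar A B C (star X) X).re =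
      (qForm A B C (fun j => ((X (Sum.inl j)).re : ℂ)) (fun j => ((X (Sum.inr j)).re : ℂ))).re +
      (qForm A B C (fun j => ((X (Sum.inl j)).im : ℂ)) (fun j => ((X (Sum.inr j)).im : ℂ))).re := by
  have key : ∀ D : Matrix (Fin n) (Fin n) ℂ, D.IsSymm → ∀ y : Fin n → ℂ,
      (∑ j, ∑ k, D j k * star (y k) * y j) =
      (∑ j, ∑ k, D j k * ((y k).re : ℂ) * ((y j).re : ℂ)) +
      (∑ j, ∑ k, D j k * ((y k).im : ℂ) * ((y j).im : ℂ)) := by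
    intro D hD y
    have h1 : ∑ j, ∑ k, D j k * star (y k) * y j = ∑ j, ∑ k, D j k * star (y j) * y k := by
      rw [Finset.sum_comm]
      refine Finset.sum_congr rfl fun j _ => Finset.sum_congr rfl fun k _ => ?_
      rw [hD.apply]
    have h2 : (∑ j, ∑ k, D j k * star (y k) * y j) + ∑ j, ∑ k, D j k * star (y j) * y k =
      2 * ((∑ j, ∑ k, D j k * ((y k).re : ℂ) * ((y j).re : ℂ)) +
      (∑ j, ∑ k, D j k * ((y k).im : ℂ) * ((y j).im : ℂ))) := by
      rw [← Finset.sum_add_distrib, ← Finset.sum_add_distrib, Finset.mul_sum]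
      refine Finset.sum_congr rfl fun j _ => ?_
      rw [← Finset.sum_add_distrib, ← Finset.sum_add_distrib, Finset.mul_sum]
      refine Finset.sum_congr rfl fun k _ => ?_
      have e1 : star (y k) * y j + star (y j) * y k =
          2 * (((y k).re : ℂ) * (y j).re + ((y k).im : ℂ) * (y j).im) := by
        apply Complex.ext <;> simp <;> ring
      linear_combination D j k * e1
    rw [← h1] at h2
    linear_combination h2 / 2
  have hB : (∑ k, (∑ l, B k l * star (X (Sum.inl l))) * X (Sum.inr k))
    + (∑ k, (∑ l, B k l * X (Sum.inl l)) * star (X (Sum.inr k))) =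
    2 * (∑ k, (∑ l, B k l * ((X (Sum.inl l)).re : ℂ)) * ((X (Sum.inr k)).re : ℂ)) +
    2 * (∑ k, (∑ l, B k l * ((X (Sum.inl l)).im : ℂ)) * ((X (Sum.inr k)).im : ℂ)) := by
    rw [Finset.mul_sum, Finset.mul_sum, ← Finset.sum_add_distrib, ← Finset.sum_add_distrib]
    refine Finset.sum_congr rfl fun j _ => ?_
    rw [Finset.sum_mul, Finset.sum_mul, Finset.sum_mul, Finset.sum_mul, Finset.mul_sum,
      Finset.mul_sum, ← Finset.sum_add_distrib, ← Finset.sum_add_distrib]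
    refine Finset.sum_congr rfl fun k _ => ?_
    have e1 : star (X (Sum.inl k)) * X (Sum.inr j) + star (X (Sum.inr j)) * X (Sum.inl k) =
          2 * (((X (Sum.inl k)).re : ℂ) * (X (Sum.inr j)).re
            + ((X (Sum.inl k)).im : ℂ) * (X (Sum.inr j)).im) := by
        apply Complex.ext <;> simp <;> ring
    linear_combination B j k * e1
  rw [← Complex.add_re]
  congr 1
  unfold qPolar qForm
  simp only [Pi.star_apply]
  rw [key A hAs, key C hCs]
  linear_combination hB

theorem pairH {n : ℕ} (P Q : Matrix (Fin n) (Fin n) ℂ) (b c : Fin n → ℂ) :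
    star b ⬝ᵥ (P.conjTranspose * Q).mulVec c = star (P.mulVec b) ⬝ᵥ Q.mulVec c := by
  rw [← Matrix.mulVec_mulVec, Matrix.dotProduct_mulVec, ← Matrix.star_mulVec]

/-- Linear algebra input: the stable Lagrangian subspace and its consequences. -/
theorem la_main {n : ℕ} (A B C : Matrix (Fin n) (Fin n) ℂ) (hAs : A.IsSymm) (hCs : C.IsSymm)
    (hpos : ∀ x ξ : Fin n → ℝ, ¬(x = 0 ∧ ξ = 0) →
      0 < (qForm A B C (fun j => (x j : ℂ)) (fun j => (ξ j : ℂ))).re)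
    (F : Matrix (Fin n ⊕ Fin n) (Fin n ⊕ Fin n) ℂ)
    (hF : ∀ X Y, sympForm X (F.mulVec Y) = qPolar A B C X Y)
    (lam : Fin n → ℂ) (hlam : ∀ j, 0 < (lam j).im)
    (hchar : F.charpoly =
      ∏ j, ((Polynomial.X - Polynomial.C (lam j)) * (Polynomial.X + Polynomial.C (lam j)))) :
    ∃ G T Ti M : Matrix (Fin n) (Fin n) ℂ, G.IsSymm ∧
      (∀ x : Fin n → ℝ, x ≠ 0 → 0 < (∑ j, ∑ k, G j k * (x j : ℂ) * (x k : ℂ)).re) ∧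
      T * Ti = 1 ∧ Ti * T = 1 ∧ (∀ i j, j < i → M i j = 0) ∧ (∀ i, M i i = - lam i) ∧
      A - G * C * G - Complex.I • (B.transpose * G + G * B) = 0 ∧
      T * (B - Complex.I • (C * G)) = M * T := by
  obtain ⟨Y1, Y2, M, hM, hMd, hinj, h1, h2⟩ := la_cols A B C F hF hAs hCs lam hchar
  have hAt : A.transpose = A := hAs
  have hCt : C.transpose = C := hCs
  have hW : Y2.transpose * Y1 - Y1.transpose * Y2 = 0 := by
    apply sylv_zero M _ hM
    · intro i j h
      rw [hMd, hMd] at h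
      have := congrArg Complex.im h
      simp at this
      have := hlam i; have := hlam j
      linarith
    · have e1 : M.transpose * Y1.transpose = Y1.transpose * B.transpose + Y2.transpose * C := by
        rw [← Matrix.transpose_mul, ← h1]; simp [Matrix.transpose_mul, hCt]
      have e2 : M.transpose * Y2.transpose = - (Y1.transpose * A) - Y2.transpose * B := by
        rw [← Matrix.transpose_mul, ← h2]; simp [Matrix.transpose_mul, hAt]
      rw [mul_sub, sub_mul, ← mul_assoc, ← mul_assoc, e1, e2, mul_assoc _ Y1, mul_assoc _ Y2,
        ← h1, ← h2]
      noncomm_ring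
  -- negativity
  have hneg : ∀ b : Fin n → ℂ, b ≠ 0 →
      (star b ⬝ᵥ (Complex.I • (Y2.conjTranspose * Y1 - Y1.conjTranspose * Y2)).mulVec b).re < 0 := by
    apply lyap _ ((-Complex.I) • M)
    · rw [Matrix.IsHermitian, Matrix.conjTranspose_smul, Matrix.conjTranspose_sub,
        Matrix.conjTranspose_mul, Matrix.conjTranspose_mul]
      simp only [Matrix.conjTranspose_conjTranspose, Complex.star_def, Complex.conj_I]
      rw [neg_smul, ← smul_neg, neg_sub]
    · intro i j hij; simp [hM i j hij]
    · intro i; simp [hMd]; exact hlam i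
    · intro b hb
      have e0 : star b ⬝ᵥ (Complex.I • (Y2.conjTranspose * Y1 - Y1.conjTranspose * Y2)).mulVec
          (((-Complex.I) • M).mulVec b) =
          star (Y2.mulVec b) ⬝ᵥ (Y1 * M).mulVec b - star (Y1.mulVec b) ⬝ᵥ (Y2 * M).mulVec b := by
        rw [Matrix.mulVec_mulVec, Matrix.smul_mul, Matrix.mul_smul, smul_smul]
        have : Complex.I * -Complex.I = 1 := by simp
        rw [this, one_smul, sub_mul, Matrix.sub_mulVec, dotProduct_sub, mul_assoc, mul_assoc,
          pairH, pairH]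
      set X : Fin n ⊕ Fin n → ℂ := Sum.elim (Y1.mulVec b) (Y2.mulVec b) with hX
      have e1 : star (Y2.mulVec b) ⬝ᵥ (Y1 * M).mulVec b - star (Y1.mulVec b) ⬝ᵥ (Y2 * M).mulVec b
          = qPolar A B C (star X) X := by
        rw [← h1, ← h2, Matrix.add_mulVec, Matrix.sub_mulVec, Matrix.neg_mulVec,
          ← Matrix.mulVec_mulVec, ← Matrix.mulVec_mulVec, ← Matrix.mulVec_mulVec,
          ← Matrix.mulVec_mulVec]
        unfold qPolar
        simp only [hX, Pi.star_apply, Sum.elim_inl, Sum.elim_inr]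
        set x := Y1.mulVec b
        set y := Y2.mulVec b
        have s1 : ∀ D : Matrix (Fin n) (Fin n) ℂ, D.IsSymm → ∀ x : Fin n → ℂ,
            star x ⬝ᵥ D.mulVec x = ∑ j, ∑ k, D j k * star (x k) * x j := by
          intro D hD x
          simp only [dotProduct, Matrix.mulVec, Pi.star_apply, Finset.mul_sum]
          rw [Finset.sum_comm]
          refine Finset.sum_congr rfl fun j _ => Finset.sum_congr rfl fun k _ => ?_
          rw [← hD.apply]; ring
        have s2 : star x ⬝ᵥ B.transpose.mulVec y = ∑ k, (∑ l, B k l * star (x l)) * y k := by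
          simp only [dotProduct, Matrix.mulVec, Pi.star_apply, Finset.mul_sum, Finset.sum_mul]
          rw [Finset.sum_comm]
          refine Finset.sum_congr rfl fun j _ => Finset.sum_congr rfl fun k _ => ?_
          rw [Matrix.transpose_apply]; ring
        have s3 : star y ⬝ᵥ B.mulVec x = ∑ k, (∑ l, B k l * x l) * star (y k) := by
          simp only [dotProduct, Matrix.mulVec, Pi.star_apply]
          refine Finset.sum_congr rfl fun j _ => ?_
          ring
        rw [dotProduct_add, dotProduct_sub, dotProduct_neg, s1 A hAs, s1 C hCs, s2, s3]
        ring
      rw [e0, e1, sesq_eq A B C hAs hCs]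
      have hq0 : ∀ x ξ : Fin n → ℝ, 0 ≤ (qForm A B C (fun j => (x j : ℂ)) (fun j => (ξ j : ℂ))).re := by
        intro x ξ
        by_cases h : x = 0 ∧ ξ = 0
        · rw [h.1, h.2]; simp [qForm]
        · exact (hpos x ξ h).le
      by_cases hr : (fun j => (X (Sum.inl j)).re) = 0 ∧ (fun j => (X (Sum.inr j)).re) = 0
      · by_cases hi : (fun j => (X (Sum.inl j)).im) = 0 ∧ (fun j => (X (Sum.inr j)).im) = 0
        · exfalso
          apply hb
          apply hinj
          · ext j; exact Complex.ext (congrFun hr.1 j) (congrFun hi.1 j)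
          · ext j; exact Complex.ext (congrFun hr.2 j) (congrFun hi.2 j)
        · exact add_pos_of_nonneg_of_pos (hq0 _ _) (hpos _ _ hi)
      · exact add_pos_of_pos_of_nonneg (hpos _ _ hr) (hq0 _ _)
  have hneg2 : ∀ b : Fin n → ℂ, b ≠ 0 →
      (Complex.I * (star (Y2.mulVec b) ⬝ᵥ Y1.mulVec b - star (Y1.mulVec b) ⬝ᵥ Y2.mulVec b)).re < 0 := by
    intro b hb
    have := hneg b hb
    rw [Matrix.smul_mulVec, dotProduct_smul, Matrix.sub_mulVec, dotProduct_sub,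
      pairH, pairH] at this
    exact this
  have hu : IsUnit Y1.det := by
    rw [isUnit_iff_ne_zero]
    intro h0
    obtain ⟨v, hv0, hv⟩ := Matrix.exists_mulVec_eq_zero_iff.mpr h0
    have := hneg2 v hv0
    rw [hv] at this
    simp at this
  have hTi : Y1⁻¹ * Y1 = 1 := Matrix.nonsing_inv_mul _ hu
  have hTi' : Y1 * Y1⁻¹ = 1 := Matrix.mul_nonsing_inv _ hu
  set T := Y1⁻¹ with hT
  have hK : (Y2 * T).transpose = Y2 * T := by
    have e3 : T.transpose * (Y2.transpose * Y1 - Y1.transpose * Y2) * T = 0 := by rw [hW]; simp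
    have e4 : T.transpose * Y1.transpose = 1 := by rw [← Matrix.transpose_mul, hTi']; simp
    rw [mul_sub, sub_mul, ← mul_assoc, ← mul_assoc, e4, mul_assoc, hTi', one_mul, mul_one,
      sub_eq_zero] at e3
    rw [Matrix.transpose_mul, e3]
  set K := Y2 * T with hKd
  have hKY : K * Y1 = Y2 := by rw [hKd, mul_assoc, hTi, mul_one]
  have r1 : T * (B + C * K) = M * T := by
    have : Y1 * (M * T) = B + C * K := by
      rw [← mul_assoc, ← h1, add_mul, mul_assoc, mul_assoc, hTi', mul_one]
    rw [← this, ← mul_assoc, hTi, one_mul]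
  have r2 : A + B.transpose * K + K * B + K * C * K = 0 := by
    have e5 : Y2 * M * T = K * (B + C * K) := by
      rw [mul_assoc, ← r1, ← mul_assoc]
    rw [← h2, sub_mul, neg_mul, mul_assoc, mul_assoc, hTi', mul_one] at e5
    have : K * (B + C * K) = K * B + K * C * K := by rw [mul_add, ← mul_assoc]
    rw [this] at e5
    rw [add_assoc, ← e5]; simp only [hKd]; abel
  have hGK : ∀ Z : Matrix (Fin n) (Fin n) ℂ, Complex.I • (Complex.I • Z) = - Z := by
    intro Z; rw [smul_smul, Complex.I_mul_I, neg_one_smul]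
  refine ⟨Complex.I • K, T, Y1, M, ?_, ?_, hTi, hTi', hM, hMd, ?_, ?_⟩
  · rw [Matrix.IsSymm, Matrix.transpose_smul, hK]
  · intro x hx
    have hb : T.mulVec (fun j => (x j : ℂ)) ≠ 0 := by
      intro h
      apply hx
      have := congrArg (Y1.mulVec) h
      rw [Matrix.mulVec_mulVec, hTi', Matrix.one_mulVec, Matrix.mulVec_zero] at this
      ext j
      have := congrFun this j
      simpa using this
    have h := hneg2 _ hb
    rw [← hKY, ← Matrix.mulVec_mulVec, Matrix.mulVec_mulVec (M := Y1), hTi', Matrix.one_mulVec] at h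
    have hsx : star (fun j => (x j : ℂ)) = (fun j => (x j : ℂ)) := by ext j; simp
    rw [Matrix.star_dotProduct, hsx] at h
    have e6 : ∑ j, ∑ k, (Complex.I • K) j k * (x j : ℂ) * (x k : ℂ) =
        Complex.I * ((fun j => (x j : ℂ)) ⬝ᵥ K.mulVec (fun j => (x j : ℂ))) := by
      simp only [dotProduct, Matrix.mulVec, Finset.mul_sum, Matrix.smul_apply, smul_eq_mul]
      refine Finset.sum_congr rfl fun j _ => Finset.sum_congr rfl fun k _ => ?_
      ring
    rw [e6]
    generalize ((fun j => (x j : ℂ)) ⬝ᵥ K.mulVec (fun j => (x j : ℂ))) = s at h ⊢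
    simp at h ⊢
    linarith
  · rw [Matrix.smul_mul, Matrix.smul_mul, Matrix.mul_smul, Matrix.mul_smul, Matrix.smul_mul, hGK, ← smul_add, hGK,
      ← r2]
    abel
  · rw [Matrix.mul_smul, hGK, sub_neg_eq_add, r1]


theorem rec_abs {n : ℕ} (v d : (Fin n → ℤ) → ℝ) (Φ K2 K1 c δ Q S0 : ℝ) (m : ℕ) (hm : 1 ≤ m)
    (hΦ : 0 ≤ Φ) (hK2 : 0 ≤ K2) (hK1 : 0 ≤ K1) (hc : 0 < c) (hδ : 0 < δ)
    (hv0 : ∀ α, 0 ≤ v α) (hneg : ∀ α, (∃ j, α j < 0) → v α = 0) (hS0 : ∀ α, v α ≤ S0)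
    (hrec : ∀ α, (∀ j, 0 ≤ α j) → d α * v α ≤ Φ
      + K2 * ∑ j, ∑ k, v (α - Pi.single j 1 - Pi.single k 1)
      + K1 * ∑ j, ∑ k, if j < k then ((α k : ℝ) + 1) * v (α - Pi.single j 1 + Pi.single k 1) else 0)
    (hdδ : ∀ α, (∀ j, 0 ≤ α j) → δ ≤ d α)
    (hdc : ∀ α, (∀ j, 0 ≤ α j) → (m : ℝ) ≤ ∑ j, (α j : ℝ) → c * ∑ j, (α j : ℝ) ≤ d α)
    (h4 : 4 * K2 * n ^ 2 ≤ c * m) (h8 : 8 * K1 * n ^ 2 ≤ c) (hQ1 : 1 ≤ Q)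
    (hQ : 1 + K2 * n ^ 2 + K1 * n ^ 2 * (m + 1) ≤ Q * δ) (α : Fin n → ℤ) :
    v α ≤ 2 * (Q ^ (n * m + 1) + 1 / c) * Φ := by
  have hle : ∀ α : Fin n → ℤ, (∀ j, 0 ≤ α j) → ∀ k, (α k : ℝ) ≤ ∑ j, (α j : ℝ) := by
    intro α hα k
    exact Finset.single_le_sum (f := fun j => (α j : ℝ)) (fun j _ => by exact_mod_cast hα j)
      (Finset.mem_univ k)
  -- bound given common bound on off-diagonal terms
  have hgen : ∀ α : Fin n → ℤ, (∀ j, 0 ≤ α j) → ∀ R : ℝ, 0 ≤ R →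
      (∀ j k, v (α - Pi.single j 1 - Pi.single k 1) ≤ R) →
      (∀ j k, j < k → v (α - Pi.single j 1 + Pi.single k 1) ≤ R) →
      d α * v α ≤ Φ + K2 * n ^ 2 * R + K1 * n ^ 2 * (∑ j, (α j : ℝ) + 1) * R := by
    intro α hα R hR h1 h2
    refine (hrec α hα).trans ?_
    have hs0 : 0 ≤ ∑ j, (α j : ℝ) := Finset.sum_nonneg fun j _ => by exact_mod_cast hα j
    have e1 : ∑ j, ∑ k, v (α - Pi.single j 1 - Pi.single k 1) ≤ ∑ j : Fin n, ∑ k : Fin n, R :=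
      Finset.sum_le_sum fun j _ => Finset.sum_le_sum fun k _ => h1 j k
    have e2 : (∑ j, ∑ k, if j < k then ((α k : ℝ) + 1) * v (α - Pi.single j 1 + Pi.single k 1) else 0)
        ≤ ∑ j : Fin n, ∑ k : Fin n, (∑ j, (α j : ℝ) + 1) * R := by
      refine Finset.sum_le_sum fun j _ => Finset.sum_le_sum fun k _ => ?_
      split_ifs with hjk
      · have := hle α hα k
        have h0 : (0:ℝ) ≤ α k := by exact_mod_cast hα k
        exact mul_le_mul (by linarith) (h2 j k hjk) (hv0 _) (by linarith)
      · positivity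
    simp only [Finset.sum_const, Finset.card_univ, Fintype.card_fin, nsmul_eq_mul] at e1 e2
    have := mul_le_mul_of_nonneg_left e1 hK2
    have := mul_le_mul_of_nonneg_left e2 hK1
    nlinarith
  -- low modes
  let W : (Fin n → ℤ) → ℤ := fun α => ∑ j, ((n : ℤ) - (j.val : ℤ)) * α j
  have hWadd : ∀ α β : Fin n → ℤ, W (α + β) = W α + W β := by
    intro α β; simp [W, mul_add, Finset.sum_add_distrib]
  have hWsub : ∀ α β : Fin n → ℤ, W (α - β) = W α - W β := by
    intro α β; simp [W, mul_sub, Finset.sum_sub_distrib]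
  have hWs : ∀ j : Fin n, W (Pi.single j 1) = n - j.val := by
    intro j; simp [W, Pi.single_apply]
  have hsum_s : ∀ j : Fin n, ∑ i, (Pi.single j (1:ℤ) : Fin n → ℤ) i = 1 := by
    intro j; simp [Pi.single_apply]
  have hlow : ∀ w : ℕ, ∀ α : Fin n → ℤ, (∀ j, 0 ≤ α j) → W α ≤ w → ∑ j, α j ≤ m →
      v α ≤ Q ^ (w + 1) * Φ := by
    intro w
    induction w with
    | zero =>
      intro α hα hw hs
      have hz : ∀ β : Fin n → ℤ, W β < 0 → v β = 0 := by
        intro β hβ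
        apply hneg
        by_contra! h
        have : 0 ≤ W β := Finset.sum_nonneg fun j _ => mul_nonneg (by have := j.isLt; omega) (h j)
        omega
      have h := hgen α hα 0 le_rfl
        (fun j k => (hz _ (by rw [hWsub, hWsub, hWs, hWs]; have := j.isLt; have := k.isLt; push_cast at hw; omega)).le)
        (fun j k hjk => (hz _ (by rw [hWadd, hWsub, hWs, hWs]; rw [Fin.lt_def] at hjk; push_cast at hw; omega)).le)
      have h1 := mul_le_mul_of_nonneg_right (hdδ α hα) (hv0 α)
      have h2 : δ * v α ≤ Φ := by linarith
      have h3 : 1 ≤ Q * δ := by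
        have : 0 ≤ K2 * n ^ 2 := by positivity
        have : 0 ≤ K1 * n ^ 2 * (m + 1) := by positivity
        linarith
      rw [zero_add, pow_one]
      have := mul_le_mul_of_nonneg_left h2 (by linarith : 0 ≤ Q)
      nlinarith [hv0 α]
    | succ w ih =>
      intro α hα hw hs
      set R := Q ^ (w + 1) * Φ with hR
      have hR0 : 0 ≤ R := by positivity
      have hRΦ : Φ ≤ R := by
        rw [hR]; exact le_mul_of_one_le_left hΦ (one_le_pow₀ hQ1)
      have hz : ∀ β : Fin n → ℤ, W β ≤ w → ∑ j, β j ≤ m → v β ≤ R := by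
        intro β h1 h2
        by_cases h : ∃ j, β j < 0
        · rw [hneg β h]; exact hR0
        · push Not at h
          exact ih β h h1 h2
      have h := hgen α hα R hR0
        (fun j k => hz _ (by rw [hWsub, hWsub, hWs, hWs]; have := j.isLt; have := k.isLt; push_cast at hw; omega)
          (by simp only [Pi.sub_apply, Finset.sum_sub_distrib, hsum_s]; omega))
        (fun j k hjk => hz _ (by rw [hWadd, hWsub, hWs, hWs]; rw [Fin.lt_def] at hjk; push_cast at hw; omega)
          (by simp only [Pi.sub_apply, Pi.add_apply, Finset.sum_sub_distrib, Finset.sum_add_distrib, hsum_s]; omega))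
      have hs' : ∑ j, (α j : ℝ) ≤ m := by exact_mod_cast hs
      have h1 := mul_le_mul_of_nonneg_right (hdδ α hα) (hv0 α)
      have h5 : K1 * n ^ 2 * (∑ j, (α j : ℝ) + 1) * R ≤ K1 * n ^ 2 * (m + 1) * R := by gcongr
      have h2 : δ * v α ≤ (Q * δ) * R := by
        calc δ * v α ≤ Φ + K2 * n ^ 2 * R + K1 * n ^ 2 * (m + 1) * R := by linarith
          _ ≤ (1 + K2 * n ^ 2 + K1 * n ^ 2 * (m + 1)) * R := by linarith
          _ ≤ _ := mul_le_mul_of_nonneg_right hQ hR0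
      have h3 : v α ≤ Q * R := by
        by_contra! h6
        have := mul_lt_mul_of_pos_left h6 hδ
        linarith
      calc v α ≤ Q * R := h3
        _ = _ := by rw [hR]; ring
  -- sup
  have hne : Nonempty (Fin n → ℤ) := ⟨0⟩
  have hbdd : BddAbove (Set.range v) := ⟨S0, by rintro _ ⟨α, rfl⟩; exact hS0 α⟩
  set S := ⨆ α, v α with hS
  have hvS : ∀ α, v α ≤ S := fun α => le_ciSup hbdd α
  have hSnn : 0 ≤ S := (hv0 0).trans (hvS 0)
  have hQp : 0 ≤ Q ^ (n * m + 1) * Φ := by positivity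
  have hall : ∀ α, v α ≤ (Q ^ (n * m + 1) + 1 / c) * Φ + S / 2 := by
    intro α
    have hcΦ : 0 ≤ 1 / c * Φ := by positivity
    by_cases h : ∃ j, α j < 0
    · rw [hneg α h, add_mul]; linarith
    push Not at h
    by_cases hs : ∑ j, α j ≤ m
    · have hWb : W α ≤ ((n * m : ℕ) : ℤ) := by
        calc W α ≤ ∑ j, (n : ℤ) * α j := Finset.sum_le_sum fun j _ =>
              mul_le_mul_of_nonneg_right (by omega) (h j)
          _ = n * ∑ j, α j := by rw [Finset.mul_sum]
          _ ≤ n * m := mul_le_mul_of_nonneg_left hs (by omega)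
          _ = _ := by push_cast; ring
      have := hlow _ α h hWb hs
      rw [add_mul]; linarith
    · have hs' : (m : ℝ) ≤ ∑ j, (α j : ℝ) := by
        have : (m : ℤ) ≤ ∑ j, α j := by omega
        exact_mod_cast this
      have hm1 : (1 : ℝ) ≤ m := by exact_mod_cast hm
      have h1 := hgen α h S hSnn (fun _ _ => hvS _) (fun _ _ _ => hvS _)
      have h2 := mul_le_mul_of_nonneg_right (hdc α h hs') (hv0 α)
      set s := ∑ j, (α j : ℝ)
      have h5 : K2 * n ^ 2 * S ≤ c * s / 4 * S := by
        apply mul_le_mul_of_nonneg_right _ hSnn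
        have := mul_le_mul_of_nonneg_left hs' hc.le
        linarith
      have h6 : K1 * n ^ 2 * (s + 1) * S ≤ c * s / 4 * S := by
        apply mul_le_mul_of_nonneg_right _ hSnn
        have : K1 * n ^ 2 * (s + 1) ≤ K1 * n ^ 2 * (2 * s) := by
          apply mul_le_mul_of_nonneg_left _ (by positivity); linarith
        nlinarith
      have h7 : Φ ≤ s * Φ := le_mul_of_one_le_left hΦ (by linarith)
      have h8 : (c * s) * v α ≤ (c * s) * (1 / c * Φ + S / 2) := by
        have : (c * s) * (1 / c * Φ + S / 2) = s * Φ + c * s / 2 * S := by field_simp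
        rw [this]; linarith
      have h9 := le_of_mul_le_mul_left h8 (mul_pos hc (by linarith))
      rw [add_mul]; linarith
  have hSle : S ≤ (Q ^ (n * m + 1) + 1 / c) * Φ + S / 2 := ciSup_le hall
  have := hvS α
  linarith


/-- eigenvalues indexed by integers -/
noncomputable def eigv {n : ℕ} (lam : Fin n → ℂ) (α : Fin n → ℤ) : ℂ :=
  -Complex.I * ∑ j, lam j * (2 * (α j : ℂ) + 1)

/-- monomial weight -/
noncomputable def wt {n : ℕ} (r b : ℝ) (α : Fin n → ℤ) : ℝ := ∏ j, (r * b ^ (j.val)) ^ (α j)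

theorem wt_pos {n : ℕ} {r b : ℝ} (hr : 0 < r) (hb : 0 < b) (α : Fin n → ℤ) : 0 < wt r b α :=
  Finset.prod_pos fun j _ => by positivity

theorem wt_add {n : ℕ} {r b : ℝ} (hr : 0 < r) (hb : 0 < b) (α β : Fin n → ℤ) :
    wt r b (α + β) = wt r b α * wt r b β := by
  unfold wt
  rw [← Finset.prod_mul_distrib]
  exact Finset.prod_congr rfl fun j _ => by rw [Pi.add_apply, zpow_add₀ (by positivity)]

theorem wt_sub {n : ℕ} {r b : ℝ} (hr : 0 < r) (hb : 0 < b) (α β : Fin n → ℤ) :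
    wt r b (α - β) = wt r b α / wt r b β := by
  unfold wt
  rw [← Finset.prod_div_distrib]
  exact Finset.prod_congr rfl fun j _ => by rw [Pi.sub_apply, zpow_sub₀ (by positivity)]

theorem wt_single {n : ℕ} (r b : ℝ) (j : Fin n) :
    wt r b (Pi.single j 1) = r * b ^ j.val := by
  unfold wt
  rw [Finset.prod_eq_single j]
  · simp
  · intro k _ hk; simp [hk]
  · simp

theorem exists_lower {n : ℕ} (f : Fin n → ℝ) (hf : ∀ j, 0 < f j) : ∃ c > 0, ∀ j, c ≤ f j := by
  refine ⟨1 / (1 + ∑ j, 1 / f j), ?_, ?_⟩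
  · have : 0 ≤ ∑ j, 1 / f j := Finset.sum_nonneg fun j _ => by have := hf j; positivity
    positivity
  · intro j
    have h1 : 1 / f j ≤ ∑ j, 1 / f j := Finset.single_le_sum (f := fun j => 1 / f j)
      (fun j _ => by have := hf j; positivity) (Finset.mem_univ j)
    have h2 := hf j
    rw [div_le_iff₀ (by have : 0 < 1 / f j := by positivity
                        linarith)]
    have : f j * (1 / f j) = 1 := by field_simp
    nlinarith

theorem eig_lower {n : ℕ} (lam : Fin n → ℂ) (c : ℝ) (hc : 0 < c) (hcl : ∀ j, c ≤ (lam j).im)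
    (α : Fin n → ℤ) (hα : ∀ j, 0 ≤ α j) (ζ : ℂ) (m : ℝ) (hζ : ‖ζ‖ ≤ c * m)
    (hm : m ≤ ∑ j, (α j : ℝ)) : c * ∑ j, (α j : ℝ) ≤ ‖eigv lam α - ζ‖ := by
  have h1 : (eigv lam α).re = ∑ j, (lam j).im * (2 * (α j : ℝ) + 1) := by
    unfold eigv
    simp [Complex.im_sum]
  have h2 : 2 * c * ∑ j, (α j : ℝ) ≤ (eigv lam α).re := by
    rw [h1, Finset.mul_sum]
    refine Finset.sum_le_sum fun j _ => ?_
    have : (0:ℝ) ≤ α j := by exact_mod_cast hα j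
    have := mul_le_mul_of_nonneg_right (hcl j) (by linarith : (0:ℝ) ≤ 2 * α j + 1)
    linarith
  have h3 := Complex.re_le_norm (eigv lam α)
  have h4 := norm_sub_norm_le (eigv lam α) ζ
  have h5 := mul_le_mul_of_nonneg_left hm hc.le
  linarith

theorem rec_main {n : ℕ} (C' M : Matrix (Fin n) (Fin n) ℂ) (lam : Fin n → ℂ)
    (hlam : ∀ j, 0 < (lam j).im) :
    ∃ b ≥ (1:ℝ), ∃ Kc ≥ (1:ℝ), ∀ (r δ : ℝ) (ζ : ℂ) (m : ℕ), 0 < r → 0 < δ → δ ≤ 1 → 1 ≤ m →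
      Kc * ‖ζ‖ ≤ m → Kc * r ^ 2 ≤ m →
      ∀ (V Fv : (Fin n → ℤ) → ℂ) (Φ S0 : ℝ), 0 ≤ Φ → (∀ α, (∃ j, α j < 0) → V α = 0) →
      (∀ α, ‖V α‖ * wt r b α ≤ S0) → (∀ α, (∀ j, 0 ≤ α j) → ‖Fv α‖ * wt r b α ≤ Φ) →
      (∀ α, (∀ j, 0 ≤ α j) → (eigv lam α - ζ) * V α = Fv α
        + ∑ j, ∑ k, C' j k * V (α - Pi.single j 1 - Pi.single k 1)
        - 2 * Complex.I * ∑ j, ∑ k, if j < k then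
          M j k * ((α k : ℂ) + 1) * V (α - Pi.single j 1 + Pi.single k 1) else 0) →
      (∀ α, (∀ j, 0 ≤ α j) → δ ≤ ‖eigv lam α - ζ‖) →
      ∀ α, ‖V α‖ * wt r b α ≤ 2 * ((Kc * m / δ) ^ (n * m + 1) + Kc) * Φ := by
  obtain ⟨c, hc, hcl⟩ := exists_lower _ hlam
  set Cm : ℝ := ∑ j, ∑ k, ‖C' j k‖ with hCm
  set Mm : ℝ := ∑ j, ∑ k, ‖M j k‖ with hMm
  have hle : ∀ (D : Matrix (Fin n) (Fin n) ℂ) j k, ‖D j k‖ ≤ ∑ j, ∑ k, ‖D j k‖ := by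
    intro D j k
    refine (Finset.single_le_sum (f := fun k => ‖D j k‖) (fun _ _ => norm_nonneg _)
      (Finset.mem_univ k)).trans ?_
    exact Finset.single_le_sum (f := fun j => ∑ k, ‖D j k‖)
      (fun _ _ => Finset.sum_nonneg fun _ _ => norm_nonneg _) (Finset.mem_univ j)
  have hCm0 : 0 ≤ Cm := Finset.sum_nonneg fun _ _ => Finset.sum_nonneg fun _ _ => norm_nonneg _
  have hMm0 : 0 ≤ Mm := Finset.sum_nonneg fun _ _ => Finset.sum_nonneg fun _ _ => norm_nonneg _
  set b : ℝ := 1 + 16 * Mm * n ^ 2 / c with hb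
  have hb1 : 1 ≤ b := by rw [hb]; have : 0 ≤ 16 * Mm * n ^ 2 / c := by positivity
                         linarith
  have hb0 : 0 < b := by linarith
  set Kc : ℝ := 1 + c + 1 / c + 4 * Cm * b ^ (2 * n) * n ^ 2 / c with hKc
  have hx1 : 0 < 1 / c := by positivity
  have hx2 : 0 ≤ 4 * Cm * b ^ (2 * n) * n ^ 2 / c := by positivity
  have hKc1 : 1 ≤ Kc := by rw [hKc]; linarith
  refine ⟨b, hb1, Kc, hKc1, ?_⟩
  intro r δ ζ m hr hδ hδ1 hm hζ hrm V Fv Φ S0 hΦ hVneg hVb hFb hrec heig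
  have hm1 : (1:ℝ) ≤ m := by exact_mod_cast hm
  have hK1b : 8 * (2 * Mm / b) * n ^ 2 ≤ c := by
    have : 8 * (2 * Mm / b) * n ^ 2 = (16 * Mm * n ^ 2) / b := by ring
    rw [this, div_le_iff₀ hb0, hb, mul_add, mul_div_cancel₀ _ hc.ne']
    linarith
  have hK2b : 4 * (Cm * r ^ 2 * b ^ (2 * n)) * n ^ 2 ≤ c * m := by
    have h1 : 4 * Cm * b ^ (2 * n) * n ^ 2 / c * r ^ 2 ≤ m := by
      refine le_trans (mul_le_mul_of_nonneg_right ?_ (sq_nonneg r)) hrm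
      rw [hKc]; linarith
    have h2 := mul_le_mul_of_nonneg_left h1 hc.le
    refine le_trans (le_of_eq ?_) h2
    field_simp
  have hcr : ∀ α, ‖V α‖ * wt r b α ≤ 2 * ((Kc * m / δ) ^ (n * m + 1) + 1 / c) * Φ := by
    apply rec_abs (fun α => ‖V α‖ * wt r b α) (fun α => ‖eigv lam α - ζ‖) Φ
      (Cm * r ^ 2 * b ^ (2 * n)) (2 * Mm / b) c δ (Kc * m / δ) S0 m hm hΦ (by positivity)
      (by positivity) hc hδ
    · intro α; exact mul_nonneg (norm_nonneg _) (wt_pos hr hb0 α).le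
    · intro α h; simp [hVneg α h]
    · exact hVb
    · intro α hα
      have hw := wt_pos hr hb0 α
      have e := congrArg norm (hrec α hα)
      rw [norm_mul] at e
      calc ‖eigv lam α - ζ‖ * (‖V α‖ * wt r b α)
          = ‖Fv α + ∑ j, ∑ k, C' j k * V (α - Pi.single j 1 - Pi.single k 1)
        - 2 * Complex.I * ∑ j, ∑ k, if j < k then
          M j k * ((α k : ℂ) + 1) * V (α - Pi.single j 1 + Pi.single k 1) else 0‖ * wt r b α := by
            rw [← e]; ring
        _ ≤ (‖Fv α‖ + ∑ j, ∑ k, ‖C' j k * V (α - Pi.single j 1 - Pi.single k 1)‖ +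
            2 * ∑ j, ∑ k, ‖if j < k then
          M j k * ((α k : ℂ) + 1) * V (α - Pi.single j 1 + Pi.single k 1) else 0‖) * wt r b α := by
            refine mul_le_mul_of_nonneg_right ?_ hw.le
            refine (norm_sub_le _ _).trans (add_le_add ((norm_add_le _ _).trans
              (add_le_add le_rfl ?_)) ?_)
            · exact (norm_sum_le _ _).trans (Finset.sum_le_sum fun j _ => norm_sum_le _ _)
            · rw [norm_mul, norm_mul, Complex.norm_I, Complex.norm_two, mul_one]
              refine mul_le_mul_of_nonneg_left ?_ (by norm_num)
              exact (norm_sum_le _ _).trans (Finset.sum_le_sum fun j _ => norm_sum_le _ _)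
        _ = ‖Fv α‖ * wt r b α
            + (∑ j, ∑ k, ‖C' j k * V (α - Pi.single j 1 - Pi.single k 1)‖ * wt r b α) +
            ∑ j, ∑ k, 2 * ‖if j < k then
          M j k * ((α k : ℂ) + 1) * V (α - Pi.single j 1 + Pi.single k 1) else 0‖ * wt r b α := by
            rw [add_mul, add_mul, Finset.sum_mul, mul_assoc, Finset.sum_mul, Finset.mul_sum]
            simp only [Finset.sum_mul, Finset.mul_sum, mul_assoc]
        _ ≤ _ := by
            refine add_le_add (add_le_add (hFb α hα) ?_) ?_
            · rw [Finset.mul_sum]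
              refine Finset.sum_le_sum fun j _ => ?_
              rw [Finset.mul_sum]
              refine Finset.sum_le_sum fun k _ => ?_
              rw [wt_sub hr hb0, wt_sub hr hb0, wt_single, wt_single, norm_mul]
              have h1 : ‖C' j k‖ ≤ Cm := hle C' j k
              have h2 : b ^ j.val * b ^ k.val ≤ b ^ (2 * n) := by
                rw [← pow_add]
                exact pow_le_pow_right₀ hb1 (by have := j.isLt; have := k.isLt; omega)
              have h3 : ‖C' j k‖ * (b ^ j.val * b ^ k.val) ≤ Cm * b ^ (2 * n) := by gcongr
              set X := ‖V (α - Pi.single j 1 - Pi.single k 1)‖ *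
                (wt r b α / (r * b ^ j.val) / (r * b ^ k.val)) with hX
              have hX0 : 0 ≤ X := by positivity
              have : ‖C' j k‖ * ‖V (α - Pi.single j 1 - Pi.single k 1)‖ * wt r b α =
                 (‖C' j k‖ * (b ^ j.val * b ^ k.val)) * (r ^ 2 * X) := by
                rw [hX]; field_simp
              rw [this]
              calc _ ≤ (Cm * b ^ (2 * n)) * (r ^ 2 * X) := by gcongr
                _ = _ := by ring
            · rw [Finset.mul_sum]
              refine Finset.sum_le_sum fun j _ => ?_
              rw [Finset.mul_sum]
              refine Finset.sum_le_sum fun k _ => ?_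
              split_ifs with hjk
              swap
              · simp
              rw [wt_add hr hb0, wt_sub hr hb0, wt_single, wt_single, norm_mul, norm_mul]
              have h1 : ‖M j k‖ ≤ Mm := hle M j k
              have h0 : (0:ℝ) ≤ α k := by exact_mod_cast hα k
              have h2 : ‖((α k : ℂ) + 1)‖ = (α k : ℝ) + 1 := by
                have : ((α k : ℂ) + 1) = (((α k : ℝ) + 1 : ℝ) : ℂ) := by push_cast; rfl
                rw [this, Complex.norm_real, Real.norm_of_nonneg (by linarith)]
              rw [h2]
              have h3 : b ^ j.val * b ≤ b ^ k.val := by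
                rw [← pow_succ]; exact pow_le_pow_right₀ hb1 (by rw [Fin.lt_def] at hjk; omega)
              have h4 : b ^ j.val / b ^ k.val ≤ 1 / b := by
                rw [div_le_div_iff₀ (by positivity) hb0]; linarith
              set X := ‖V (α - Pi.single j 1 + Pi.single k 1)‖ *
                (wt r b α / (r * b ^ j.val) * (r * b ^ k.val)) with hX
              have hX0 : 0 ≤ X := by positivity
              have : 2 * (‖M j k‖ * ((α k : ℝ) + 1) * ‖V (α - Pi.single j 1 + Pi.single k 1)‖) * wt r b α =
                 (2 * ‖M j k‖ * (b ^ j.val / b ^ k.val)) * (((α k : ℝ) + 1) * X) := by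
                rw [hX]; field_simp
              rw [this]
              calc _ ≤ (2 * Mm * (1 / b)) * (((α k : ℝ) + 1) * X) := by gcongr
                _ = _ := by ring
    · exact heig
    · intro α hα hmα
      apply eig_lower lam c hc hcl α hα ζ m _ hmα
      have h1 : 1 / c * ‖ζ‖ ≤ m := by
        refine le_trans (mul_le_mul_of_nonneg_right ?_ (norm_nonneg _)) hζ
        rw [hKc]; linarith
      have h2 := mul_le_mul_of_nonneg_left h1 hc.le
      refine le_trans (le_of_eq ?_) h2
      field_simp
    · exact hK2b
    · exact hK1b
    · rw [le_div_iff₀ hδ]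
      nlinarith
    · rw [div_mul_cancel₀ _ hδ.ne']
      have h1 : (1 + c) * m ≤ Kc * m := by
        apply mul_le_mul_of_nonneg_right _ (by linarith); rw [hKc]; linarith
      have h2 : 2 * Mm / b * n ^ 2 * (m + 1) ≤ c / 8 * (m + 1) := by
        apply mul_le_mul_of_nonneg_right _ (by linarith); linarith
      nlinarith
  intro α
  refine (hcr α).trans ?_
  have : 1 / c ≤ Kc := by rw [hKc]; linarith
  gcongr


/-- shorthand for Euclidean space -/
abbrev EE (n : ℕ) := EuclideanSpace ℝ (Fin n)

theorem exp_iter_bound (N : ℕ) : ∀ n, n ≤ N → ∀ w : ℂ,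
    ‖iteratedFDeriv ℝ n Complex.exp w‖ ≤
      (1 + ‖(ContinuousLinearMap.mul ℝ ℂ)‖) ^ N * ‖Complex.exp w‖ := by
  have h : ∀ n, ∀ w : ℂ, ‖iteratedFDeriv ℝ n Complex.exp w‖ ≤
      ‖(ContinuousLinearMap.mul ℝ ℂ)‖ ^ n * ‖Complex.exp w‖ := by
    intro n
    induction n with
    | zero => intro w; simp
    | succ n ih =>
      intro w
      rw [← norm_iteratedFDeriv_fderiv]
      have h1 : fderiv ℝ Complex.exp = (ContinuousLinearMap.mul ℝ ℂ) ∘ Complex.exp := by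
        ext1 z
        have h2 : HasFDerivAt Complex.exp ((ContinuousLinearMap.mul ℝ ℂ) (Complex.exp z)) z := by
          refine (Complex.hasDerivAt_exp z).complexToReal_fderiv.congr_fderiv ?_
          ext w; simp
        rw [h2.fderiv]; rfl
      rw [h1]
      refine ((ContinuousLinearMap.mul ℝ ℂ).norm_iteratedFDeriv_comp_left
        (Complex.contDiff_exp.contDiffAt (n := n)) le_rfl).trans ?_
      rw [pow_succ', mul_assoc]
      exact mul_le_mul_of_nonneg_left (ih w) (norm_nonneg _)
  intro n hn w
  refine (h n w).trans (mul_le_mul_of_nonneg_right ?_ (norm_nonneg _))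
  have h0 := norm_nonneg (ContinuousLinearMap.mul ℝ ℂ)
  generalize ‖(ContinuousLinearMap.mul ℝ ℂ)‖ = K at h0 ⊢
  calc K ^ n ≤ (1 + K) ^ n := pow_le_pow_left₀ h0 (by linarith) n
    _ ≤ (1 + K) ^ N := pow_le_pow_right₀ (by linarith) hn

theorem exp_comp_temp {D : Type*} [NormedAddCommGroup D] [NormedSpace ℝ D] {f : D → ℂ}
    (hf : f.HasTemperateGrowth) (b : ℝ) (hb : ∀ x, (f x).re < b) :
    Function.HasTemperateGrowth (fun x => Complex.exp (f x)) := by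
  have hopen : IsOpen {w : ℂ | w.re < b} := isOpen_lt Complex.continuous_re continuous_const
  apply Function.HasTemperateGrowth.comp' (g := Complex.exp) (t := {w : ℂ | w.re < b}) _
    hopen.uniqueDiffOn Complex.contDiff_exp.contDiffOn _ hf
  · rintro _ ⟨x, rfl⟩; exact hb x
  · intro N
    refine ⟨0, (1 + ‖(ContinuousLinearMap.mul ℝ ℂ)‖) ^ N * Real.exp b, by positivity, ?_⟩
    intro n hn w hw
    rw [iteratedFDerivWithin_of_isOpen n hopen hw]
    refine (exp_iter_bound N n hn w).trans ?_
    rw [pow_zero, mul_one, Complex.norm_exp]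
    have : Real.exp w.re ≤ Real.exp b := Real.exp_le_exp.mpr (le_of_lt hw)
    gcongr

theorem coord_temp {n : ℕ} (j : Fin n) :
    Function.HasTemperateGrowth (fun x : EE n => ((x j : ℝ) : ℂ)) :=
  (Complex.ofRealCLM ∘L (EuclideanSpace.proj j : EE n →L[ℝ] ℝ)).hasTemperateGrowth

theorem int_ts {n : ℕ} {ψ : EE n → ℂ} (hψ : ψ.HasTemperateGrowth) (u : SchwartzMap (EE n) ℂ) :
    Integrable (fun x => ψ x * u x) := by
  have := (SchwartzMap.smulLeftCLM ℂ ψ u).integrable (μ := volume)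
  simpa [SchwartzMap.smulLeftCLM_apply hψ] using this

theorem fderiv_temp {n : ℕ} {ψ : EE n → ℂ} (hψ : ψ.HasTemperateGrowth) (v : EE n) :
    Function.HasTemperateGrowth (fun x => fderiv ℝ ψ x v) := by
  have h1 : Function.HasTemperateGrowth (fderiv ℝ ψ) := by
    refine ⟨hψ.1.fderiv_right (by simp), fun k => ?_⟩
    obtain ⟨l, C, h⟩ := hψ.2 (k + 1)
    exact ⟨l, C, fun x => by rw [norm_iteratedFDeriv_fderiv]; exact h x⟩
  exact (ContinuousLinearMap.apply ℝ ℂ v).hasTemperateGrowth.comp h1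

theorem ibp {n : ℕ} {ψ : EE n → ℂ} (hψ : ψ.HasTemperateGrowth) (u : SchwartzMap (EE n) ℂ)
    (v : EE n) : ∫ x, ψ x * fderiv ℝ u x v = - ∫ x, fderiv ℝ ψ x v * u x := by
  have hd : Function.HasTemperateGrowth (fun x => fderiv ℝ ψ x v) := fderiv_temp hψ v
  apply integral_mul_fderiv_eq_neg_fderiv_mul_of_integrable
  · exact int_ts hd u
  · exact int_ts hψ (LineDeriv.lineDerivOp v u)
  · exact int_ts hψ u
  · exact fun x _ => hψ.1.differentiable (by simp) x
  · exact fun x _ => u.differentiable x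


/-- divided powers -/
noncomputable def dp (m : ℤ) (y : ℂ) : ℂ := if m < 0 then 0 else y ^ m.toNat / (m.toNat.factorial : ℂ)

/-- linear forms -/
noncomputable def lf {n : ℕ} (T : Matrix (Fin n) (Fin n) ℂ) (j : Fin n) (x : EE n) : ℂ :=
  ∑ k, T j k * (x k : ℂ)

/-- complex gaussian -/
noncomputable def gau {n : ℕ} (G : Matrix (Fin n) (Fin n) ℂ) (x : EE n) : ℂ :=
  Complex.exp (-(1/2) * ∑ j, ∑ k, G j k * (x j : ℂ) * (x k : ℂ))

/-- generalized dual modes -/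
noncomputable def psi {n : ℕ} (G T : Matrix (Fin n) (Fin n) ℂ) (α : Fin n → ℤ) (x : EE n) : ℂ :=
  (∏ j, dp (α j) (lf T j x)) * gau G x

/-- partial derivative -/
noncomputable def pd {n : ℕ} (k : Fin n) (f : EE n → ℂ) (x : EE n) : ℂ :=
  fderiv ℝ f x (EuclideanSpace.single k 1)

theorem dp_deriv (m : ℤ) (y : ℂ) : HasDerivAt (dp m) (dp (m - 1) y) y := by
  rcases lt_trichotomy m 0 with h | h | h
  · have h1 : dp m = fun _ => 0 := by ext z; simp [dp, h]
    have h2 : dp (m - 1) y = 0 := by simp [dp]; omega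
    rw [h1, h2]; exact hasDerivAt_const _ _
  · subst h
    have h1 : dp 0 = fun _ => 1 := by ext z; simp [dp]
    have h2 : dp (0 - 1) y = 0 := by simp [dp]
    rw [h1, h2]; exact hasDerivAt_const _ _
  · obtain ⟨k, rfl⟩ : ∃ k : ℕ, m = k + 1 := ⟨(m - 1).toNat, by omega⟩
    have h1 : dp (k + 1) = fun z => z ^ (k + 1) / ((k + 1).factorial : ℂ) := by
      ext z
      have : ¬ ((k:ℤ) + 1 < 0) := by omega
      simp only [dp, this, if_false]
      rfl
    have h2 : dp (k + 1 - 1) y = y ^ k / (k.factorial : ℂ) := by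
      simp [dp]
    rw [h1, h2]
    have := (hasDerivAt_pow (k + 1) y).div_const ((k + 1).factorial : ℂ)
    refine this.congr_deriv ?_
    rw [Nat.factorial_succ, Nat.add_sub_cancel]
    push_cast
    have : (k.factorial : ℂ) ≠ 0 := by exact_mod_cast k.factorial_ne_zero
    have : (k : ℂ) + 1 ≠ 0 := by exact_mod_cast k.succ_ne_zero
    field_simp

theorem dp_mul (m : ℤ) (y : ℂ) : y * dp m y = ((m : ℂ) + 1) * dp (m + 1) y := by
  rcases lt_trichotomy m (-1) with h | h | h
  · have h1 : m < 0 := by omega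
    have h2 : m + 1 < 0 := by omega
    simp [dp, h1, h2]
  · subst h; simp [dp]
  · obtain ⟨k, rfl⟩ : ∃ k : ℕ, m = k := ⟨m.toNat, by omega⟩
    have h3 : ¬ ((k:ℤ) + 1 < 0) := by omega
    have h1 : dp (k + 1) y = y ^ (k + 1) / ((k + 1).factorial : ℂ) := by
      simp only [dp, h3, if_false]
      rfl
    rw [h1]
    simp only [dp]
    rw [if_neg (by omega)]
    simp only [Int.toNat_natCast]
    rw [Nat.factorial_succ]
    push_cast
    have : (k.factorial : ℂ) ≠ 0 := by exact_mod_cast k.factorial_ne_zero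
    have : (k : ℂ) + 1 ≠ 0 := by exact_mod_cast k.succ_ne_zero
    field_simp
    ring

theorem lf_temp {n : ℕ} (T : Matrix (Fin n) (Fin n) ℂ) (j : Fin n) :
    Function.HasTemperateGrowth (fun x : EE n => lf T j x) := by
  unfold lf
  apply Function.HasTemperateGrowth.sum
  intro k _
  exact (Function.HasTemperateGrowth.const (T j k)).fun_mul (coord_temp k)

theorem prod_temp {n : ℕ} {ι : Type*} (s : Finset ι) (f : ι → EE n → ℂ)
    (hf : ∀ i ∈ s, (f i).HasTemperateGrowth) :
    Function.HasTemperateGrowth (fun x => ∏ i ∈ s, f i x) := by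
  classical
  induction s using Finset.induction_on with
  | empty => simpa using Function.HasTemperateGrowth.const (1:ℂ)
  | insert a s ha ih =>
    simp only [Finset.prod_insert ha]
    exact (hf a (by simp)).fun_mul (ih fun i hi => hf i (by simp [hi]))

theorem dp_lf_temp {n : ℕ} (T : Matrix (Fin n) (Fin n) ℂ) (j : Fin n) (m : ℤ) :
    Function.HasTemperateGrowth (fun x : EE n => dp m (lf T j x)) := by
  unfold dp
  by_cases h : m < 0
  · simp only [h, if_true]; exact Function.HasTemperateGrowth.const 0
  · simp only [h, if_false, div_eq_mul_inv]
    exact ((lf_temp T j).fun_pow _).fun_mul (Function.HasTemperateGrowth.const _)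

theorem quad_temp {n : ℕ} (G : Matrix (Fin n) (Fin n) ℂ) :
    Function.HasTemperateGrowth (fun x : EE n => ∑ j, ∑ k, G j k * (x j : ℂ) * (x k : ℂ)) := by
  apply Function.HasTemperateGrowth.sum
  intro j _
  apply Function.HasTemperateGrowth.sum
  intro k _
  exact ((Function.HasTemperateGrowth.const (G j k)).fun_mul (coord_temp j)).fun_mul (coord_temp k)

theorem gau_temp {n : ℕ} (G : Matrix (Fin n) (Fin n) ℂ)
    (hG : ∀ x : EE n, 0 ≤ (∑ j, ∑ k, G j k * (x j : ℂ) * (x k : ℂ)).re) :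
    Function.HasTemperateGrowth (gau G) := by
  unfold gau
  apply exp_comp_temp ((Function.HasTemperateGrowth.const _).fun_mul (quad_temp G)) 1
  intro x
  have := hG x
  have h2 : (-(1/2) * ∑ j, ∑ k, G j k * (x j : ℂ) * (x k : ℂ)).re =
    -(1/2) * (∑ j, ∑ k, G j k * (x j : ℂ) * (x k : ℂ)).re := by
    have : (-(1/2) : ℂ) = ((-(1/2) : ℝ) : ℂ) := by push_cast; rfl
    rw [this, Complex.re_ofReal_mul]
  rw [h2]; linarith

theorem psi_temp {n : ℕ} (G T : Matrix (Fin n) (Fin n) ℂ)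
    (hG : ∀ x : EE n, 0 ≤ (∑ j, ∑ k, G j k * (x j : ℂ) * (x k : ℂ)).re) (α : Fin n → ℤ) :
    Function.HasTemperateGrowth (psi G T α) :=
  (prod_temp _ _ fun j _ => dp_lf_temp T j (α j)).fun_mul (gau_temp G hG)

theorem lf_hasFDeriv {n : ℕ} (T : Matrix (Fin n) (Fin n) ℂ) (j k : Fin n) (x : EE n) :
    HasLineDerivAt ℝ (lf T j) (T j k) x (EuclideanSpace.single k 1) := by
  unfold HasLineDerivAt
  have : (fun t : ℝ => lf T j (x + t • EuclideanSpace.single k (1:ℝ))) =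
      fun t : ℝ => lf T j x + (t : ℂ) * T j k := by
    ext t
    simp only [lf, PiLp.add_apply, PiLp.smul_apply, smul_eq_mul, PiLp.single_apply]
    push_cast
    simp only [mul_add, Finset.sum_add_distrib]
    congr 1
    rw [Finset.sum_eq_single k]
    · simp; ring
    · intro l _ hl; simp [hl]
    · simp
  rw [this]
  have h1 : HasDerivAt (fun t : ℝ => (t : ℂ)) 1 0 := Complex.ofRealCLM.hasDerivAt
  simpa using (h1.mul_const (T j k)).const_add (lf T j x)

theorem gau_eq {n : ℕ} (G : Matrix (Fin n) (Fin n) ℂ) (x : EE n) :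
    gau G x = Complex.exp (-(1/2) * ∑ j, (x j : ℂ) * lf G j x) := by
  unfold gau lf
  congr 2
  refine Finset.sum_congr rfl fun j _ => ?_
  rw [Finset.mul_sum]
  refine Finset.sum_congr rfl fun k _ => by ring

theorem gau_line {n : ℕ} (G : Matrix (Fin n) (Fin n) ℂ) (hGs : G.IsSymm) (k : Fin n) (x : EE n) :
    HasLineDerivAt ℝ (gau G) (-(lf G k x) * gau G x) x (EuclideanSpace.single k 1) := by
  have hc : ∀ j, HasDerivAt (fun t : ℝ => (((x + t • EuclideanSpace.single k (1:ℝ)) j : ℝ) : ℂ))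
      ((1 : Matrix (Fin n) (Fin n) ℂ) j k) 0 := by
    intro j
    have := lf_hasFDeriv (1 : Matrix (Fin n) (Fin n) ℂ) j k x
    unfold HasLineDerivAt at this
    have h2 : ∀ y : EE n, lf (1 : Matrix (Fin n) (Fin n) ℂ) j y = (y j : ℂ) := by
      intro y; simp [lf, Matrix.one_apply]
    simpa only [h2] using this
  unfold HasLineDerivAt
  simp only [gau_eq]
  have h1 : HasDerivAt (fun t : ℝ => ∑ j, (((x + t • EuclideanSpace.single k (1:ℝ)) j : ℝ) : ℂ) *
      lf G j (x + t • EuclideanSpace.single k (1:ℝ))) (2 * lf G k x) 0 := by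
    have := HasDerivAt.fun_sum (u := Finset.univ) (fun j _ => (hc j).mul (lf_hasFDeriv G j k x))
    refine this.congr_deriv ?_
    simp only [zero_smul, add_zero, Matrix.one_apply, ite_mul, one_mul, zero_mul]
    rw [Finset.sum_add_distrib, Finset.sum_ite_eq' Finset.univ k, if_pos (Finset.mem_univ k), two_mul]
    congr 1
    unfold lf
    exact Finset.sum_congr rfl fun j _ => by rw [hGs.apply]; ring
  have h2 := (h1.const_mul (-(1/2) : ℂ)).cexp
  refine h2.congr_deriv ?_
  simp only [zero_smul, add_zero]
  ring

theorem psi_line {n : ℕ} (G T : Matrix (Fin n) (Fin n) ℂ) (hGs : G.IsSymm) (α : Fin n → ℤ)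
    (k : Fin n) (x : EE n) :
    HasLineDerivAt ℝ (psi G T α) ((∑ j, T j k * psi G T (α - Pi.single j 1) x)
      - lf G k x * psi G T α x) x (EuclideanSpace.single k 1) := by
  have h1 : ∀ j, HasDerivAt (fun t : ℝ => dp (α j) (lf T j (x + t • EuclideanSpace.single k (1:ℝ))))
      (dp (α j - 1) (lf T j x) * T j k) 0 := by
    intro j
    have h2 := lf_hasFDeriv T j k x
    unfold HasLineDerivAt at h2
    have h3 : HasDerivAt (fun t : ℝ => dp (α j) (lf T j (x + t • EuclideanSpace.single k (1:ℝ))))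
      (dp (α j - 1) (lf T j (x + (0:ℝ) • EuclideanSpace.single k (1:ℝ))) * T j k) 0 :=
      HasDerivAt.comp (h₂ := dp (α j))
        (h := fun t : ℝ => lf T j (x + t • EuclideanSpace.single k (1:ℝ))) (0:ℝ)
        (dp_deriv (α j) (lf T j (x + (0:ℝ) • EuclideanSpace.single k (1:ℝ)))) h2
    refine h3.congr_deriv ?_
    simp only [zero_smul, add_zero]
  have h4 := HasDerivAt.fun_finsetProd (u := Finset.univ) (fun j _ => h1 j)
  have h5 := h4.mul (gau_line G hGs k x)
  unfold HasLineDerivAt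
  refine h5.congr_deriv ?_
  simp only [zero_smul, add_zero]
  rw [Finset.sum_mul, sub_eq_add_neg]
  congr 1
  · refine Finset.sum_congr rfl fun j _ => ?_
    unfold psi
    rw [← Finset.mul_prod_erase Finset.univ _ (Finset.mem_univ j)]
    have : ∏ i ∈ Finset.univ.erase j, dp ((α - Pi.single j 1 : Fin n → ℤ) i) (lf T i x)
        = ∏ i ∈ Finset.univ.erase j, dp (α i) (lf T i x) := by
      refine Finset.prod_congr rfl fun i hi => ?_
      have := (Finset.mem_erase.mp hi).1
      simp [this]
    rw [this]
    simp
    ring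
  · unfold psi; ring

theorem pd_psi {n : ℕ} (G T : Matrix (Fin n) (Fin n) ℂ) (hGs : G.IsSymm)
    (hG : ∀ x : EE n, 0 ≤ (∑ j, ∑ k, G j k * (x j : ℂ) * (x k : ℂ)).re) (α : Fin n → ℤ)
    (k : Fin n) (x : EE n) :
    pd k (psi G T α) x = (∑ j, T j k * psi G T (α - Pi.single j 1) x)
      - lf G k x * psi G T α x := by
  have hd : DifferentiableAt ℝ (psi G T α) x := (psi_temp G T hG α).1.differentiable (by simp) x
  rw [pd, ← hd.lineDeriv_eq_fderiv]
  exact (psi_line G T hGs α k x).lineDeriv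

theorem psi_mul {n : ℕ} (G T : Matrix (Fin n) (Fin n) ℂ) (α : Fin n → ℤ) (k : Fin n) (x : EE n) :
    lf T k x * psi G T α x = ((α k : ℂ) + 1) * psi G T (α + Pi.single k 1) x := by
  unfold psi
  have e1 : ∏ j, dp (α j) (lf T j x) = _ :=
    (Finset.mul_prod_erase Finset.univ (fun j => dp (α j) (lf T j x)) (Finset.mem_univ k)).symm
  have e2 : ∏ j, dp ((α + Pi.single k 1 : Fin n → ℤ) j) (lf T j x) = _ :=
    (Finset.mul_prod_erase Finset.univ (fun j => dp ((α + Pi.single k 1 : Fin n → ℤ) j) (lf T j x))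
      (Finset.mem_univ k)).symm
  rw [e1, e2]
  have : ∏ i ∈ Finset.univ.erase k, dp ((α + Pi.single k 1 : Fin n → ℤ) i) (lf T i x)
        = ∏ i ∈ Finset.univ.erase k, dp (α i) (lf T i x) := by
      refine Finset.prod_congr rfl fun i hi => ?_
      have := (Finset.mem_erase.mp hi).1
      simp [this]
  rw [this]
  have h := dp_mul (α k) (lf T k x)
  simp only [Pi.add_apply, Pi.single_eq_same]
  linear_combination h * (∏ i ∈ Finset.univ.erase k, dp (α i) (lf T i x)) * gau G x

theorem psi_neg {n : ℕ} (G T : Matrix (Fin n) (Fin n) ℂ) (α : Fin n → ℤ) (h : ∃ j, α j < 0)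
    (x : EE n) : psi G T α x = 0 := by
  obtain ⟨j, hj⟩ := h
  unfold psi
  rw [Finset.prod_eq_zero (Finset.mem_univ j) (by simp [dp, hj]), zero_mul]


/-- derivative of a Schwartz function as a Schwartz function -/
noncomputable def sd {n : ℕ} (k : Fin n) (u : SchwartzMap (EE n) ℂ) : SchwartzMap (EE n) ℂ :=
  LineDeriv.lineDerivOp (EuclideanSpace.single k (1:ℝ)) u

theorem sd_apply {n : ℕ} (k : Fin n) (u : SchwartzMap (EE n) ℂ) (x : EE n) :
    sd k u x = fderiv ℝ u x (EuclideanSpace.single k 1) := rfl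

theorem ibp' {n : ℕ} {ψ : EE n → ℂ} (hψ : ψ.HasTemperateGrowth) (u : SchwartzMap (EE n) ℂ)
    (k : Fin n) : ∫ x, ψ x * sd k u x = - ∫ x, pd k ψ x * u x :=
  ibp hψ u _

theorem pd_temp {n : ℕ} {ψ : EE n → ℂ} (hψ : ψ.HasTemperateGrowth) (k : Fin n) :
    Function.HasTemperateGrowth (pd k ψ) := fderiv_temp hψ _

/-- expression of the Weyl quantization -/
theorem weyl_eq {n : ℕ} (A B C : Matrix (Fin n) (Fin n) ℂ) (u : SchwartzMap (EE n) ℂ) (x : EE n) :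
    weylQuant A B C 1 (fun y => u y) x = (∑ j, ∑ k, A j k * (x j : ℂ) * (x k : ℂ)) * u x
      - ∑ j, ∑ k, C j k * sd j (sd k u) x - 2 * Complex.I * ∑ k, lf B k x * sd k u x
      - Complex.I * (∑ j, B j j) * u x := by
  unfold weylQuant lf
  simp only [Complex.ofReal_one, one_pow, one_mul, mul_one, div_eq_mul_inv, Complex.inv_I]
  have h : ∀ j k, fderiv ℝ (fun y => fderiv ℝ (fun y => u y) y (EuclideanSpace.single k 1)) x
    (EuclideanSpace.single j 1) = sd j (sd k u) x := fun j k => rfl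
  have h2 : ∀ k, fderiv ℝ (fun y => u y) x (EuclideanSpace.single k 1) = sd k u x := fun k => rfl
  simp only [h, h2]
  ring

theorem weyl_schwartz {n : ℕ} (A B C : Matrix (Fin n) (Fin n) ℂ) (ζ : ℂ)
    (u : SchwartzMap (EE n) ℂ) :
    ∃ f : SchwartzMap (EE n) ℂ, ∀ x, f x = weylQuant A B C 1 (fun y => u y) x - ζ * u x := by
  refine ⟨SchwartzMap.smulLeftCLM ℂ (fun x : EE n => ∑ j, ∑ k, A j k * (x j : ℂ) * (x k : ℂ)) u
    - ∑ j, ∑ k, C j k • sd j (sd k u)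
    - (2 * Complex.I) • ∑ k, SchwartzMap.smulLeftCLM ℂ (fun x => lf B k x) (sd k u)
    - (Complex.I * (∑ j, B j j)) • u - ζ • u, fun x => ?_⟩
  rw [weyl_eq]
  simp only [sub_apply, smul_apply, sum_apply,
    SchwartzMap.smulLeftCLM_apply_apply (quad_temp A),
    SchwartzMap.smulLeftCLM_apply_apply (lf_temp B _), smul_eq_mul]

/-- formal transpose -/
noncomputable def Pt {n : ℕ} (A B C : Matrix (Fin n) (Fin n) ℂ) (ψ : EE n → ℂ) (x : EE n) : ℂ :=
  (∑ j, ∑ k, A j k * (x j : ℂ) * (x k : ℂ)) * ψ x - ∑ j, ∑ k, C j k * pd j (pd k ψ) x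
    + 2 * Complex.I * ∑ k, lf B k x * pd k ψ x + Complex.I * (∑ j, B j j) * ψ x

theorem lf_pd_mul {n : ℕ} (B : Matrix (Fin n) (Fin n) ℂ) {ψ : EE n → ℂ} (hψ : ψ.HasTemperateGrowth)
    (k : Fin n) (x : EE n) :
    pd k (fun x => lf B k x * ψ x) x = B k k * ψ x + lf B k x * pd k ψ x := by
  have h1 : DifferentiableAt ℝ (lf B k) x := (lf_temp B k).1.differentiable (by simp) x
  have h2 : DifferentiableAt ℝ ψ x := hψ.1.differentiable (by simp) x
  unfold pd
  rw [fderiv_fun_mul h1 h2]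
  simp only [add_apply, smul_apply, smul_eq_mul]
  rw [← h1.lineDeriv_eq_fderiv, (lf_hasFDeriv B k k x).lineDeriv]
  ring

theorem int4 {n : ℕ} {a b c d : EE n → ℂ} (ha : Integrable a) (hb : Integrable b)
    (hc : Integrable c) (hd : Integrable d) (k1 k2 k3 : ℂ) :
    ∫ x, (a x + k1 * b x + k2 * c x + k3 * d x) =
      (∫ x, a x) + k1 * (∫ x, b x) + k2 * (∫ x, c x) + k3 * ∫ x, d x := by
  have h1 : Integrable (fun x => k1 * b x) := hb.const_mul _
  have h2 : Integrable (fun x => k2 * c x) := hc.const_mul _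
  have h3 : Integrable (fun x => k3 * d x) := hd.const_mul _
  have h4 : Integrable (fun x => a x + k1 * b x) := ha.add h1
  have h5 : Integrable (fun x => a x + k1 * b x + k2 * c x) := h4.add h2
  rw [integral_add h5 h3, integral_add h4 h2, integral_add ha h1]
  simp only [integral_const_mul]

theorem int_sum2 {n : ℕ} (c : Fin n → Fin n → ℂ) (f : Fin n → Fin n → EE n → ℂ)
    (hf : ∀ j k, Integrable (f j k)) :
    ∫ x, ∑ j, ∑ k, c j k * f j k x = ∑ j, ∑ k, c j k * ∫ x, f j k x := by
  rw [integral_finsetSum _ fun j _ => integrable_finsetSum _ fun k _ => (hf j k).const_mul (c j k)]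
  refine Finset.sum_congr rfl fun j _ => ?_
  rw [integral_finsetSum _ fun k _ => (hf j k).const_mul (c j k)]
  exact Finset.sum_congr rfl fun k _ => integral_const_mul _ _

theorem transp {n : ℕ} (A B C : Matrix (Fin n) (Fin n) ℂ) (hCs : C.IsSymm) {ψ : EE n → ℂ}
    (hψ : ψ.HasTemperateGrowth) (u : SchwartzMap (EE n) ℂ) :
    ∫ x, ψ x * weylQuant A B C 1 (fun y => u y) x = ∫ x, Pt A B C ψ x * u x := by
  have hi : ∀ {φ : EE n → ℂ}, φ.HasTemperateGrowth → ∀ v : SchwartzMap (EE n) ℂ,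
    Integrable (fun x => φ x * v x) := fun h v => int_ts h v
  have hl : ∀ k, Function.HasTemperateGrowth (fun x => lf B k x * ψ x) :=
    fun k => (lf_temp B k).fun_mul hψ
  have hq : Function.HasTemperateGrowth
    (fun x : EE n => (∑ j, ∑ k, A j k * (x j : ℂ) * (x k : ℂ)) * ψ x) := (quad_temp A).fun_mul hψ
  have hll : ∀ k, Function.HasTemperateGrowth (fun x => lf B k x * pd k ψ x) :=
    fun k => (lf_temp B k).fun_mul (pd_temp hψ k)
  have e1 : ∀ x, ψ x * weylQuant A B C 1 (fun y => u y) x =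
      ((∑ j, ∑ k, A j k * (x j : ℂ) * (x k : ℂ)) * ψ x) * u x
      - ∑ j, ∑ k, C j k * (ψ x * sd j (sd k u) x) - 2 * Complex.I * ∑ k, (lf B k x * ψ x) * sd k u x
      - Complex.I * (∑ j, B j j) * (ψ x * u x) := by
    intro x
    rw [weyl_eq]
    have t1 : ∑ j, ∑ k, C j k * (ψ x * sd j (sd k u) x) = ψ x * ∑ j, ∑ k, C j k * sd j (sd k u) x := by
      simp only [Finset.mul_sum]
      exact Finset.sum_congr rfl fun j _ => Finset.sum_congr rfl fun k _ => by ring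
    have t2 : ∑ k, (lf B k x * ψ x) * sd k u x = ψ x * ∑ k, lf B k x * sd k u x := by
      simp only [Finset.mul_sum]
      exact Finset.sum_congr rfl fun j _ => by ring
    rw [t1, t2]; ring
  have e2 : ∀ x, Pt A B C ψ x * u x = ((∑ j, ∑ k, A j k * (x j : ℂ) * (x k : ℂ)) * ψ x) * u x
      - ∑ j, ∑ k, C j k * (pd j (pd k ψ) x * u x)
      + 2 * Complex.I * ∑ k, (lf B k x * pd k ψ x) * u x + Complex.I * (∑ j, B j j) * (ψ x * u x) := by
    intro x
    unfold Pt
    have t1 : ∑ j, ∑ k, C j k * (pd j (pd k ψ) x * u x) = (∑ j, ∑ k, C j k * pd j (pd k ψ) x) * u x := by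
      simp only [Finset.sum_mul]
      exact Finset.sum_congr rfl fun j _ => Finset.sum_congr rfl fun k _ => by ring
    have t2 : ∑ k, (lf B k x * pd k ψ x) * u x = (∑ k, lf B k x * pd k ψ x) * u x := by
      simp only [Finset.sum_mul]
    rw [t1, t2]; ring
  have ic : Integrable (fun x => ∑ j, ∑ k, C j k * (ψ x * sd j (sd k u) x)) :=
    integrable_finsetSum _ fun j _ => integrable_finsetSum _ fun k _ => (hi hψ _).const_mul _
  have ic' : Integrable (fun x => ∑ j, ∑ k, C j k * (pd j (pd k ψ) x * u x)) :=
    integrable_finsetSum _ fun j _ => integrable_finsetSum _ fun k _ =>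
      (hi (pd_temp (pd_temp hψ k) j) _).const_mul _
  have ib : Integrable (fun x => ∑ k, (lf B k x * ψ x) * sd k u x) :=
    integrable_finsetSum _ fun k _ => hi (hl k) _
  have ib' : Integrable (fun x => ∑ k, (lf B k x * pd k ψ x) * u x) :=
    integrable_finsetSum _ fun k _ => hi (hll k) _
  have iu := hi hψ u
  have iq := hi hq u
  have ec : ∫ x, ∑ j, ∑ k, C j k * (ψ x * sd j (sd k u) x) =
      ∫ x, ∑ j, ∑ k, C j k * (pd j (pd k ψ) x * u x) := by
    rw [int_sum2 C (fun j k x => ψ x * sd j (sd k u) x) fun j k => hi hψ _,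
      int_sum2 C (fun j k x => pd j (pd k ψ) x * u x) fun j k => hi (pd_temp (pd_temp hψ k) j) _,
      Finset.sum_comm]
    refine Finset.sum_congr rfl fun j _ => Finset.sum_congr rfl fun k _ => ?_
    rw [ibp' hψ, ibp' (pd_temp hψ k), neg_neg, hCs.apply]
  have eb : ∫ x, ∑ k, (lf B k x * ψ x) * sd k u x =
      - (∑ j, B j j) * (∫ x, ψ x * u x) - ∫ x, ∑ k, (lf B k x * pd k ψ x) * u x := by
    rw [integral_finsetSum _ fun k _ => hi (hl k) _, integral_finsetSum _ fun k _ => hi (hll k) _,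
      neg_mul, Finset.sum_mul, ← Finset.sum_neg_distrib, ← Finset.sum_sub_distrib]
    refine Finset.sum_congr rfl fun k _ => ?_
    rw [ibp' (hl k)]
    simp only [lf_pd_mul B hψ, add_mul]
    have : ∀ x, B k k * ψ x * u x = B k k * (ψ x * u x) := fun x => by ring
    simp only [this]
    rw [integral_add (iu.const_mul _) (hi (hll k) _), integral_const_mul]
    ring
  have f1 := int4 iq ic ib iu (-1) (-(2 * Complex.I)) (-(Complex.I * (∑ j, B j j)))
  have f2 := int4 iq ic' ib' iu (-1) (2 * Complex.I) (Complex.I * (∑ j, B j j))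
  have g1 : ∫ x, ψ x * weylQuant A B C 1 (fun y => u y) x = _ :=
    (integral_congr_ae (Filter.Eventually.of_forall fun x => by
      simp only [e1]; ring)).trans f1
  have g2 : ∫ x, Pt A B C ψ x * u x = _ :=
    (integral_congr_ae (Filter.Eventually.of_forall fun x => by
      simp only [e2]; ring)).trans f2
  rw [g1, g2, ec, eb]
  ring


theorem sum3_rev {n : ℕ} (f : Fin n → Fin n → Fin n → ℂ) :
    ∑ j, ∑ k, ∑ l, f j k l = ∑ l, ∑ k, ∑ j, f j k l := by
  calc _ = ∑ k, ∑ j, ∑ l, f j k l := Finset.sum_comm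
    _ = ∑ k, ∑ l, ∑ j, f j k l := Finset.sum_congr rfl fun k _ => Finset.sum_comm
    _ = _ := Finset.sum_comm

theorem s1_alg {n : ℕ} (C T : Matrix (Fin n) (Fin n) ℂ) (hCs : C.IsSymm) (p : Fin n → Fin n → ℂ) :
    ∑ j, ∑ k, C j k * ∑ l, T l k * ∑ m, T m j * p l m =
      ∑ l, ∑ m, (T * C * T.transpose) l m * p l m := by
  simp only [Matrix.mul_apply, Matrix.transpose_apply, Finset.mul_sum, Finset.sum_mul]
  rw [sum3_rev]
  refine Finset.sum_congr rfl fun l _ => ?_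
  rw [← sum3_rev]
  calc _ = ∑ j, ∑ m, ∑ k, C j k * (T l k * (T m j * p l m)) := by
        rw [Finset.sum_comm]
    _ = ∑ m, ∑ j, ∑ k, C j k * (T l k * (T m j * p l m)) := Finset.sum_comm
    _ = _ := Finset.sum_congr rfl fun m _ => Finset.sum_congr rfl fun j _ =>
        Finset.sum_congr rfl fun k _ => by rw [hCs.apply]; ring

theorem s2_alg {n : ℕ} (C T : Matrix (Fin n) (Fin n) ℂ) (hCs : C.IsSymm) (g p : Fin n → ℂ) :
    ∑ j, ∑ k, C j k * ∑ l, T l k * (g j * p l) =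
      ∑ l, (T.mulVec (C.mulVec g)) l * p l := by
  simp only [Matrix.mulVec, dotProduct, Finset.mul_sum, Finset.sum_mul]
  rw [sum3_rev]
  exact Finset.sum_congr rfl fun m _ => Finset.sum_congr rfl fun j _ =>
        Finset.sum_congr rfl fun k _ => by rw [hCs.apply]; ring

theorem s3_alg {n : ℕ} (C T : Matrix (Fin n) (Fin n) ℂ) (g p : Fin n → ℂ) :
    ∑ j, ∑ k, C j k * (g k * ∑ l, T l j * p l) =
      ∑ l, (T.mulVec (C.mulVec g)) l * p l := by
  simp only [Matrix.mulVec, dotProduct, Finset.mul_sum, Finset.sum_mul]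
  calc _ = ∑ j, ∑ l, ∑ k, C j k * (g k * (T l j * p l)) :=
        Finset.sum_congr rfl fun j _ => Finset.sum_comm
    _ = ∑ l, ∑ j, ∑ k, C j k * (g k * (T l j * p l)) := Finset.sum_comm
    _ = _ := Finset.sum_congr rfl fun m _ => Finset.sum_congr rfl fun j _ =>
        Finset.sum_congr rfl fun k _ => by ring

theorem s4_alg {n : ℕ} (T : Matrix (Fin n) (Fin n) ℂ) (b p : Fin n → ℂ) :
    ∑ k, b k * ∑ l, T l k * p l = ∑ l, (T.mulVec b) l * p l := by
  simp only [Matrix.mulVec, dotProduct, Finset.mul_sum, Finset.sum_mul]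
  rw [Finset.sum_comm]
  exact Finset.sum_congr rfl fun m _ => Finset.sum_congr rfl fun j _ => by ring

theorem ricc_alg {n : ℕ} (A B C G : Matrix (Fin n) (Fin n) ℂ) (hGs : G.IsSymm)
    (hR : A - G * C * G - Complex.I • (B.transpose * G + G * B) = 0) (x : Fin n → ℂ) :
    (∑ j, ∑ k, A j k * x j * x k) - (∑ j, ∑ k, C j k * (G.mulVec x k * G.mulVec x j))
      - 2 * Complex.I * ∑ k, B.mulVec x k * G.mulVec x k = 0 := by
  have h1 : ∀ A : Matrix (Fin n) (Fin n) ℂ, ∀ x y : Fin n → ℂ,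
      ∑ j, ∑ k, A j k * (y k * x j) = x ⬝ᵥ A.mulVec y := by
    intro A x y
    simp only [Matrix.mulVec, dotProduct, Finset.mul_sum]
    exact Finset.sum_congr rfl fun m _ => Finset.sum_congr rfl fun j _ => by ring
  have h2 : ∑ j, ∑ k, A j k * x j * x k = x ⬝ᵥ A.mulVec x := by
    rw [← h1]
    exact Finset.sum_congr rfl fun m _ => Finset.sum_congr rfl fun j _ => by ring
  have h3 : ∑ k, B.mulVec x k * G.mulVec x k = B.mulVec x ⬝ᵥ G.mulVec x := rfl
  have hA : A = G * C * G + Complex.I • (B.transpose * G + G * B) := by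
    rw [sub_sub, sub_eq_zero] at hR; exact hR
  have hGx : ∀ v, x ⬝ᵥ G.mulVec v = G.mulVec x ⬝ᵥ v := by
    intro v
    rw [Matrix.dotProduct_mulVec, ← Matrix.mulVec_transpose, hGs.eq]
  have hBx : ∀ v, x ⬝ᵥ B.transpose.mulVec v = B.mulVec x ⬝ᵥ v := by
    intro v
    rw [Matrix.dotProduct_mulVec, ← Matrix.mulVec_transpose, Matrix.transpose_transpose]
  rw [h2, h1, h3, hA]
  simp only [Matrix.add_mulVec, Matrix.smul_mulVec, dotProduct_add, dotProduct_smul,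
    ← Matrix.mulVec_mulVec, hGx, hBx, smul_eq_mul]
  rw [dotProduct_comm (G.mulVec x) (B.mulVec x)]
  ring

theorem pd_pd_psi {n : ℕ} (G T : Matrix (Fin n) (Fin n) ℂ) (hGs : G.IsSymm)
    (hG : ∀ x : EE n, 0 ≤ (∑ j, ∑ k, G j k * (x j : ℂ) * (x k : ℂ)).re) (α : Fin n → ℤ)
    (j k : Fin n) (x : EE n) :
    pd j (pd k (psi G T α)) x =
      (∑ l, T l k * ((∑ m, T m j * psi G T (α - Pi.single l 1 - Pi.single m 1) x)
        - lf G j x * psi G T (α - Pi.single l 1) x))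
      - (G k j * psi G T α x + lf G k x * ((∑ l, T l j * psi G T (α - Pi.single l 1) x)
        - lf G j x * psi G T α x)) := by
  have e : pd k (psi G T α) = fun x => (∑ j, T j k * psi G T (α - Pi.single j 1) x)
      - lf G k x * psi G T α x := by
    ext x; exact pd_psi G T hGs hG α k x
  have hd : ∀ β, DifferentiableAt ℝ (psi G T β) x := fun β =>
    (psi_temp G T hG β).1.differentiable (by simp) x
  have hl : DifferentiableAt ℝ (lf G k) x := (lf_temp G k).1.differentiable (by simp) x
  rw [e]
  unfold pd
  have d1 : DifferentiableAt ℝ (fun x => ∑ j, T j k * psi G T (α - Pi.single j 1) x) x :=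
    DifferentiableAt.fun_sum fun j _ => (hd _).const_mul _
  rw [fderiv_fun_sub d1 (hl.fun_mul (hd α)), fderiv_fun_mul hl (hd α),
    fderiv_fun_sum fun j _ => (hd _).const_mul _]
  simp only [sub_apply, add_apply, smul_apply, smul_eq_mul, sum_apply]
  have h1 : ∀ β, fderiv ℝ (psi G T β) x (EuclideanSpace.single j 1) = _ :=
    fun β => pd_psi G T hGs hG β j x
  have h2 : fderiv ℝ (lf G k) x (EuclideanSpace.single j 1) = G k j := by
    rw [← hl.lineDeriv_eq_fderiv, (lf_hasFDeriv G k j x).lineDeriv]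
  rw [h1, h2]
  congr 1
  · refine Finset.sum_congr rfl fun l _ => ?_
    rw [fderiv_const_mul (hd _), smul_apply, h1, smul_eq_mul]
  · ring

theorem tr_alg {n : ℕ} (B C G T Ti M : Matrix (Fin n) (Fin n) ℂ) (lam : Fin n → ℂ)
    (hT : T * Ti = 1) (hMd : ∀ i, M i i = -lam i)
    (hM : T * (B - Complex.I • (C * G)) = M * T) :
    (∑ j, ∑ k, C j k * G k j) + Complex.I * ∑ j, B j j = -Complex.I * ∑ j, lam j := by
  have h1 : (B - Complex.I • (C * G)).trace = M.trace := by
    have : (M * T * Ti).trace = (B - Complex.I • (C * G)).trace := by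
      rw [← hM, Matrix.trace_mul_comm, ← Matrix.mul_assoc, mul_eq_one_comm.mp hT, Matrix.one_mul]
    rw [← this, Matrix.mul_assoc, hT, Matrix.mul_one]
  have h2 : M.trace = - ∑ j, lam j := by
    simp [Matrix.trace, hMd]
  have h3 : (C * G).trace = ∑ j, ∑ k, C j k * G k j := by
    simp [Matrix.trace, Matrix.mul_apply]
  have h4 : B.trace = ∑ j, B j j := rfl
  rw [Matrix.trace_sub, Matrix.trace_smul, h2, smul_eq_mul] at h1
  rw [← h3, ← h4]
  linear_combination Complex.I * h1 + (C * G).trace * Complex.I_sq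

theorem Pt_psi {n : ℕ} (A B C G T Ti M : Matrix (Fin n) (Fin n) ℂ) (hCs : C.IsSymm)
    (lam : Fin n → ℂ) (hGs : G.IsSymm)
    (hG : ∀ x : EE n, 0 ≤ (∑ j, ∑ k, G j k * (x j : ℂ) * (x k : ℂ)).re)
    (hT : T * Ti = 1) (hMl : ∀ i j, j < i → M i j = 0) (hMd : ∀ i, M i i = -lam i)
    (hR : A - G * C * G - Complex.I • (B.transpose * G + G * B) = 0)
    (hM : T * (B - Complex.I • (C * G)) = M * T) (α : Fin n → ℤ) (x : EE n) :
    Pt A B C (psi G T α) x = eigv lam α * psi G T α x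
      - (∑ l, ∑ m, (T * C * T.transpose) l m * psi G T (α - Pi.single l 1 - Pi.single m 1) x)
      + 2 * Complex.I * ∑ l, ∑ k, if l < k then
        M l k * ((α k : ℂ) + 1) * psi G T (α - Pi.single l 1 + Pi.single k 1) x else 0 := by
  set xv : Fin n → ℂ := fun j => (x j : ℂ) with hxv
  have hlf : ∀ S : Matrix (Fin n) (Fin n) ℂ, ∀ j, lf S j x = S.mulVec xv j := fun S j => rfl
  have r1 := ricc_alg A B C G hGs hR xv
  have r2 := tr_alg B C G T Ti M lam hT hMd hM
  have r3 := s1_alg C T hCs (fun l m => psi G T (α - Pi.single l 1 - Pi.single m 1) x)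
  have r4 := s2_alg C T hCs (G.mulVec xv) (fun l => psi G T (α - Pi.single l 1) x)
  have r5 := s3_alg C T (G.mulVec xv) (fun l => psi G T (α - Pi.single l 1) x)
  have r6 := s4_alg T (B.mulVec xv) (fun l => psi G T (α - Pi.single l 1) x)
  have hMx : T.mulVec (B.mulVec xv) - Complex.I • T.mulVec (C.mulVec (G.mulVec xv))
      = M.mulVec (T.mulVec xv) := by
    have := congrArg (fun S => S.mulVec xv) hM
    simp only [← Matrix.mulVec_mulVec, Matrix.sub_mulVec, Matrix.smul_mulVec, Matrix.mulVec_sub,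
      Matrix.mulVec_smul] at this
    exact this
  have r7 : ∑ l, (M.mulVec (T.mulVec xv)) l * psi G T (α - Pi.single l 1) x =
      -(∑ l, lam l * (α l : ℂ)) * psi G T α x + ∑ l, ∑ k, if l < k then
        M l k * ((α k : ℂ) + 1) * psi G T (α - Pi.single l 1 + Pi.single k 1) x else 0 := by
    rw [neg_mul, Finset.sum_mul, ← Finset.sum_neg_distrib, ← Finset.sum_add_distrib]
    refine Finset.sum_congr rfl fun l _ => ?_
    have : M.mulVec (T.mulVec xv) l * psi G T (α - Pi.single l 1) x =
        ∑ k, M l k * (lf T k x * psi G T (α - Pi.single l 1) x) := by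
      have : M.mulVec (T.mulVec xv) l = ∑ k, M l k * lf T k x := rfl
      rw [this, Finset.sum_mul]
      exact Finset.sum_congr rfl fun k _ => by ring
    rw [this]
    simp only [psi_mul]
    have e : ∀ k, M l k * ((((α - Pi.single l 1 : Fin n → ℤ) k : ℂ) + 1) *
        psi G T (α - Pi.single l 1 + Pi.single k 1) x) =
        (if k = l then -(lam l * (α l : ℂ) * psi G T α x) else 0) + if l < k then
        M l k * ((α k : ℂ) + 1) * psi G T (α - Pi.single l 1 + Pi.single k 1) x else 0 := by
      intro k
      rcases lt_trichotomy k l with h | h | h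
      · rw [hMl l k h, if_neg h.ne, if_neg h.asymm]; simp
      · subst h; simp [hMd]; ring
      · rw [if_neg h.ne', if_pos h]
        simp [h.ne']; ring
    simp only [e]
    rw [Finset.sum_add_distrib]
    simp
  have r8 : ∑ l, (M.mulVec (T.mulVec xv)) l * psi G T (α - Pi.single l 1) x =
      (∑ l, (T.mulVec (B.mulVec xv)) l * psi G T (α - Pi.single l 1) x) - Complex.I *
      ∑ l, (T.mulVec (C.mulVec (G.mulVec xv))) l * psi G T (α - Pi.single l 1) x := by
    rw [← hMx, Finset.mul_sum, ← Finset.sum_sub_distrib]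
    exact Finset.sum_congr rfl fun l _ => by
      simp only [Pi.sub_apply, Pi.smul_apply, smul_eq_mul]; ring
  -- expand
  have x1 : ∑ j, ∑ k, C j k * pd j (pd k (psi G T α)) x =
      (∑ j, ∑ k, C j k * ∑ l, T l k * ∑ m, T m j * psi G T (α - Pi.single l 1 - Pi.single m 1) x)
      - (∑ j, ∑ k, C j k * ∑ l, T l k * (G.mulVec xv j * psi G T (α - Pi.single l 1) x))
      - (∑ j, ∑ k, C j k * G k j) * psi G T α x
      - (∑ j, ∑ k, C j k * (G.mulVec xv k * ∑ l, T l j * psi G T (α - Pi.single l 1) x))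
      + (∑ j, ∑ k, C j k * (G.mulVec xv k * G.mulVec xv j)) * psi G T α x := by
    simp only [Finset.sum_mul, ← Finset.sum_sub_distrib, ← Finset.sum_add_distrib]
    refine Finset.sum_congr rfl fun j _ => Finset.sum_congr rfl fun k _ => ?_
    rw [pd_pd_psi G T hGs hG]
    simp only [mul_sub, Finset.sum_sub_distrib, hlf]
    ring
  have x2 : ∑ k, lf B k x * pd k (psi G T α) x =
      (∑ k, B.mulVec xv k * ∑ l, T l k * psi G T (α - Pi.single l 1) x)
      - (∑ k, B.mulVec xv k * G.mulVec xv k) * psi G T α x := by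
    simp only [Finset.sum_mul, ← Finset.sum_sub_distrib]
    refine Finset.sum_congr rfl fun k _ => ?_
    rw [pd_psi G T hGs hG]
    simp only [mul_sub, hlf]
    ring
  have x3 : eigv lam α = -Complex.I * (2 * ∑ l, lam l * (α l : ℂ)) + -Complex.I * ∑ j, lam j := by
    unfold eigv
    have : ∑ j, lam j * (2 * (α j : ℂ) + 1) = 2 * (∑ l, lam l * (α l : ℂ)) + ∑ j, lam j := by
      rw [Finset.mul_sum, ← Finset.sum_add_distrib]
      exact Finset.sum_congr rfl fun l _ => by ring
    rw [this]; ring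
  unfold Pt
  rw [x1, x2, x3, ← r2]
  simp only [hxv] at r1
  rw [r4, r5, r6, r3]
  rw [r8] at r7
  linear_combination psi G T α x * r1 + 2 * Complex.I * r7 + 2 * (∑ l, (T.mulVec (C.mulVec (G.mulVec xv))) l * psi G T (α - Pi.single l 1) x) * Complex.I_sq


theorem homog_lower {E : Type*} [NormedAddCommGroup E] [NormedSpace ℝ E] [FiniteDimensional ℝ E]
    (q : E → ℝ) (hc : Continuous q) (hh : ∀ (t : ℝ) x, q (t • x) = t ^ 2 * q x)
    (hp : ∀ x, x ≠ 0 → 0 < q x) : ∃ c > 0, ∀ x, c * ‖x‖ ^ 2 ≤ q x := by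
  have h0 : q 0 = 0 := by simpa using hh 0 0
  rcases (Metric.sphere (0:E) 1).eq_empty_or_nonempty with he | hne
  · refine ⟨1, one_pos, fun x => ?_⟩
    by_cases hx : x = 0
    · simp [hx, h0]
    · exfalso
      have : (‖x‖⁻¹ : ℝ) • x ∈ Metric.sphere (0:E) 1 := by
        simp [norm_smul, norm_ne_zero_iff.mpr hx]
      rw [he] at this; exact this
  · obtain ⟨y, hy, hmin⟩ := (isCompact_sphere (0:E) 1).exists_isMinOn hne hc.continuousOn
    refine ⟨q y, hp y (by rintro rfl; simp at hy), fun x => ?_⟩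
    by_cases hx : x = 0
    · simp [hx, h0]
    have hn : ‖x‖ ≠ 0 := norm_ne_zero_iff.mpr hx
    have h1 : (‖x‖⁻¹ : ℝ) • x ∈ Metric.sphere (0:E) 1 := by
      simp [norm_smul, hn]
    have h2 : q y ≤ q ((‖x‖⁻¹ : ℝ) • x) := hmin h1
    rw [hh] at h2
    calc q y * ‖x‖ ^ 2 ≤ (‖x‖⁻¹ ^ 2 * q x) * ‖x‖ ^ 2 := by gcongr
      _ = q x := by field_simp

theorem quadG_lower {n : ℕ} (G : Matrix (Fin n) (Fin n) ℂ)
    (hG : ∀ x : Fin n → ℝ, x ≠ 0 → 0 < (∑ j, ∑ k, G j k * (x j:ℂ) * (x k:ℂ)).re) :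
    ∃ c > 0, ∀ x : EE n, c * ‖x‖ ^ 2 ≤ (∑ j, ∑ k, G j k * (x j:ℂ) * (x k:ℂ)).re := by
  apply homog_lower (fun x : EE n => (∑ j, ∑ k, G j k * (x j:ℂ) * (x k:ℂ)).re)
  · exact Complex.continuous_re.comp (quad_temp G).1.continuous
  · intro t x
    have : ∑ j, ∑ k, G j k * ((t • x) j:ℂ) * ((t • x) k:ℂ) =
        ((t ^ 2 : ℝ) : ℂ) * ∑ j, ∑ k, G j k * (x j:ℂ) * (x k:ℂ) := by
      simp only [Finset.mul_sum]
      refine Finset.sum_congr rfl fun j _ => Finset.sum_congr rfl fun k _ => ?_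
      simp only [PiLp.smul_apply, smul_eq_mul]
      push_cast; ring
    simp only [this, Complex.re_ofReal_mul]
  · intro x hx
    exact hG x (fun h => hx (by ext j; exact congrFun h j))

theorem gau_norm {n : ℕ} (G : Matrix (Fin n) (Fin n) ℂ) (c : ℝ)
    (hc : ∀ x : EE n, c * ‖x‖ ^ 2 ≤ (∑ j, ∑ k, G j k * (x j:ℂ) * (x k:ℂ)).re) (x : EE n) :
    ‖gau G x‖ ≤ Real.exp (-(c / 2) * ‖x‖ ^ 2) := by
  unfold gau
  rw [Complex.norm_exp]
  apply Real.exp_le_exp.mpr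
  have h2 : (-(1/2) * ∑ j, ∑ k, G j k * (x j : ℂ) * (x k : ℂ)).re =
    -(1/2) * (∑ j, ∑ k, G j k * (x j : ℂ) * (x k : ℂ)).re := by
    have : (-(1/2) : ℂ) = ((-(1/2) : ℝ) : ℂ) := by push_cast; rfl
    rw [this, Complex.re_ofReal_mul]
  rw [h2]
  have := hc x
  linarith

theorem dp_norm (m : ℤ) (y : ℂ) (r : ℝ) (hr : 0 < r) : ‖dp m y‖ * r ^ m ≤ Real.exp (r * ‖y‖) := by
  unfold dp
  by_cases h : m < 0
  · simp [h]; positivity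
  · obtain ⟨k, rfl⟩ : ∃ k : ℕ, m = k := ⟨m.toNat, by omega⟩
    rw [if_neg h]
    have := Real.pow_div_factorial_le_exp (r * ‖y‖) (by positivity) k
    refine le_trans (le_of_eq ?_) this
    simp only [Int.toNat_natCast, norm_div, norm_pow, zpow_natCast, mul_pow]
    rw [Complex.norm_natCast]
    ring

theorem lf_norm {n : ℕ} (T : Matrix (Fin n) (Fin n) ℂ) (j : Fin n) (x : EE n) :
    ‖lf T j x‖ ≤ (∑ k, ‖T j k‖) * ‖x‖ := by
  unfold lf
  rw [Finset.sum_mul]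
  refine (norm_sum_le _ _).trans (Finset.sum_le_sum fun k _ => ?_)
  rw [norm_mul, Complex.norm_real]
  gcongr
  exact PiLp.norm_apply_le x k

theorem psi_norm {n : ℕ} (G T : Matrix (Fin n) (Fin n) ℂ) (c b : ℝ) (hc0 : 0 < c) (hb : 0 < b)
    (hc : ∀ x : EE n, c * ‖x‖ ^ 2 ≤ (∑ j, ∑ k, G j k * (x j:ℂ) * (x k:ℂ)).re) :
    ∃ K ≥ 1, ∀ r > 0, ∀ (x : EE n),
      Real.exp (∑ j : Fin n, (r * b ^ j.val) * ‖lf T j x‖) * ‖gau G x‖ ≤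
        Real.exp (K * r ^ 2) * Real.exp (-(c / 4) * ‖x‖ ^ 2) := by
  set K0 : ℝ := ∑ j : Fin n, b ^ j.val * ∑ k, ‖T j k‖ with hK0
  have hK0n : 0 ≤ K0 := Finset.sum_nonneg fun j _ => by positivity
  refine ⟨1 + K0 ^ 2 / c, by have : 0 ≤ K0 ^ 2 / c := by positivity
                             linarith, fun r hr x => ?_⟩
  have h1 : ∑ j : Fin n, (r * b ^ j.val) * ‖lf T j x‖ ≤ r * K0 * ‖x‖ := by
    rw [hK0, Finset.mul_sum, Finset.sum_mul]
    refine Finset.sum_le_sum fun j _ => ?_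
    have := lf_norm T j x
    calc _ ≤ (r * b ^ j.val) * ((∑ k, ‖T j k‖) * ‖x‖) := by gcongr
      _ = _ := by ring
  calc _ ≤ Real.exp (r * K0 * ‖x‖) * Real.exp (-(c / 2) * ‖x‖ ^ 2) := by
        gcongr; exact gau_norm G c hc x
    _ ≤ _ := by
      rw [← Real.exp_add, ← Real.exp_add]
      apply Real.exp_le_exp.mpr
      have : r * K0 * ‖x‖ ≤ K0 ^ 2 / c * r ^ 2 + c / 4 * ‖x‖ ^ 2 := by
        have e : K0 ^ 2 / c * r ^ 2 + c / 4 * ‖x‖ ^ 2 - r * K0 * ‖x‖ =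
          (r * K0 - c / 2 * ‖x‖) ^ 2 / c := by field_simp; ring
        have : 0 ≤ (r * K0 - c / 2 * ‖x‖) ^ 2 / c := by positivity
        linarith
      nlinarith [sq_nonneg r]

theorem psi_wt {n : ℕ} (G T : Matrix (Fin n) (Fin n) ℂ) (r b : ℝ) (hr : 0 < r) (hb : 0 < b)
    (α : Fin n → ℤ) (x : EE n) :
    ‖psi G T α x‖ * wt r b α ≤
      Real.exp (∑ j : Fin n, (r * b ^ j.val) * ‖lf T j x‖) * ‖gau G x‖ := by
  unfold psi wt
  rw [norm_mul, norm_prod, mul_right_comm, ← Finset.prod_mul_distrib, Real.exp_sum]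
  gcongr with j
  exact dp_norm _ _ _ (by positivity)

theorem l2Norm_nonneg {n : ℕ} (f : EE n → ℂ) : 0 ≤ l2Norm f := Real.sqrt_nonneg _

theorem gauss_int {n : ℕ} (κ : ℝ) (hκ : 0 < κ) :
    Integrable (fun x : EE n => Real.exp (-κ * ‖x‖ ^ 2)) := by
  have := (GaussianFourier.integrable_cexp_neg_mul_sq_norm_add (V := EE n) (b := (κ:ℂ)) (by simpa)
    0 0).norm
  refine this.congr (Filter.Eventually.of_forall fun x => ?_)
  simp only [Complex.norm_exp]
  congr 1
  simp [← Complex.ofReal_pow]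

theorem gauss_cs {n : ℕ} (κ : ℝ) (hκ : 0 < κ) : ∃ K ≥ 1, ∀ u : SchwartzMap (EE n) ℂ,
    ∫ x, Real.exp (-κ * ‖x‖ ^ 2) * ‖u x‖ ≤ K * l2Norm (fun x => u x) := by
  refine ⟨1 + (∫ x : EE n, Real.exp (-κ * ‖x‖ ^ 2) ^ (2:ℝ)) ^ (1 / (2:ℝ)), ?_, fun u => ?_⟩
  · have : 0 ≤ (∫ x : EE n, Real.exp (-κ * ‖x‖ ^ 2) ^ (2:ℝ)) ^ (1 / (2:ℝ)) := by positivity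
    linarith
  have h22 : Real.HolderConjugate 2 2 := Real.HolderConjugate.two_two
  have hg : MemLp (fun x : EE n => Real.exp (-κ * ‖x‖ ^ 2)) (ENNReal.ofReal 2) := by
    have e : ENNReal.ofReal 2 = 2 := by simp
    rw [e, memLp_two_iff_integrable_sq]
    · have := gauss_int (n := n) (2 * κ) (by positivity)
      refine this.congr (Filter.Eventually.of_forall fun x => ?_)
      simp only [← Real.exp_nat_mul]
      congr 1; push_cast; ring
    · exact (by fun_prop : Continuous fun x : EE n => Real.exp (-κ * ‖x‖ ^ 2)).aestronglyMeasurable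
  have := integral_mul_le_Lp_mul_Lq_of_nonneg (μ := (volume : Measure (EE n))) h22
    (f := fun x => Real.exp (-κ * ‖x‖ ^ 2))
    (g := fun x => ‖u x‖) (Filter.Eventually.of_forall fun x => by positivity)
    (Filter.Eventually.of_forall fun x => by positivity) hg (u.memLp _).norm
  refine this.trans ?_
  have e : (∫ x, ‖u x‖ ^ (2:ℝ)) ^ (1 / (2:ℝ)) = l2Norm (fun x => u x) := by
    unfold l2Norm
    rw [Real.sqrt_eq_rpow]
    simp only [Real.rpow_two]
  rw [e]
  have := l2Norm_nonneg (fun x => u x)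
  gcongr
  linarith

theorem V_bound {n : ℕ} (G T : Matrix (Fin n) (Fin n) ℂ) (c b : ℝ) (hc0 : 0 < c) (hb : 0 < b)
    (hc : ∀ x : EE n, c * ‖x‖ ^ 2 ≤ (∑ j, ∑ k, G j k * (x j:ℂ) * (x k:ℂ)).re) :
    ∃ K ≥ 1, ∀ r > 0, ∀ (u : SchwartzMap (EE n) ℂ) (α : Fin n → ℤ),
      ‖∫ x, psi G T α x * u x‖ * wt r b α ≤ K * Real.exp (K * r ^ 2) * l2Norm (fun x => u x) := by
  obtain ⟨K1, hK1, h1⟩ := psi_norm G T c b hc0 hb hc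
  obtain ⟨K2, hK2, h2⟩ := gauss_cs (n := n) (c / 4) (by positivity)
  refine ⟨max K1 K2, le_max_of_le_left hK1, fun r hr u α => ?_⟩
  have hG : ∀ x : EE n, 0 ≤ (∑ j, ∑ k, G j k * (x j : ℂ) * (x k : ℂ)).re := fun x =>
    le_trans (by positivity) (hc x)
  have hw := wt_pos hr hb α
  have hgi : Integrable (fun x : EE n => Real.exp (-(c/4) * ‖x‖ ^ 2) * ‖u x‖) := by
    have := (gauss_int (n := n) (c/4) (by positivity)).mul_bdd (c := (SchwartzMap.seminorm ℝ 0 0 u))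
      (g := fun x => ‖u x‖) u.continuous.norm.aestronglyMeasurable
      (Filter.Eventually.of_forall fun x => by simpa using SchwartzMap.norm_le_seminorm ℝ u x)
    exact this
  calc ‖∫ x, psi G T α x * u x‖ * wt r b α ≤ (∫ x, ‖psi G T α x * u x‖) * wt r b α := by
        gcongr; exact norm_integral_le_integral_norm _
    _ = ∫ x, ‖psi G T α x * u x‖ * wt r b α := by rw [integral_mul_const]
    _ ≤ ∫ x, Real.exp (K1 * r ^ 2) * (Real.exp (-(c / 4) * ‖x‖ ^ 2) * ‖u x‖) := by
        apply integral_mono ((int_ts (psi_temp G T hG α) u).norm.mul_const _) (hgi.const_mul _)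
        intro x
        simp only [norm_mul]
        have := (psi_wt G T r b hr hb α x).trans (h1 r hr x)
        calc _ = ‖psi G T α x‖ * wt r b α * ‖u x‖ := by ring
          _ ≤ (Real.exp (K1 * r ^ 2) * Real.exp (-(c / 4) * ‖x‖ ^ 2)) * ‖u x‖ := by gcongr
          _ = _ := by ring
    _ = Real.exp (K1 * r ^ 2) * ∫ x, (Real.exp (-(c / 4) * ‖x‖ ^ 2) * ‖u x‖) := integral_const_mul _ _
    _ ≤ Real.exp (K1 * r ^ 2) * (K2 * l2Norm (fun x => u x)) := by gcongr; exact h2 u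
    _ ≤ Real.exp (max K1 K2 * r ^ 2) * (max K1 K2 * l2Norm (fun x => u x)) := by
        have := l2Norm_nonneg (fun x => u x)
        gcongr
        · exact le_max_left _ _
        · exact le_max_right _ _
    _ = _ := by ring


theorem mode_rec {n : ℕ} (A B C G T Ti M : Matrix (Fin n) (Fin n) ℂ) (hCs : C.IsSymm)
    (lam : Fin n → ℂ) (hGs : G.IsSymm)
    (hG : ∀ x : EE n, 0 ≤ (∑ j, ∑ k, G j k * (x j : ℂ) * (x k : ℂ)).re)
    (hT : T * Ti = 1) (hMl : ∀ i j, j < i → M i j = 0) (hMd : ∀ i, M i i = -lam i)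
    (hR : A - G * C * G - Complex.I • (B.transpose * G + G * B) = 0)
    (hM : T * (B - Complex.I • (C * G)) = M * T) (ζ : ℂ) (u f : SchwartzMap (EE n) ℂ)
    (hf : ∀ x, f x = weylQuant A B C 1 (fun y => u y) x - ζ * u x) (α : Fin n → ℤ) :
    (eigv lam α - ζ) * (∫ x, psi G T α x * u x) = (∫ x, psi G T α x * f x)
      + (∑ j, ∑ k, (T * C * T.transpose) j k *
          ∫ x, psi G T (α - Pi.single j 1 - Pi.single k 1) x * u x)
      - 2 * Complex.I * ∑ j, ∑ k, if j < k then M j k * ((α k : ℂ) + 1) *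
          ∫ x, psi G T (α - Pi.single j 1 + Pi.single k 1) x * u x else 0 := by
  have hi : ∀ β, Integrable (fun x => psi G T β x * u x) := fun β => int_ts (psi_temp G T hG β) u
  have hif : Integrable (fun x => psi G T α x * f x) := int_ts (psi_temp G T hG α) f
  have h1 : ∫ x, psi G T α x * weylQuant A B C 1 (fun y => u y) x =
      (∫ x, psi G T α x * f x) + ζ * ∫ x, psi G T α x * u x := by
    rw [← integral_const_mul, ← integral_add hif ((hi α).const_mul _)]
    refine integral_congr_ae (Filter.Eventually.of_forall fun x => ?_)
    simp only [hf]; ring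
  have h2 := transp A B C hCs (psi_temp G T hG α) u
  have e : ∀ x, Pt A B C (psi G T α) x * u x = (0 : EE n → ℂ) x
      + eigv lam α * (psi G T α x * u x)
      + (-1) * (∑ l, ∑ m, (T * C * T.transpose) l m *
        (psi G T (α - Pi.single l 1 - Pi.single m 1) x * u x))
      + (2 * Complex.I) * ∑ l, ∑ k, (if l < k then M l k * ((α k : ℂ) + 1) else 0) *
        (psi G T (α - Pi.single l 1 + Pi.single k 1) x * u x) := by
    intro x
    rw [Pt_psi A B C G T Ti M hCs lam hGs hG hT hMl hMd hR hM]
    simp only [add_mul, sub_mul, Pi.zero_apply]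
    simp only [mul_assoc, Finset.sum_mul, ite_mul, zero_mul]
    ring
  have i1 : Integrable (fun x => ∑ l, ∑ m, (T * C * T.transpose) l m *
        (psi G T (α - Pi.single l 1 - Pi.single m 1) x * u x)) :=
    integrable_finsetSum _ fun l _ => integrable_finsetSum _ fun m _ => (hi _).const_mul _
  have i2 : Integrable (fun x => ∑ l, ∑ k, (if l < k then M l k * ((α k : ℂ) + 1) else 0) *
        (psi G T (α - Pi.single l 1 + Pi.single k 1) x * u x)) :=
    integrable_finsetSum _ fun l _ => integrable_finsetSum _ fun m _ => (hi _).const_mul _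
  have s1 : ∫ x, (∑ l, ∑ m, (T * C * T.transpose) l m *
        (psi G T (α - Pi.single l 1 - Pi.single m 1) x * u x)) =
      ∑ l, ∑ m, (T * C * T.transpose) l m *
        ∫ x, psi G T (α - Pi.single l 1 - Pi.single m 1) x * u x :=
    int_sum2 (T * C * T.transpose)
      (fun l m x => psi G T (α - Pi.single l 1 - Pi.single m 1) x * u x) fun _ _ => hi _
  have s2 : ∫ x, (∑ l, ∑ k, (if l < k then M l k * ((α k : ℂ) + 1) else 0) *
        (psi G T (α - Pi.single l 1 + Pi.single k 1) x * u x)) =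
      ∑ l, ∑ k, (if l < k then M l k * ((α k : ℂ) + 1) else 0) *
        ∫ x, psi G T (α - Pi.single l 1 + Pi.single k 1) x * u x :=
    int_sum2 (fun l k => if l < k then M l k * ((α k : ℂ) + 1) else 0)
      (fun l k x => psi G T (α - Pi.single l 1 + Pi.single k 1) x * u x) fun _ _ => hi _
  have h3 := int4 (integrable_zero (EE n) ℂ volume) (hi α) i1 i2 (eigv lam α) (-1) (2 * Complex.I)
  have h4 := (integral_congr_ae (μ := volume) (Filter.Eventually.of_forall e)).trans h3
  rw [s1, s2] at h4
  simp only [Pi.zero_apply, integral_zero, ite_mul, zero_mul] at h4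
  rw [h1, h4] at h2
  linear_combination -h2

theorem mode_bound {n : ℕ} (A B C G T Ti M : Matrix (Fin n) (Fin n) ℂ) (hCs : C.IsSymm)
    (lam : Fin n → ℂ) (hlam : ∀ j, 0 < (lam j).im) (hGs : G.IsSymm)
    (c : ℝ) (hc0 : 0 < c)
    (hc : ∀ x : EE n, c * ‖x‖ ^ 2 ≤ (∑ j, ∑ k, G j k * (x j:ℂ) * (x k:ℂ)).re)
    (hT : T * Ti = 1) (hMl : ∀ i j, j < i → M i j = 0) (hMd : ∀ i, M i i = -lam i)
    (hR : A - G * C * G - Complex.I • (B.transpose * G + G * B) = 0)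
    (hM : T * (B - Complex.I • (C * G)) = M * T) :
    ∃ b ≥ 1, ∃ K ≥ 1, ∀ (r δ : ℝ) (ζ : ℂ) (m : ℕ), 0 < r → 0 < δ → δ ≤ 1 → 1 ≤ m →
      K * ‖ζ‖ ≤ m → K * r ^ 2 ≤ m → ∀ u f : SchwartzMap (EE n) ℂ,
      (∀ x, f x = weylQuant A B C 1 (fun y => u y) x - ζ * u x) →
      (∀ α : Fin n → ℤ, (∀ j, 0 ≤ α j) → δ ≤ ‖eigv lam α - ζ‖) →
      ∀ α, ‖∫ x, psi G T α x * u x‖ * wt r b α ≤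
        2 * ((K * m / δ) ^ (n * m + 1) + K) * (K * Real.exp (K * r ^ 2) * l2Norm (fun x => f x)) := by
  obtain ⟨b, hb, Kc, hKc, hrec⟩ := rec_main (T * C * T.transpose) M lam hlam
  obtain ⟨K, hK, hV⟩ := V_bound G T c b hc0 (by linarith) hc
  have hG : ∀ x : EE n, 0 ≤ (∑ j, ∑ k, G j k * (x j : ℂ) * (x k : ℂ)).re := fun x =>
    le_trans (by positivity) (hc x)
  refine ⟨b, hb, max Kc K, le_max_of_le_left hKc, fun r δ ζ m hr hδ hδ1 hm hζ hrm u f hf hres α => ?_⟩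
  have hl := l2Norm_nonneg (fun x => f x)
  have hKle := le_max_left Kc K
  have h1 := hrec r δ ζ m hr hδ hδ1 hm
    (le_trans (by gcongr) hζ) (le_trans (by gcongr) hrm)
    (fun α => ∫ x, psi G T α x * u x) (fun α => ∫ x, psi G T α x * f x)
    (K * Real.exp (K * r ^ 2) * l2Norm (fun x => f x))
    (K * Real.exp (K * r ^ 2) * l2Norm (fun x => u x)) (by positivity)
    (fun α hα => by simp only [psi_neg G T α hα, zero_mul, integral_zero])
    (fun α => hV r hr u α) (fun α _ => hV r hr f α)
    (fun α _ => mode_rec A B C G T Ti M hCs lam hGs hG hT hMl hMd hR hM ζ u f hf α) hres α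
  refine h1.trans ?_
  gcongr
  · exact le_max_right _ _
  · exact le_max_right _ _


/-- complex conjugate of a Schwartz function -/
noncomputable def cj {n : ℕ} (u : SchwartzMap (EE n) ℂ) (x : EE n) : ℂ := star (u x)

theorem cj_temp {n : ℕ} (u : SchwartzMap (EE n) ℂ) : Function.HasTemperateGrowth (cj u) :=
  (Complex.conjCLE : ℂ →L[ℝ] ℂ).hasTemperateGrowth.comp u.hasTemperateGrowth

theorem pd_cj {n : ℕ} (u : SchwartzMap (EE n) ℂ) (k : Fin n) (x : EE n) :
    pd k (cj u) x = star (sd k u x) := by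
  have h : HasFDerivAt (cj u) ((Complex.conjCLE : ℂ →L[ℝ] ℂ).comp (fderiv ℝ u x)) x :=
    (Complex.conjCLE : ℂ →L[ℝ] ℂ).hasFDerivAt.comp x (u.differentiable x).hasFDerivAt
  unfold pd
  rw [h.fderiv]
  rfl

theorem half_b {n : ℕ} (B : Matrix (Fin n) (Fin n) ℂ) {ψ : EE n → ℂ}
    (hψ : ψ.HasTemperateGrowth) (u : SchwartzMap (EE n) ℂ) :
    ∫ x, ∑ k, (lf B k x * ψ x) * sd k u x =
      - (∑ j, B j j) * (∫ x, ψ x * u x) - ∫ x, ∑ k, (lf B k x * pd k ψ x) * u x := by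
  have hi : ∀ {φ : EE n → ℂ}, φ.HasTemperateGrowth → ∀ v : SchwartzMap (EE n) ℂ,
    Integrable (fun x => φ x * v x) := fun h v => int_ts h v
  have hl : ∀ k, Function.HasTemperateGrowth (fun x => lf B k x * ψ x) :=
    fun k => (lf_temp B k).fun_mul hψ
  have hll : ∀ k, Function.HasTemperateGrowth (fun x => lf B k x * pd k ψ x) :=
    fun k => (lf_temp B k).fun_mul (pd_temp hψ k)
  rw [integral_finsetSum _ fun k _ => hi (hl k) _, integral_finsetSum _ fun k _ => hi (hll k) _,
      neg_mul, Finset.sum_mul, ← Finset.sum_neg_distrib, ← Finset.sum_sub_distrib]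
  refine Finset.sum_congr rfl fun k _ => ?_
  rw [ibp' (hl k)]
  simp only [lf_pd_mul B hψ, add_mul]
  have : ∀ x, B k k * ψ x * u x = B k k * (ψ x * u x) := fun x => by ring
  simp only [this]
  rw [integral_add ((hi hψ u).const_mul _) (hi (hll k) _), integral_const_mul]
  ring

/-- phase-space vector -/
noncomputable def Xv {n : ℕ} (u : SchwartzMap (EE n) ℂ) (x : EE n) : Fin n ⊕ Fin n → ℂ :=
  Sum.elim (fun j => (x j : ℂ) * u x) (fun k => -Complex.I * sd k u x)

theorem energy_id {n : ℕ} (A B C : Matrix (Fin n) (Fin n) ℂ) (hCs : C.IsSymm)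
    (u : SchwartzMap (EE n) ℂ) :
    Integrable (fun x => qPolar A B C (star (Xv u x)) (Xv u x)) ∧
    ∫ x, cj u x * weylQuant A B C 1 (fun y => u y) x =
      ∫ x, qPolar A B C (star (Xv u x)) (Xv u x) := by
  have hψ := cj_temp u
  have hi : ∀ {φ : EE n → ℂ}, φ.HasTemperateGrowth → ∀ v : SchwartzMap (EE n) ℂ,
    Integrable (fun x => φ x * v x) := fun h v => int_ts h v
  have hl : ∀ k, Function.HasTemperateGrowth (fun x => lf B k x * cj u x) :=
    fun k => (lf_temp B k).fun_mul hψ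
  have hq : Function.HasTemperateGrowth
    (fun x : EE n => (∑ j, ∑ k, A j k * (x j : ℂ) * (x k : ℂ)) * cj u x) := (quad_temp A).fun_mul hψ
  have hll : ∀ k, Function.HasTemperateGrowth (fun x => lf B k x * pd k (cj u) x) :=
    fun k => (lf_temp B k).fun_mul (pd_temp hψ k)
  have e1 : ∀ x, cj u x * weylQuant A B C 1 (fun y => u y) x =
      ((∑ j, ∑ k, A j k * (x j : ℂ) * (x k : ℂ)) * cj u x) * u x
      + (-1) * (∑ j, ∑ k, C j k * (cj u x * sd j (sd k u) x))
      + (-(2 * Complex.I)) * (∑ k, (lf B k x * cj u x) * sd k u x)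
      + (-(Complex.I * (∑ j, B j j))) * (cj u x * u x) := by
    intro x
    rw [weyl_eq]
    have t1 : ∑ j, ∑ k, C j k * (cj u x * sd j (sd k u) x) = cj u x * ∑ j, ∑ k, C j k * sd j (sd k u) x := by
      simp only [Finset.mul_sum]
      exact Finset.sum_congr rfl fun j _ => Finset.sum_congr rfl fun k _ => by ring
    have t2 : ∑ k, (lf B k x * cj u x) * sd k u x = cj u x * ∑ k, lf B k x * sd k u x := by
      simp only [Finset.mul_sum]
      exact Finset.sum_congr rfl fun j _ => by ring
    rw [t1, t2]; ring
  have e2 : ∀ x, qPolar A B C (star (Xv u x)) (Xv u x) =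
      ((∑ j, ∑ k, A j k * (x j : ℂ) * (x k : ℂ)) * cj u x) * u x
      + 1 * (∑ j, ∑ k, C j k * (pd j (cj u) x * sd k u x))
      + (-Complex.I) * (∑ k, (lf B k x * cj u x) * sd k u x)
      + Complex.I * (∑ k, (lf B k x * pd k (cj u) x) * u x) := by
    intro x
    unfold qPolar
    simp only [Pi.star_apply, Xv, Sum.elim_inl, Sum.elim_inr, pd_cj, star_mul', star_neg,
      Complex.star_def, Complex.conj_I, Complex.conj_ofReal, cj]
    have t1 : ∑ j, ∑ k, A j k * ((x k : ℂ) * (starRingEnd ℂ) (u x)) * ((x j : ℂ) * u x) =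
        ((∑ j, ∑ k, A j k * (x j : ℂ) * (x k : ℂ)) * (starRingEnd ℂ) (u x)) * u x := by
      simp only [Finset.sum_mul]
      exact Finset.sum_congr rfl fun j _ => Finset.sum_congr rfl fun k _ => by ring
    have t2 : ∑ k, (∑ l, B k l * ((x l : ℂ) * (starRingEnd ℂ) (u x))) * (-Complex.I * sd k u x) =
        (-Complex.I) * (∑ k, (lf B k x * (starRingEnd ℂ) (u x)) * sd k u x) := by
      rw [Finset.mul_sum]
      refine Finset.sum_congr rfl fun k _ => ?_
      unfold lf
      simp only [Finset.sum_mul, Finset.mul_sum]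
      exact Finset.sum_congr rfl fun l _ => by ring
    have t3 : ∑ k, (∑ l, B k l * ((x l : ℂ) * u x)) * (- -Complex.I * (starRingEnd ℂ) (sd k u x)) =
        Complex.I * (∑ k, (lf B k x * (starRingEnd ℂ) (sd k u x)) * u x) := by
      rw [Finset.mul_sum]
      refine Finset.sum_congr rfl fun k _ => ?_
      unfold lf
      simp only [Finset.sum_mul, Finset.mul_sum]
      exact Finset.sum_congr rfl fun l _ => by ring
    have t4 : ∑ j, ∑ k, C j k * (- -Complex.I * (starRingEnd ℂ) (sd k u x)) * (-Complex.I * sd j u x) =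
        ∑ j, ∑ k, C j k * ((starRingEnd ℂ) (sd j u x) * sd k u x) := by
      rw [Finset.sum_comm]
      refine Finset.sum_congr rfl fun j _ => Finset.sum_congr rfl fun k _ => ?_
      rw [hCs.apply]
      linear_combination (-(C j k * (starRingEnd ℂ) (sd j u x) * sd k u x)) * Complex.I_sq
    rw [t1, t2, t3, t4]; ring
  have ic : Integrable (fun x => ∑ j, ∑ k, C j k * (cj u x * sd j (sd k u) x)) :=
    integrable_finsetSum _ fun j _ => integrable_finsetSum _ fun k _ => (hi hψ _).const_mul _
  have ic' : Integrable (fun x => ∑ j, ∑ k, C j k * (pd j (cj u) x * sd k u x)) :=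
    integrable_finsetSum _ fun j _ => integrable_finsetSum _ fun k _ =>
      (hi (pd_temp hψ j) _).const_mul _
  have ib : Integrable (fun x => ∑ k, (lf B k x * cj u x) * sd k u x) :=
    integrable_finsetSum _ fun k _ => hi (hl k) _
  have ib' : Integrable (fun x => ∑ k, (lf B k x * pd k (cj u) x) * u x) :=
    integrable_finsetSum _ fun k _ => hi (hll k) _
  have iu := hi hψ u
  have iq := hi hq u
  have f1 := int4 iq ic ib iu (-1) (-(2 * Complex.I)) (-(Complex.I * (∑ j, B j j)))
  have f2 := int4 iq ic' ib ib' 1 (-Complex.I) Complex.I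
  have g1 := (integral_congr_ae (μ := volume) (Filter.Eventually.of_forall e1)).trans f1
  have g2 := (integral_congr_ae (μ := volume) (Filter.Eventually.of_forall e2)).trans f2
  have eb := half_b B hψ u
  have ec : ∫ x, ∑ j, ∑ k, C j k * (cj u x * sd j (sd k u) x) =
      - ∫ x, ∑ j, ∑ k, C j k * (pd j (cj u) x * sd k u x) := by
    rw [int_sum2 C (fun j k x => cj u x * sd j (sd k u) x) fun j k => hi hψ _,
      int_sum2 C (fun j k x => pd j (cj u) x * sd k u x) fun j k => hi (pd_temp hψ j) _,
      ← Finset.sum_neg_distrib]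
    refine Finset.sum_congr rfl fun j _ => ?_
    rw [← Finset.sum_neg_distrib]
    refine Finset.sum_congr rfl fun k _ => ?_
    rw [ibp' hψ]; ring
  constructor
  · have : Integrable (fun x => ((∑ j, ∑ k, A j k * (x j : ℂ) * (x k : ℂ)) * cj u x) * u x
      + 1 * (∑ j, ∑ k, C j k * (pd j (cj u) x * sd k u x))
      + (-Complex.I) * (∑ k, (lf B k x * cj u x) * sd k u x)
      + Complex.I * (∑ k, (lf B k x * pd k (cj u) x) * u x)) :=
      ((iq.add (ic'.const_mul _)).add (ib.const_mul _)).add (ib'.const_mul _)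
    exact this.congr (Filter.Eventually.of_forall fun x => (e2 x).symm)
  · rw [g1, g2, ec]
    linear_combination (-Complex.I) * eb


theorem qF_lower {n : ℕ} (A B C : Matrix (Fin n) (Fin n) ℂ)
    (hpos : ∀ x ξ : Fin n → ℝ, ¬(x = 0 ∧ ξ = 0) →
      0 < (qForm A B C (fun j => (x j : ℂ)) (fun j => (ξ j : ℂ))).re) :
    ∃ c > 0, ∀ x ξ : Fin n → ℝ, c * ((∑ j, x j ^ 2) + ∑ j, ξ j ^ 2) ≤
      (qForm A B C (fun j => (x j : ℂ)) (fun j => (ξ j : ℂ))).re := by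
  obtain ⟨c, hc, h⟩ := homog_lower (E := EE n × EE n)
    (fun p => (qForm A B C (fun j => (p.1 j : ℂ)) (fun j => (p.2 j : ℂ))).re)
    (by
      unfold qForm
      fun_prop)
    (by
      intro t p
      have : qForm A B C (fun j => ((t • p).1 j : ℂ)) (fun j => ((t • p).2 j : ℂ)) =
        ((t ^ 2 : ℝ) : ℂ) * qForm A B C (fun j => (p.1 j : ℂ)) (fun j => (p.2 j : ℂ)) := by
        unfold qForm
        simp only [Prod.smul_fst, Prod.smul_snd, PiLp.smul_apply, smul_eq_mul, mul_add,
          Finset.mul_sum, Finset.sum_mul]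
        congr 1
        · congr 1
          · exact Finset.sum_congr rfl fun j _ => Finset.sum_congr rfl fun k _ => by
              push_cast; ring
          · exact Finset.sum_congr rfl fun j _ => Finset.sum_congr rfl fun k _ => by
              push_cast; ring
        · exact Finset.sum_congr rfl fun j _ => Finset.sum_congr rfl fun k _ => by
              push_cast; ring
      simp only [this, Complex.re_ofReal_mul])
    (by
      intro p hp
      refine hpos p.1 p.2 fun h => hp ?_
      apply Prod.ext
      · ext j; exact congrFun h.1 j
      · ext j; exact congrFun h.2 j)
  refine ⟨c / 2, by positivity, fun x ξ => ?_⟩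
  have h1 := h (WithLp.toLp 2 x, WithLp.toLp 2 ξ)
  refine le_trans ?_ h1
  have a1 : ‖(WithLp.toLp 2 x : EE n)‖ ^ 2 = ∑ j, x j ^ 2 := by
    rw [EuclideanSpace.real_norm_sq_eq]
  have a2 : ‖(WithLp.toLp 2 ξ : EE n)‖ ^ 2 = ∑ j, ξ j ^ 2 := by
    rw [EuclideanSpace.real_norm_sq_eq]
  rw [← a1, ← a2]
  have b1 : ‖(WithLp.toLp 2 x : EE n)‖ ≤ ‖((WithLp.toLp 2 x, WithLp.toLp 2 ξ) : EE n × EE n)‖ :=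
    norm_fst_le ((WithLp.toLp 2 x, WithLp.toLp 2 ξ) : EE n × EE n)
  have b2 : ‖(WithLp.toLp 2 ξ : EE n)‖ ≤ ‖((WithLp.toLp 2 x, WithLp.toLp 2 ξ) : EE n × EE n)‖ :=
    norm_snd_le ((WithLp.toLp 2 x, WithLp.toLp 2 ξ) : EE n × EE n)
  have c1 := pow_le_pow_left₀ (norm_nonneg _) b1 2
  have c2 := pow_le_pow_left₀ (norm_nonneg _) b2 2
  nlinarith

/-- energy density -/
noncomputable def p2 {n : ℕ} (u : SchwartzMap (EE n) ℂ) (x : EE n) : ℝ :=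
  ‖x‖ ^ 2 * ‖u x‖ ^ 2 + ∑ k, ‖sd k u x‖ ^ 2

theorem sq_int {n : ℕ} (u : SchwartzMap (EE n) ℂ) : Integrable (fun x => ‖u x‖ ^ 2) :=
  (u.memLp 2).integrable_norm_pow (by norm_num)

theorem p2_int {n : ℕ} (u : SchwartzMap (EE n) ℂ) : Integrable (p2 u) := by
  have : p2 u = fun x => (∑ j, ‖(SchwartzMap.smulLeftCLM ℂ (fun x : EE n => ((x j : ℝ) : ℂ)) u) x‖ ^ 2)
      + ∑ k, ‖sd k u x‖ ^ 2 := by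
    ext x
    unfold p2
    simp only [SchwartzMap.smulLeftCLM_apply_apply (coord_temp _), norm_smul, mul_pow,
      Complex.norm_real, ← Finset.sum_mul]
    rw [EuclideanSpace.norm_sq_eq]
  rw [this]
  exact (integrable_finsetSum _ fun j _ => sq_int _).add (integrable_finsetSum _ fun j _ => sq_int _)

theorem p2_nonneg {n : ℕ} (u : SchwartzMap (EE n) ℂ) (x : EE n) : 0 ≤ p2 u x := by
  unfold p2; positivity

theorem energy {n : ℕ} (A B C : Matrix (Fin n) (Fin n) ℂ) (hAs : A.IsSymm) (hCs : C.IsSymm)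
    (hpos : ∀ x ξ : Fin n → ℝ, ¬(x = 0 ∧ ξ = 0) →
      0 < (qForm A B C (fun j => (x j : ℂ)) (fun j => (ξ j : ℂ))).re) :
    ∃ c > 0, ∀ (ζ : ℂ) (u f : SchwartzMap (EE n) ℂ),
      (∀ x, f x = weylQuant A B C 1 (fun y => u y) x - ζ * u x) →
      c * ∫ x, p2 u x ≤ (∫ x, ‖f x‖ ^ 2) + (1 + ‖ζ‖) * ∫ x, ‖u x‖ ^ 2 := by
  obtain ⟨c, hc, hq⟩ := qF_lower A B C hpos
  refine ⟨c, hc, fun ζ u f hf => ?_⟩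
  obtain ⟨hIntZero, hid⟩ := energy_id A B C hCs u
  have hpt : ∀ x, c * p2 u x ≤ (qPolar A B C (star (Xv u x)) (Xv u x)).re := by
    intro x
    rw [sesq_eq A B C hAs hCs]
    have h1 := hq (fun j => (Xv u x (Sum.inl j)).re) (fun j => (Xv u x (Sum.inr j)).re)
    have h2 := hq (fun j => (Xv u x (Sum.inl j)).im) (fun j => (Xv u x (Sum.inr j)).im)
    refine le_trans (le_of_eq ?_) (add_le_add h1 h2)
    rw [← mul_add]
    congr 1
    have e : ∀ z : ℂ, z.re ^ 2 + z.im ^ 2 = ‖z‖ ^ 2 := fun z => by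
      rw [← Complex.normSq_eq_norm_sq, Complex.normSq_apply]; ring
    have e1 : ∑ j, (Xv u x (Sum.inl j)).re ^ 2 + ∑ j, (Xv u x (Sum.inl j)).im ^ 2 = ‖x‖ ^ 2 * ‖u x‖ ^ 2 := by
      rw [← Finset.sum_add_distrib]
      simp only [e, Xv, Sum.elim_inl, norm_mul, Complex.norm_real, mul_pow]
      rw [← Finset.sum_mul, EuclideanSpace.norm_sq_eq]
    have e2 : ∑ j, (Xv u x (Sum.inr j)).re ^ 2 + ∑ j, (Xv u x (Sum.inr j)).im ^ 2 = ∑ k, ‖sd k u x‖ ^ 2 := by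
      rw [← Finset.sum_add_distrib]
      simp only [e, Xv, Sum.elim_inr, norm_mul, norm_neg, Complex.norm_I, one_mul]
    unfold p2
    rw [← e1, ← e2]; ring
  have s1 : c * ∫ x, p2 u x ≤ (∫ x, qPolar A B C (star (Xv u x)) (Xv u x)).re := by
    have : (∫ x, qPolar A B C (star (Xv u x)) (Xv u x)).re =
        ∫ x, (qPolar A B C (star (Xv u x)) (Xv u x)).re := (integral_re hIntZero).symm
    rw [this, ← integral_const_mul]
    exact integral_mono ((p2_int u).const_mul _) hIntZero.re hpt
  have s2 : (∫ x, cj u x * weylQuant A B C 1 (fun y => u y) x).re ≤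
      ∫ x, (‖f x‖ ^ 2 + (1 + ‖ζ‖) * ‖u x‖ ^ 2) := by
    refine (Complex.re_le_norm _).trans ((norm_integral_le_integral_norm _).trans ?_)
    apply integral_mono_of_nonneg (Filter.Eventually.of_forall fun x => norm_nonneg _)
      ((sq_int f).add ((sq_int u).const_mul _))
    refine Filter.Eventually.of_forall fun x => ?_
    have e : weylQuant A B C 1 (fun y => u y) x = f x + ζ * u x := by rw [hf]; ring
    simp only [e, norm_mul, cj, norm_star]
    have t := norm_add_le (f x) (ζ * u x)
    rw [norm_mul] at t
    have hu := norm_nonneg (u x)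
    have := mul_le_mul_of_nonneg_left t hu
    simp only [Pi.add_apply]
    nlinarith [sq_nonneg (‖f x‖ - ‖u x‖), sq_nonneg (‖f x‖ ), sq_nonneg (‖u x‖ )]
  rw [integral_add (sq_int f) ((sq_int u).const_mul _), integral_const_mul] at s2
  rw [hid] at s2
  exact s1.trans s2


noncomputable def tr {n : ℕ} (T : Matrix (Fin n) (Fin n) ℂ) (z : Fin n → ℂ) (K : ℕ) (x : EE n) : ℂ :=
  ∏ j, ∑ k ∈ Finset.range K, (z j * lf T j x) ^ k / (k.factorial : ℂ)

theorem tr_norm1 (K : ℕ) (w : ℂ) :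
    ‖∑ k ∈ Finset.range K, w ^ k / (k.factorial : ℂ)‖ ≤ Real.exp ‖w‖ := by
  refine le_trans (norm_sum_le _ _) ?_
  refine le_trans (le_of_eq ?_) (Real.sum_le_exp_of_nonneg (norm_nonneg w) K)
  refine Finset.sum_congr rfl fun k _ => ?_
  simp

theorem tr_expand {n : ℕ} (G T : Matrix (Fin n) (Fin n) ℂ) (z : Fin n → ℂ) (K : ℕ) (x : EE n) :
    tr T z K x * gau G x =
      ∑ α ∈ Fintype.piFinset (fun _ : Fin n => Finset.range K),
        (∏ j, z j ^ (α j)) * psi G T (fun j => (α j : ℤ)) x := by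
  unfold tr
  rw [Finset.prod_univ_sum, Finset.sum_mul]
  refine Finset.sum_congr rfl fun α _ => ?_
  unfold psi
  rw [← mul_assoc, ← Finset.prod_mul_distrib]
  congr 1
  refine Finset.prod_congr rfl fun j _ => ?_
  unfold dp
  rw [if_neg (by simp), Int.toNat_natCast, mul_pow]
  ring

theorem geo_prod (n K : ℕ) :
    ∑ α ∈ Fintype.piFinset (fun _ : Fin n => Finset.range K), ∏ j : Fin n, ((1:ℝ)/2) ^ (α j) ≤ 2 ^ n := by
  have := Finset.prod_univ_sum (fun _ : Fin n => Finset.range K) (fun _ k => ((1:ℝ)/2) ^ k)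
  rw [← this]
  simp only [Finset.prod_const, Finset.card_univ, Fintype.card_fin]
  have h := sum_geometric_two_le K
  exact pow_le_pow_left₀ (Finset.sum_nonneg fun _ _ => by positivity) h n

theorem tr_int {n : ℕ} (G T : Matrix (Fin n) (Fin n) ℂ)
    (hG : ∀ x : EE n, 0 ≤ (∑ j, ∑ k, G j k * (x j : ℂ) * (x k : ℂ)).re)
    (r b S : ℝ) (hr : 0 < r) (hb : 0 < b) (z : Fin n → ℂ) (hz : ∀ j, ‖z j‖ ≤ r * b ^ j.val / 2)
    (u : SchwartzMap (EE n) ℂ) (hS : ∀ α, ‖∫ x, psi G T α x * u x‖ * wt r b α ≤ S) (K : ℕ) :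
    ‖∫ x, tr T z K x * gau G x * u x‖ ≤ 2 ^ n * S := by
  have e : ∀ x, tr T z K x * gau G x * u x =
      ∑ α ∈ Fintype.piFinset (fun _ : Fin n => Finset.range K),
        (∏ j, z j ^ (α j)) * (psi G T (fun j => (α j : ℤ)) x * u x) := by
    intro x
    rw [tr_expand, Finset.sum_mul]
    exact Finset.sum_congr rfl fun α _ => by ring
  have e2 : ∫ x, tr T z K x * gau G x * u x =
      ∑ α ∈ Fintype.piFinset (fun _ : Fin n => Finset.range K),
        (∏ j, z j ^ (α j)) * ∫ x, psi G T (fun j => (α j : ℤ)) x * u x := by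
    refine (integral_congr_ae (μ := volume) (Filter.Eventually.of_forall e)).trans ?_
    rw [integral_finsetSum]
    · exact Finset.sum_congr rfl fun α _ => integral_const_mul _ _
    · intro α _
      exact (int_ts (psi_temp G T hG _) u).const_mul _
  rw [e2]
  have hS0 : 0 ≤ S := le_trans (mul_nonneg (norm_nonneg _) (wt_pos hr hb 0).le) (hS 0)
  refine (norm_sum_le _ _).trans ?_
  refine le_trans ?_ (mul_le_mul_of_nonneg_right (geo_prod n K) hS0)
  rw [Finset.sum_mul]
  refine Finset.sum_le_sum fun α _ => ?_
  have h1 := hS (fun j => (α j : ℤ))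
  rw [norm_mul, norm_prod]
  have h2 : ∏ j, ‖z j ^ (α j)‖ ≤ (∏ j : Fin n, ((1:ℝ)/2) ^ (α j)) * wt r b (fun j => (α j : ℤ)) := by
    unfold wt
    rw [← Finset.prod_mul_distrib]
    refine Finset.prod_le_prod (fun _ _ => norm_nonneg _) fun j _ => ?_
    rw [norm_pow, zpow_natCast, ← mul_pow]
    refine pow_le_pow_left₀ (norm_nonneg _) ((hz j).trans (le_of_eq (by ring))) _
  calc _ ≤ ((∏ j : Fin n, ((1:ℝ)/2) ^ (α j)) * wt r b (fun j => (α j : ℤ))) * ‖∫ x, psi G T (fun j => (α j : ℤ)) x * u x‖ :=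
        mul_le_mul_of_nonneg_right h2 (norm_nonneg _)
    _ = (∏ j : Fin n, ((1:ℝ)/2) ^ (α j)) * (‖∫ x, psi G T (fun j => (α j : ℤ)) x * u x‖ * wt r b (fun j => (α j : ℤ))) := by ring
    _ ≤ _ := mul_le_mul_of_nonneg_left h1 (Finset.prod_nonneg fun _ _ => by positivity)

theorem lf_cont {n : ℕ} (T : Matrix (Fin n) (Fin n) ℂ) (j : Fin n) : Continuous (fun x : EE n => lf T j x) := by
  unfold lf; fun_prop

theorem gau_cont {n : ℕ} (G : Matrix (Fin n) (Fin n) ℂ) : Continuous (fun x : EE n => gau G x) := by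
  unfold gau; fun_prop

theorem tr_cont {n : ℕ} (T : Matrix (Fin n) (Fin n) ℂ) (z : Fin n → ℂ) (K : ℕ) :
    Continuous (fun x : EE n => tr T z K x) := by
  unfold tr
  have := lf_cont T
  fun_prop

theorem exp_tendsto (w : ℂ) :
    Filter.Tendsto (fun K => ∑ k ∈ Finset.range K, w ^ k / (k.factorial : ℂ)) Filter.atTop (nhds (Complex.exp w)) := by
  have := (NormedSpace.expSeries_div_hasSum_exp w).tendsto_sum_nat
  rwa [← Complex.exp_eq_exp_ℂ] at this

theorem V_exp {n : ℕ} (G T : Matrix (Fin n) (Fin n) ℂ) (c : ℝ) (hc0 : 0 < c)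
    (hc : ∀ x : EE n, c * ‖x‖ ^ 2 ≤ (∑ j, ∑ k, G j k * (x j:ℂ) * (x k:ℂ)).re)
    (r b S : ℝ) (hr : 0 < r) (hb : 0 < b) (z : Fin n → ℂ) (hz : ∀ j, ‖z j‖ ≤ r * b ^ j.val / 2)
    (u : SchwartzMap (EE n) ℂ) (hS : ∀ α, ‖∫ x, psi G T α x * u x‖ * wt r b α ≤ S) :
    ‖∫ x, Complex.exp (∑ j, z j * lf T j x) * gau G x * u x‖ ≤ 2 ^ n * S := by
  have hG : ∀ x : EE n, 0 ≤ (∑ j, ∑ k, G j k * (x j : ℂ) * (x k : ℂ)).re := fun x =>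
    le_trans (by positivity) (hc x)
  obtain ⟨K1, hK1, h1⟩ := psi_norm G T c b hc0 hb hc
  have lim : Filter.Tendsto (fun K => ∫ x, tr T z K x * gau G x * u x) Filter.atTop
      (nhds (∫ x, Complex.exp (∑ j, z j * lf T j x) * gau G x * u x)) := by
    apply tendsto_integral_of_dominated_convergence (fun x => Real.exp (K1 * r ^ 2) * ‖u x‖)
    · intro K
      exact (((tr_cont T z K).mul (gau_cont G)).mul u.continuous).aestronglyMeasurable
    · exact (u.integrable (μ := volume)).norm.const_mul _
    · intro K
      refine Filter.Eventually.of_forall fun x => ?_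
      rw [norm_mul]
      refine mul_le_mul_of_nonneg_right ?_ (norm_nonneg _)
      refine le_trans ?_ ((h1 r hr x).trans ?_)
      · rw [norm_mul]
        refine mul_le_mul_of_nonneg_right ?_ (norm_nonneg _)
        unfold tr
        rw [norm_prod, Real.exp_sum]
        refine Finset.prod_le_prod (fun _ _ => norm_nonneg _) fun j _ => ?_
        refine (tr_norm1 K _).trans ?_
        rw [norm_mul]
        have : 0 ≤ r * b ^ j.val := by positivity
        have := hz j
        gcongr
        linarith
      · have : Real.exp (-(c / 4) * ‖x‖ ^ 2) ≤ 1 := Real.exp_le_one_iff.2 (by nlinarith [sq_nonneg ‖x‖])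
        nlinarith [Real.exp_pos (K1 * r ^ 2)]
    · refine Filter.Eventually.of_forall fun x => ?_
      refine Filter.Tendsto.mul_const _ (Filter.Tendsto.mul_const _ ?_)
      rw [Complex.exp_sum]
      exact tendsto_finsetProd _ fun j _ => exp_tendsto _
  refine le_of_tendsto lim.norm (Filter.Eventually.of_forall fun K => ?_)
  exact tr_int G T hG r b S hr hb z hz u hS K

open scoped FourierTransform

/-- windowed function -/
noncomputable def wS {n : ℕ} (G : Matrix (Fin n) (Fin n) ℂ) (x0 : EE n) (u : SchwartzMap (EE n) ℂ) :
    SchwartzMap (EE n) ℂ := SchwartzMap.smulLeftCLM ℂ (fun x => gau G (x - x0)) u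

theorem gau_tr_temp {n : ℕ} (G : Matrix (Fin n) (Fin n) ℂ)
    (hG : ∀ x : EE n, 0 ≤ (∑ j, ∑ k, G j k * (x j : ℂ) * (x k : ℂ)).re) (x0 : EE n) :
    Function.HasTemperateGrowth (fun x => gau G (x - x0)) := by
  have := gau_temp G hG
  fun_prop

theorem wS_apply {n : ℕ} (G : Matrix (Fin n) (Fin n) ℂ)
    (hG : ∀ x : EE n, 0 ≤ (∑ j, ∑ k, G j k * (x j : ℂ) * (x k : ℂ)).re) (x0 : EE n)
    (u : SchwartzMap (EE n) ℂ) (x : EE n) : wS G x0 u x = gau G (x - x0) * u x := by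
  unfold wS
  rw [SchwartzMap.smulLeftCLM_apply_apply (gau_tr_temp G hG x0), smul_eq_mul]

theorem sd_wS {n : ℕ} (G : Matrix (Fin n) (Fin n) ℂ) (hGs : G.IsSymm)
    (hG : ∀ x : EE n, 0 ≤ (∑ j, ∑ k, G j k * (x j : ℂ) * (x k : ℂ)).re) (x0 : EE n)
    (u : SchwartzMap (EE n) ℂ) (k : Fin n) (x : EE n) :
    sd k (wS G x0 u) x = gau G (x - x0) * sd k u x - lf G k (x - x0) * gau G (x - x0) * u x := by
  have e : (wS G x0 u : EE n → ℂ) = fun x => gau G (x - x0) * u x := funext fun x => wS_apply G hG x0 u x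
  rw [sd_apply, sd_apply, e]
  have d1 : DifferentiableAt ℝ (gau G) (x - x0) := ((gau_temp G hG).1.differentiable (by simp)).differentiableAt
  have d2 : DifferentiableAt ℝ (fun x => gau G (x - x0)) x :=
    ((gau_tr_temp G hG x0).1.differentiable (by simp)).differentiableAt
  have d3 : DifferentiableAt ℝ u x := u.differentiableAt
  rw [fderiv_fun_mul d2 d3]
  have h1 : fderiv ℝ (fun x => gau G (x - x0)) x = fderiv ℝ (gau G) (x - x0) := fderiv_comp_sub x0
  have h2 : fderiv ℝ (gau G) (x - x0) (EuclideanSpace.single k 1) = -(lf G k (x - x0)) * gau G (x - x0) :=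
    (d1.hasFDerivAt.hasLineDerivAt _).unique (gau_line G hGs k (x - x0))
  simp only [add_apply, smul_apply, smul_eq_mul, h1, h2]
  ring

theorem gau_shift {n : ℕ} (G : Matrix (Fin n) (Fin n) ℂ) (hGs : G.IsSymm) (x x0 : EE n) :
    gau G (x - x0) = gau G x0 * (Complex.exp (∑ k, lf G k x0 * (x k : ℂ)) * gau G x) := by
  unfold gau lf
  rw [← Complex.exp_add, ← Complex.exp_add]
  congr 1
  have e : ∑ j, ∑ k, G j k * (x0 j : ℂ) * (x k : ℂ) = ∑ j, ∑ k, G j k * (x j : ℂ) * (x0 k : ℂ) := by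
    rw [Finset.sum_comm]
    refine Finset.sum_congr rfl fun j _ => Finset.sum_congr rfl fun k _ => ?_
    have : G k j = G j k := by rw [← hGs.apply]
    rw [this]; ring
  have e2 : ∑ k, (∑ l, G k l * (x0 l : ℂ)) * (x k : ℂ) = ∑ j, ∑ k, G j k * (x j : ℂ) * (x0 k : ℂ) := by
    refine Finset.sum_congr rfl fun j _ => ?_
    rw [Finset.sum_mul]
    exact Finset.sum_congr rfl fun k _ => by ring
  have e3 : ∑ j, ∑ k, G j k * ((x - x0) j : ℂ) * ((x - x0) k : ℂ) =
      ∑ j, ∑ k, G j k * (x j : ℂ) * (x k : ℂ) - ∑ j, ∑ k, G j k * (x j : ℂ) * (x0 k : ℂ)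
      - ∑ j, ∑ k, G j k * (x0 j : ℂ) * (x k : ℂ) + ∑ j, ∑ k, G j k * (x0 j : ℂ) * (x0 k : ℂ) := by
    simp only [← Finset.sum_sub_distrib, ← Finset.sum_add_distrib]
    refine Finset.sum_congr rfl fun j _ => Finset.sum_congr rfl fun k _ => ?_
    simp
    ring
  rw [e3, e, e2]
  ring

theorem coord_lf {n : ℕ} (T Ti : Matrix (Fin n) (Fin n) ℂ) (hT : Ti * T = 1) (y : Fin n → ℂ) (x : EE n) :
    ∑ k, y k * (x k : ℂ) = ∑ j, (∑ k, Ti k j * y k) * lf T j x := by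
  have e : ∀ k, (x k : ℂ) = ∑ j, Ti k j * lf T j x := by
    intro k
    unfold lf
    have h := congrArg (fun M => M.mulVec (fun k => (x k : ℂ)) k) hT
    simp only [Matrix.one_mulVec, ← Matrix.mulVec_mulVec] at h
    rw [← h]
    simp [Matrix.mulVec, dotProduct]
  simp only [Finset.sum_mul]
  rw [Finset.sum_comm]
  refine Finset.sum_congr rfl fun k _ => ?_
  conv_lhs => rw [e k, Finset.mul_sum]
  exact Finset.sum_congr rfl fun j _ => by ring

theorem gau_le_one {n : ℕ} (G : Matrix (Fin n) (Fin n) ℂ) (c : ℝ) (hc0 : 0 < c)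
    (hc : ∀ x : EE n, c * ‖x‖ ^ 2 ≤ (∑ j, ∑ k, G j k * (x j:ℂ) * (x k:ℂ)).re) (x : EE n) :
    ‖gau G x‖ ≤ 1 :=
  (gau_norm G c hc x).trans (Real.exp_le_one_iff.2 (by nlinarith [sq_nonneg ‖x‖]))

/-- pointwise bound of the windowed Fourier transform -/
theorem stft_bound {n : ℕ} (G T Ti : Matrix (Fin n) (Fin n) ℂ) (hGs : G.IsSymm) (c : ℝ) (hc0 : 0 < c)
    (hc : ∀ x : EE n, c * ‖x‖ ^ 2 ≤ (∑ j, ∑ k, G j k * (x j:ℂ) * (x k:ℂ)).re) (hT : Ti * T = 1)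
    (b : ℝ) (hb : 1 ≤ b) :
    ∃ C4 ≥ 1, ∀ ρ > 0, ∀ (S : ℝ) (u : SchwartzMap (EE n) ℂ),
      (∀ α, ‖∫ x, psi G T α x * u x‖ * wt (C4 * ρ) b α ≤ S) →
      ∀ x0 ξ : EE n, ‖x0‖ ≤ ρ → ‖ξ‖ ≤ ρ → ‖(𝓕 (wS G x0 u)) ξ‖ ≤ 2 ^ n * S := by
  have hG : ∀ x : EE n, 0 ≤ (∑ j, ∑ k, G j k * (x j : ℂ) * (x k : ℂ)).re := fun x =>
    le_trans (by positivity) (hc x)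
  set Q : ℝ := ∑ j, ∑ k, ‖Ti k j‖ * ((∑ l, ‖G k l‖) + 2 * Real.pi) with hQ
  have hQ0 : 0 ≤ Q := Finset.sum_nonneg fun _ _ => Finset.sum_nonneg fun _ _ => by
    have := Real.pi_pos
    have : 0 ≤ ∑ l, ‖G ‹_› l‖ := Finset.sum_nonneg fun _ _ => norm_nonneg _
    positivity
  refine ⟨2 * Q + 1, by linarith, fun ρ hρ S u hS x0 ξ hx0 hξ => ?_⟩
  set y : Fin n → ℂ := fun k => lf G k x0 - 2 * Real.pi * Complex.I * (ξ k : ℂ) with hy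
  set z : Fin n → ℂ := fun j => ∑ k, Ti k j * y k with hz
  have hyb : ∀ k, ‖y k‖ ≤ ((∑ l, ‖G k l‖) + 2 * Real.pi) * ρ := by
    intro k
    have h1 := lf_norm G k x0
    have h2 : ‖(ξ k : ℂ)‖ ≤ ρ := by
      rw [Complex.norm_real]; exact (PiLp.norm_apply_le ξ k).trans hξ
    have h3 : 0 ≤ ∑ l, ‖G k l‖ := Finset.sum_nonneg fun _ _ => norm_nonneg _
    have hpi := Real.pi_pos
    calc ‖y k‖ ≤ ‖lf G k x0‖ + ‖2 * Real.pi * Complex.I * (ξ k : ℂ)‖ := norm_sub_le _ _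
      _ = ‖lf G k x0‖ + 2 * Real.pi * ‖(ξ k : ℂ)‖ := by
          rw [norm_mul]; simp [abs_of_pos hpi]
      _ ≤ (∑ l, ‖G k l‖) * ρ + 2 * Real.pi * ρ := by
          have := mul_le_mul_of_nonneg_left hx0 h3
          gcongr
          linarith
      _ = _ := by ring
  have hzb : ∀ j, ‖z j‖ ≤ ((2 * Q + 1) * ρ) * b ^ j.val / 2 := by
    intro j
    have h1 : ‖z j‖ ≤ Q * ρ := by
      calc ‖z j‖ ≤ ∑ k, ‖Ti k j‖ * ‖y k‖ := by
            refine (norm_sum_le _ _).trans (le_of_eq (Finset.sum_congr rfl fun k _ => norm_mul _ _))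
        _ ≤ ∑ k, ‖Ti k j‖ * (((∑ l, ‖G k l‖) + 2 * Real.pi) * ρ) := by
            gcongr with k; exact hyb k
        _ = (∑ k, ‖Ti k j‖ * ((∑ l, ‖G k l‖) + 2 * Real.pi)) * ρ := by
            rw [Finset.sum_mul]; exact Finset.sum_congr rfl fun k _ => by ring
        _ ≤ Q * ρ := by
            refine mul_le_mul_of_nonneg_right ?_ hρ.le
            refine Finset.single_le_sum (f := fun j => ∑ k, ‖Ti k j‖ * ((∑ l, ‖G k l‖) + 2 * Real.pi))
              (fun j _ => Finset.sum_nonneg fun k _ => ?_) (Finset.mem_univ j)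
            have := Real.pi_pos
            have : 0 ≤ ∑ l, ‖G k l‖ := Finset.sum_nonneg fun _ _ => norm_nonneg _
            positivity
    have h2 : 1 ≤ b ^ j.val := one_le_pow₀ hb
    have h3 : 0 ≤ Q * ρ := by positivity
    nlinarith
  have key := V_exp G T c hc0 hc ((2 * Q + 1) * ρ) b S (by positivity) (by linarith) z hzb u hS
  rw [SchwartzMap.fourier_coe, Real.fourier_eq']
  have e : ∀ v : EE n, Complex.exp (↑(-2 * Real.pi * inner ℝ v ξ) * Complex.I) • wS G x0 u v =
      gau G x0 * (Complex.exp (∑ j, z j * lf T j v) * gau G v * u v) := by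
    intro v
    rw [wS_apply G hG, gau_shift G hGs, smul_eq_mul, hz, ← coord_lf T Ti hT y v]
    have e1 : ∑ k, y k * (v k : ℂ) = ↑(-2 * Real.pi * inner ℝ v ξ) * Complex.I + ∑ k, lf G k x0 * (v k : ℂ) := by
      rw [PiLp.inner_apply]
      push_cast
      rw [Finset.mul_sum, Finset.sum_mul, ← Finset.sum_add_distrib]
      refine Finset.sum_congr rfl fun k _ => ?_
      simp only [hy]
      simp
      ring
    rw [e1, Complex.exp_add]
    ring
  rw [integral_congr_ae (μ := volume) (Filter.Eventually.of_forall e), integral_const_mul, norm_mul]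
  calc _ ≤ 1 * _ := mul_le_mul_of_nonneg_right (gau_le_one G c hc0 hc x0) (norm_nonneg _)
    _ ≤ _ := by rw [one_mul]; exact key

theorem planch_cut {n : ℕ} (w : SchwartzMap (EE n) ℂ) (ρ D : ℝ) (hρ : 0 < ρ)
    (hD : ∀ ξ : EE n, ‖ξ‖ ≤ ρ → ‖(𝓕 w) ξ‖ ≤ D) :
    ρ ^ 2 * ∫ x, ‖w x‖ ^ 2 ≤ ρ ^ 2 * (volume.real (Metric.closedBall (0 : EE n) ρ) * D ^ 2)
      + ∑ k, ∫ x, ‖sd k w x‖ ^ 2 := by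
  have e1 : ∑ k, ∫ x, ‖sd k w x‖ ^ 2 = ∫ ξ, ∑ k, ‖(𝓕 (sd k w)) ξ‖ ^ 2 := by
    rw [integral_finsetSum _ fun k _ => sq_int _]
    exact Finset.sum_congr rfl fun k _ => (SchwartzMap.integral_norm_sq_fourier _).symm
  have hI : Integrable (fun ξ : EE n => Set.indicator (Metric.closedBall (0 : EE n) ρ) (fun _ => D ^ 2) ξ) :=
    (integrable_indicator_iff Metric.isClosed_closedBall.measurableSet).2
      (integrableOn_const (by exact measure_closedBall_lt_top.ne))
  have e2 : volume.real (Metric.closedBall (0 : EE n) ρ) * D ^ 2 =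
      ∫ ξ, Set.indicator (Metric.closedBall (0 : EE n) ρ) (fun _ => D ^ 2) ξ := by
    rw [integral_indicator Metric.isClosed_closedBall.measurableSet, setIntegral_const, smul_eq_mul]
  rw [e1, e2, ← SchwartzMap.integral_norm_sq_fourier w, ← integral_const_mul, ← integral_const_mul,
    ← integral_add (hI.const_mul _) (integrable_finsetSum _ fun k _ => sq_int _)]
  refine integral_mono ((sq_int _).const_mul _)
    ((hI.const_mul _).add (integrable_finsetSum _ fun k _ => sq_int _)) fun ξ => ?_
  have hs : ∀ k, ‖(𝓕 (sd k w)) ξ‖ = 2 * Real.pi * (|ξ k| * ‖(𝓕 w) ξ‖) := by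
    intro k
    unfold sd
    have ht : Function.HasTemperateGrowth (fun x : EE n => (inner ℝ x (EuclideanSpace.single k 1) : ℝ)) := by
      fun_prop
    rw [SchwartzMap.fourier_lineDerivOp_eq, smul_apply, SchwartzMap.smulLeftCLM_apply_apply ht,
      norm_smul, norm_smul]
    have hpi := Real.pi_pos
    have e0 : (inner ℝ ξ (EuclideanSpace.single k 1) : ℝ) = ξ k := by
      rw [EuclideanSpace.inner_single_right]; simp
    rw [e0]
    simp [abs_of_pos hpi]
  have hsum : ‖ξ‖ ^ 2 * ‖(𝓕 w) ξ‖ ^ 2 ≤ ∑ k, ‖(𝓕 (sd k w)) ξ‖ ^ 2 := by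
    rw [EuclideanSpace.norm_sq_eq, Finset.sum_mul]
    refine Finset.sum_le_sum fun k _ => ?_
    rw [hs k, mul_pow, mul_pow]
    have hpi := Real.pi_gt_three
    have : 1 ≤ (2 * Real.pi) ^ 2 := by nlinarith
    have h0 : 0 ≤ |ξ k| ^ 2 * ‖(𝓕 w) ξ‖ ^ 2 := by positivity
    have e : ‖ξ k‖ = |ξ k| := Real.norm_eq_abs _
    rw [e]
    nlinarith
  have hnn : 0 ≤ ∑ k, ‖(𝓕 (sd k w)) ξ‖ ^ 2 := Finset.sum_nonneg fun _ _ => by positivity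
  simp only []
  by_cases h : ‖ξ‖ ≤ ρ
  · rw [Set.indicator_of_mem (by simpa using h)]
    have h1 : ‖(𝓕 w) ξ‖ ^ 2 ≤ D ^ 2 := pow_le_pow_left₀ (norm_nonneg _) (hD ξ h) 2
    have := mul_le_mul_of_nonneg_left h1 (sq_nonneg ρ)
    linarith
  · rw [Set.indicator_of_notMem (by simpa using h)]
    push Not at h
    have h1 : ρ ^ 2 ≤ ‖ξ‖ ^ 2 := pow_le_pow_left₀ hρ.le h.le 2
    have := mul_le_mul_of_nonneg_right h1 (sq_nonneg ‖(𝓕 w) ξ‖)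
    linarith


theorem conv_int {n : ℕ} (H Φ : EE n → ℝ) (hH : Integrable H) (hΦ : Integrable Φ) :
    Integrable (fun x0 => ∫ x, H x * Φ (x - x0)) ∧
      ∫ x0, ∫ x, H x * Φ (x - x0) = (∫ x, H x) * ∫ x, Φ x := by
  have hΦ' : Integrable (fun x => Φ (-x)) := hΦ.comp_neg
  have e : (fun x0 => ∫ x, H x * Φ (x - x0)) =
      convolution H (fun x => Φ (-x)) (ContinuousLinearMap.mul ℝ ℝ) volume := by
    ext x0
    simp [convolution]
  constructor
  · rw [e]
    exact hH.integrable_convolution _ hΦ'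
  · rw [e, integral_convolution _ hH hΦ']
    simp only [ContinuousLinearMap.mul_apply']
    rw [integral_neg_eq_self Φ]

theorem lf_sub_norm {n : ℕ} (G : Matrix (Fin n) (Fin n) ℂ) : ∃ Q ≥ 1, ∀ y : EE n,
    1 + ‖y‖ ^ 2 + ∑ k, ‖lf G k y‖ ^ 2 ≤ Q * (1 + ‖y‖ ^ 2) := by
  refine ⟨1 + ∑ k, (∑ l, ‖G k l‖) ^ 2, ?_, fun y => ?_⟩
  · have : 0 ≤ ∑ k, (∑ l, ‖G k l‖) ^ 2 := Finset.sum_nonneg fun _ _ => by positivity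
    linarith
  · have h : ∑ k, ‖lf G k y‖ ^ 2 ≤ (∑ k, (∑ l, ‖G k l‖) ^ 2) * ‖y‖ ^ 2 := by
      rw [Finset.sum_mul]
      refine Finset.sum_le_sum fun k _ => ?_
      rw [← mul_pow]
      exact pow_le_pow_left₀ (norm_nonneg _) (lf_norm G k y) 2
    have : 0 ≤ ∑ k, (∑ l, ‖G k l‖) ^ 2 := Finset.sum_nonneg fun _ _ => by positivity
    nlinarith

theorem win_dom {n : ℕ} (G : Matrix (Fin n) (Fin n) ℂ) (c : ℝ) (hc0 : 0 < c)
    (hc : ∀ x : EE n, c * ‖x‖ ^ 2 ≤ (∑ j, ∑ k, G j k * (x j:ℂ) * (x k:ℂ)).re) :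
    ∃ M ≥ 1, ∀ y : EE n, ‖gau G y‖ ^ 2 * (1 + ‖y‖ ^ 2 + ∑ k, ‖lf G k y‖ ^ 2) ≤
      M * Real.exp (-(c / 2) * ‖y‖ ^ 2) := by
  obtain ⟨Q, hQ, h⟩ := lf_sub_norm G
  have h2c : 0 ≤ 2 / c := by positivity
  refine ⟨Q * (1 + 2 / c), by nlinarith, fun y => ?_⟩
  have h1 : ‖gau G y‖ ^ 2 ≤ Real.exp (-(c / 2) * ‖y‖ ^ 2) * Real.exp (-(c / 2) * ‖y‖ ^ 2) := by
    have := pow_le_pow_left₀ (norm_nonneg _) (gau_norm G c hc y) 2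
    rwa [pow_two (Real.exp _)] at this
  have h2 : (1 + ‖y‖ ^ 2) * Real.exp (-(c / 2) * ‖y‖ ^ 2) ≤ 1 + 2 / c := by
    have h3 := Real.add_one_le_exp (c / 2 * ‖y‖ ^ 2)
    have h4 : 1 + ‖y‖ ^ 2 ≤ (1 + 2 / c) * (c / 2 * ‖y‖ ^ 2 + 1) := by
      have : (2 / c) * (c / 2 * ‖y‖ ^ 2) = ‖y‖ ^ 2 := by field_simp
      have h5 : 0 ≤ c / 2 * ‖y‖ ^ 2 := by positivity
      nlinarith
    have h5 : (1 + ‖y‖ ^ 2) ≤ (1 + 2 / c) * Real.exp (c / 2 * ‖y‖ ^ 2) :=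
      h4.trans (mul_le_mul_of_nonneg_left h3 (by positivity))
    calc _ ≤ (1 + 2 / c) * Real.exp (c / 2 * ‖y‖ ^ 2) * Real.exp (-(c / 2) * ‖y‖ ^ 2) :=
          mul_le_mul_of_nonneg_right h5 (Real.exp_pos _).le
      _ = 1 + 2 / c := by
          rw [mul_assoc, ← Real.exp_add]
          have : c / 2 * ‖y‖ ^ 2 + -(c / 2) * ‖y‖ ^ 2 = 0 := by ring
          rw [this, Real.exp_zero, mul_one]
  set E := Real.exp (-(c / 2) * ‖y‖ ^ 2) with hE
  have hE0 : 0 < E := Real.exp_pos _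
  calc _ ≤ (E * E) * (Q * (1 + ‖y‖ ^ 2)) := by
        refine mul_le_mul h1 (h y) ?_ (by positivity)
        have : 0 ≤ ∑ k, ‖lf G k y‖ ^ 2 := Finset.sum_nonneg fun _ _ => by positivity
        positivity
    _ = Q * ((1 + ‖y‖ ^ 2) * E) * E := by ring
    _ ≤ _ := by gcongr

noncomputable def Hu {n : ℕ} (u : SchwartzMap (EE n) ℂ) (x : EE n) : ℝ := ‖u x‖ ^ 2 + p2 u x

theorem Hu_int {n : ℕ} (u : SchwartzMap (EE n) ℂ) : Integrable (Hu u) := (sq_int u).add (p2_int u)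

theorem HuE_int {n : ℕ} (u : SchwartzMap (EE n) ℂ) (κ : ℝ) (hκ : 0 < κ) (x0 : EE n) :
    Integrable (fun x => Hu u x * Real.exp (-κ * ‖x - x0‖ ^ 2)) := by
  refine (Hu_int u).mul_bdd (c := 1) ?_ ?_
  · exact (by fun_prop : Continuous fun x : EE n => Real.exp (-κ * ‖x - x0‖ ^ 2)).aestronglyMeasurable
  · refine Filter.Eventually.of_forall fun x => ?_
    rw [Real.norm_eq_abs, abs_of_pos (Real.exp_pos _)]
    exact Real.exp_le_one_iff.2 (by nlinarith [sq_nonneg ‖x - x0‖])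

theorem alg1 (gg ll ss uu xx M E : ℝ) (hgg : 0 ≤ gg) (hll : 0 ≤ ll) (hs0 : 0 ≤ ss) (hu0 : 0 ≤ uu)
    (hx0 : 0 ≤ xx) (h6 : gg * (1 + ll) ≤ M * E) :
    2 * gg * ss + 2 * gg * uu * ll ≤ 2 * M * ((uu + (xx + ss)) * E) := by
  have h7 : (gg * (1 + ll)) * (uu + (xx + ss)) ≤ (M * E) * (uu + (xx + ss)) :=
    mul_le_mul_of_nonneg_right h6 (by positivity)
  have a1 : 0 ≤ gg * ll * ss := by positivity
  have a2 : 0 ≤ gg * (1 + ll) * xx := by positivity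
  have a3 : 0 ≤ gg * uu := by positivity
  nlinarith

theorem alg2 (ss uu xx M E : ℝ) (h : 0 ≤ M * E * ss) :
    2 * ((1 + xx) * uu) * (M * E) ≤ 2 * M * ((uu + (xx * uu + ss)) * E) := by
  nlinarith

theorem stft_pt {n : ℕ} (G : Matrix (Fin n) (Fin n) ℂ) (hGs : G.IsSymm) (c : ℝ) (hc0 : 0 < c)
    (hc : ∀ x : EE n, c * ‖x‖ ^ 2 ≤ (∑ j, ∑ k, G j k * (x j:ℂ) * (x k:ℂ)).re) (M : ℝ) (hM1 : 1 ≤ M)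
    (hM : ∀ y : EE n, ‖gau G y‖ ^ 2 * (1 + ‖y‖ ^ 2 + ∑ k, ‖lf G k y‖ ^ 2) ≤
      M * Real.exp (-(c / 2) * ‖y‖ ^ 2))
    (u : SchwartzMap (EE n) ℂ) (ρ D : ℝ) (hρ : 0 < ρ)
    (hD : ∀ x0 ξ : EE n, ‖x0‖ ≤ ρ → ‖ξ‖ ≤ ρ → ‖(𝓕 (wS G x0 u)) ξ‖ ≤ D) (x0 : EE n) :
    ρ ^ 2 * ∫ x, ‖u x‖ ^ 2 * ‖gau G (x - x0)‖ ^ 2 ≤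
      Set.indicator (Metric.closedBall (0 : EE n) ρ)
        (fun _ => ρ ^ 2 * (volume.real (Metric.closedBall (0 : EE n) ρ) * D ^ 2)) x0
      + 2 * M * ∫ x, Hu u x * Real.exp (-(c / 2) * ‖x - x0‖ ^ 2) := by
  have hG : ∀ x : EE n, 0 ≤ (∑ j, ∑ k, G j k * (x j : ℂ) * (x k : ℂ)).re := fun x =>
    le_trans (by positivity) (hc x)
  have hEI := HuE_int u (c / 2) (by positivity) x0
  have ew : ∀ x, ‖wS G x0 u x‖ ^ 2 = ‖u x‖ ^ 2 * ‖gau G (x - x0)‖ ^ 2 := by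
    intro x; rw [wS_apply G hG, norm_mul, mul_pow, mul_comm]
  have ewi : ∫ x, ‖u x‖ ^ 2 * ‖gau G (x - x0)‖ ^ 2 = ∫ x, ‖wS G x0 u x‖ ^ 2 := by
    simp only [ew]
  by_cases h : ‖x0‖ ≤ ρ
  · rw [Set.indicator_of_mem (by simpa using h), ewi]
    refine (planch_cut (wS G x0 u) ρ D hρ fun ξ hξ => hD x0 ξ h hξ).trans ?_
    gcongr
    rw [← integral_finsetSum _ fun k _ => sq_int _, ← integral_const_mul]
    refine integral_mono (integrable_finsetSum _ fun k _ => sq_int _) (hEI.const_mul _) fun x => ?_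
    have h1 : ∀ k, ‖sd k (wS G x0 u) x‖ ^ 2 ≤ 2 * ‖gau G (x - x0)‖ ^ 2 * ‖sd k u x‖ ^ 2 +
        2 * ‖gau G (x - x0)‖ ^ 2 * ‖u x‖ ^ 2 * ‖lf G k (x - x0)‖ ^ 2 := by
      intro k
      rw [sd_wS G hGs hG]
      have h2 := norm_sub_le (gau G (x - x0) * sd k u x) (lf G k (x - x0) * gau G (x - x0) * u x)
      have h3 := pow_le_pow_left₀ (norm_nonneg _) h2 2
      refine h3.trans ?_
      rw [norm_mul, norm_mul, norm_mul]
      nlinarith [sq_nonneg (‖gau G (x - x0)‖ * ‖sd k u x‖ - ‖lf G k (x - x0)‖ * ‖gau G (x - x0)‖ * ‖u x‖)]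
    have h4 : ∑ k, ‖sd k (wS G x0 u) x‖ ^ 2 ≤ 2 * ‖gau G (x - x0)‖ ^ 2 * (∑ k, ‖sd k u x‖ ^ 2) +
        2 * ‖gau G (x - x0)‖ ^ 2 * ‖u x‖ ^ 2 * ∑ k, ‖lf G k (x - x0)‖ ^ 2 := by
      rw [Finset.mul_sum, Finset.mul_sum, ← Finset.sum_add_distrib]
      exact Finset.sum_le_sum fun k _ => h1 k
    refine h4.trans ?_
    have h5 := hM (x - x0)
    set gg := ‖gau G (x - x0)‖ ^ 2
    set ll := ∑ k, ‖lf G k (x - x0)‖ ^ 2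
    set ss := ∑ k, ‖sd k u x‖ ^ 2 with hss
    have hgg : 0 ≤ gg := by positivity
    have hll : 0 ≤ ll := Finset.sum_nonneg fun _ _ => by positivity
    have hs0 : 0 ≤ ss := Finset.sum_nonneg fun _ _ => by positivity
    set E := Real.exp (-(c / 2) * ‖x - x0‖ ^ 2)
    have hu0 : 0 ≤ ‖u x‖ ^ 2 := by positivity
    have hx0 : 0 ≤ ‖x‖ ^ 2 * ‖u x‖ ^ 2 := by positivity
    have hy0 : 0 ≤ ‖x - x0‖ ^ 2 := by positivity
    have hH : Hu u x = ‖u x‖ ^ 2 + (‖x‖ ^ 2 * ‖u x‖ ^ 2 + ss) := rfl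
    rw [hH]
    have h6 : gg * (1 + ll) ≤ M * E := le_trans (mul_le_mul_of_nonneg_left (by linarith) hgg) h5
    exact alg1 gg ll ss _ _ M E hgg hll hs0 hu0 hx0 h6
  · rw [Set.indicator_of_notMem (by simpa using h), zero_add]
    push Not at h
    rw [ewi, ← integral_const_mul, ← integral_const_mul]
    refine integral_mono ((sq_int _).const_mul _) (hEI.const_mul _) fun x => ?_
    simp only [ew]
    have h5 := hM (x - x0)
    set gg := ‖gau G (x - x0)‖ ^ 2
    set ll := ∑ k, ‖lf G k (x - x0)‖ ^ 2
    set ss := ∑ k, ‖sd k u x‖ ^ 2 with hss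
    have hgg : 0 ≤ gg := by positivity
    have hll : 0 ≤ ll := Finset.sum_nonneg fun _ _ => by positivity
    have hs0 : 0 ≤ ss := Finset.sum_nonneg fun _ _ => by positivity
    set E := Real.exp (-(c / 2) * ‖x - x0‖ ^ 2)
    have hE0 : 0 ≤ E := (Real.exp_pos _).le
    have hu0 : 0 ≤ ‖u x‖ ^ 2 := by positivity
    have hH : Hu u x = ‖u x‖ ^ 2 + (‖x‖ ^ 2 * ‖u x‖ ^ 2 + ss) := rfl
    rw [hH]
    have h1 : ‖x0‖ ≤ ‖x‖ + ‖x - x0‖ := by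
      have := norm_sub_le x (x - x0)
      simpa using this
    have h2 : ρ ^ 2 ≤ 2 * ((1 + ‖x‖ ^ 2) * (1 + ‖x - x0‖ ^ 2)) := by
      have a1 : ρ ^ 2 ≤ (‖x‖ + ‖x - x0‖) ^ 2 := pow_le_pow_left₀ hρ.le (by linarith) 2
      have a2 : 0 ≤ ‖x‖ ^ 2 * ‖x - x0‖ ^ 2 := by positivity
      nlinarith [sq_nonneg (‖x‖ - ‖x - x0‖)]
    have h6 : gg * (1 + ‖x - x0‖ ^ 2) ≤ M * E := le_trans (mul_le_mul_of_nonneg_left (by linarith) hgg) h5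
    have hME : 0 ≤ M * E := by positivity
    calc ρ ^ 2 * (‖u x‖ ^ 2 * gg) ≤ 2 * ((1 + ‖x‖ ^ 2) * (1 + ‖x - x0‖ ^ 2)) * (‖u x‖ ^ 2 * gg) :=
          mul_le_mul_of_nonneg_right h2 (by positivity)
      _ = 2 * ((1 + ‖x‖ ^ 2) * ‖u x‖ ^ 2) * (gg * (1 + ‖x - x0‖ ^ 2)) := by ring
      _ ≤ 2 * ((1 + ‖x‖ ^ 2) * ‖u x‖ ^ 2) * (M * E) := by gcongr
      _ ≤ _ := by
          exact alg2 ss _ _ M E (by positivity)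

theorem stft_main {n : ℕ} (G : Matrix (Fin n) (Fin n) ℂ) (hGs : G.IsSymm) (c : ℝ) (hc0 : 0 < c)
    (hc : ∀ x : EE n, c * ‖x‖ ^ 2 ≤ (∑ j, ∑ k, G j k * (x j:ℂ) * (x k:ℂ)).re) :
    ∃ K ≥ 1, ∀ (u : SchwartzMap (EE n) ℂ) (ρ D : ℝ), 0 < ρ →
    (∀ x0 ξ : EE n, ‖x0‖ ≤ ρ → ‖ξ‖ ≤ ρ → ‖(𝓕 (wS G x0 u)) ξ‖ ≤ D) →
    ρ ^ 2 * ∫ x, ‖u x‖ ^ 2 ≤ K * (ρ ^ 2 * ρ ^ (2 * n) * D ^ 2 + ((∫ x, ‖u x‖ ^ 2) + ∫ x, p2 u x)) := by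
  obtain ⟨M, hM1, hM⟩ := win_dom G c hc0 hc
  set Φ : EE n → ℝ := fun y => ‖gau G y‖ ^ 2 with hΦ
  set E : EE n → ℝ := fun y => Real.exp (-(c / 2) * ‖y‖ ^ 2) with hE
  have hEi : Integrable E := gauss_int (c / 2) (by positivity)
  have hΦi : Integrable Φ := by
    refine (hEi.const_mul M).mono' ((gau_cont G).norm.pow 2).aestronglyMeasurable
      (Filter.Eventually.of_forall fun y => ?_)
    have h := hM y
    have : 0 ≤ ∑ k, ‖lf G k y‖ ^ 2 := Finset.sum_nonneg fun _ _ => by positivity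
    rw [Real.norm_eq_abs, abs_of_nonneg (by positivity)]
    refine le_trans ?_ h
    have h0 : 0 ≤ ‖gau G y‖ ^ 2 := by positivity
    simp only [hΦ]
    nlinarith [sq_nonneg ‖y‖]
  set I : ℝ := ∫ y, Φ y with hI
  have hI0 : 0 < I := by
    rw [hI, integral_pos_iff_support_of_nonneg (fun y => by simp only [hΦ]; positivity) hΦi]
    have : Function.support Φ = Set.univ := by
      ext y
      simp [hΦ, gau, Complex.exp_ne_zero]
    rw [this]
    exact Measure.measure_univ_pos.2 (NeZero.ne _)
  set J : ℝ := ∫ y, E y with hJ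
  have hJ0 : 0 ≤ J := integral_nonneg fun y => (Real.exp_pos _).le
  set V : ℝ := volume.real (Metric.closedBall (0 : EE n) 1) with hV
  have hV0 : 0 ≤ V := measureReal_nonneg
  refine ⟨1 + (V ^ 2 + 2 * M * J) / I, ?_, fun u ρ D hρ hD => ?_⟩
  · have : 0 ≤ (V ^ 2 + 2 * M * J) / I := by positivity
    linarith
  have hvol : volume.real (Metric.closedBall (0 : EE n) ρ) = ρ ^ n * V := by
    rw [hV, Measure.real, Measure.real, Measure.addHaar_closedBall' _ _ hρ.le, ENNReal.toReal_mul]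
    rw [ENNReal.toReal_ofReal (by positivity)]
    simp
  obtain ⟨c1, c2⟩ := conv_int (fun x => ‖u x‖ ^ 2) Φ (sq_int u) hΦi
  obtain ⟨c3, c4⟩ := conv_int (Hu u) E (Hu_int u) hEi
  set W := ρ ^ 2 * (volume.real (Metric.closedBall (0 : EE n) ρ) * D ^ 2) with hW
  have hIi : Integrable (fun ξ : EE n => Set.indicator (Metric.closedBall (0 : EE n) ρ) (fun _ => W) ξ) :=
    (integrable_indicator_iff Metric.isClosed_closedBall.measurableSet).2
      (integrableOn_const (by exact measure_closedBall_lt_top.ne))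
  have e2 : ∫ ξ, Set.indicator (Metric.closedBall (0 : EE n) ρ) (fun _ => W) ξ =
      volume.real (Metric.closedBall (0 : EE n) ρ) * W := by
    rw [integral_indicator Metric.isClosed_closedBall.measurableSet, setIntegral_const, smul_eq_mul]
  have key := integral_mono (c1.const_mul (ρ ^ 2)) (hIi.add (c3.const_mul (2 * M)))
    fun x0 => stft_pt G hGs c hc0 hc M hM1 hM u ρ D hρ hD x0
  have key2 : ρ ^ 2 * ((∫ x, ‖u x‖ ^ 2) * I) ≤
      volume.real (Metric.closedBall (0 : EE n) ρ) * W + 2 * M * ((∫ x, Hu u x) * J) := by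
    rw [← c2, ← c4, ← e2, ← integral_const_mul, ← integral_const_mul,
      ← integral_add hIi (c3.const_mul (2 * M))]
    exact key
  have eH : ∫ x, Hu u x = (∫ x, ‖u x‖ ^ 2) + ∫ x, p2 u x := integral_add (sq_int u) (p2_int u)
  rw [eH, hW, hvol] at key2
  have hU0 : 0 ≤ (∫ x, ‖u x‖ ^ 2) + ∫ x, p2 u x :=
    add_nonneg (integral_nonneg fun x => by positivity) (integral_nonneg fun x => p2_nonneg u x)
  set U := (∫ x, ‖u x‖ ^ 2) + ∫ x, p2 u x
  have hX0 : 0 ≤ ρ ^ 2 * ρ ^ (2 * n) * D ^ 2 := by positivity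
  set X := ρ ^ 2 * ρ ^ (2 * n) * D ^ 2 with hX
  have e5 : ρ ^ n * V * (ρ ^ 2 * (ρ ^ n * V * D ^ 2)) = V ^ 2 * X := by rw [hX]; ring
  rw [e5] at key2
  have h6 : (ρ ^ 2 * ∫ x, ‖u x‖ ^ 2) * I ≤ (V ^ 2 + 2 * M * J) * (X + U) := by
    have a1 : 0 ≤ V ^ 2 * U := by positivity
    have a2 : 0 ≤ 2 * M * J * X := by positivity
    nlinarith
  have h7 : ρ ^ 2 * ∫ x, ‖u x‖ ^ 2 ≤ (V ^ 2 + 2 * M * J) / I * (X + U) := by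
    rw [div_mul_eq_mul_div, le_div_iff₀ hI0]; exact h6
  linarith


theorem l2Norm_sq {n : ℕ} (u : EE n → ℂ) : l2Norm u ^ 2 = ∫ x, ‖u x‖ ^ 2 :=
  Real.sq_sqrt (integral_nonneg fun x => by positivity)

theorem absorb (K2 c5 R N z ρ2 U P Fv Y : ℝ) (hK2 : 1 ≤ K2) (hc5 : 0 < c5) (hR : 1 ≤ R) (hN : 1 ≤ N)
    (hz : z ≤ R * N) (hU : 0 ≤ U) (hF : 0 ≤ Fv)
    (hρ : ρ2 = 2 * K2 * (1 + 2 * R / c5) * N)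
    (h1 : ρ2 * U ≤ K2 * (ρ2 * Y + (U + P))) (h2 : c5 * P ≤ Fv + (1 + z) * U) :
    U ≤ 2 * K2 * Y + 2 * K2 / c5 * Fv := by
  have hP : P ≤ Fv / c5 + (2 * R / c5) * N * U := by
    have : P = (c5 * P) / c5 := by field_simp
    rw [this]
    have h3 : c5 * P ≤ Fv + (2 * R * N) * U := by
      refine h2.trans ?_
      have : 1 + z ≤ 2 * R * N := by nlinarith
      nlinarith
    calc c5 * P / c5 ≤ (Fv + (2 * R * N) * U) / c5 := by gcongr
      _ = _ := by ring
  set w := 2 * R / c5 with hw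
  have hw0 : 0 < w := by positivity
  have hρ1 : 1 ≤ ρ2 := by
    rw [hρ]
    have : 1 ≤ 1 + w := by linarith
    have : 1 ≤ K2 * (1 + w) := by nlinarith
    nlinarith
  have h4 : K2 * (U + P) ≤ ρ2 / 2 * U + K2 * (Fv / c5) := by
    have a1 : U + P ≤ (1 + w) * N * U + Fv / c5 := by nlinarith
    have a2 := mul_le_mul_of_nonneg_left a1 (by linarith : 0 ≤ K2)
    rw [hρ]
    linarith
  have h5 : ρ2 * U ≤ ρ2 * (2 * K2 * Y) + 2 * (K2 * (Fv / c5)) := by linarith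
  have h6 : 0 ≤ K2 * (Fv / c5) := by positivity
  have h7 : ρ2 * U ≤ ρ2 * (2 * K2 * Y + 2 * K2 / c5 * Fv) := by
    have e : 2 * K2 / c5 * Fv = 2 * (K2 * (Fv / c5)) := by ring
    rw [e]; nlinarith
  exact le_of_mul_le_mul_left h7 (by linarith)

theorem core_raw {n : ℕ} (A B C : Matrix (Fin n) (Fin n) ℂ) (hAs : A.IsSymm) (hCs : C.IsSymm)
    (hpos : ∀ x ξ : Fin n → ℝ, ¬(x = 0 ∧ ξ = 0) →
      0 < (qForm A B C (fun j => (x j : ℂ)) (fun j => (ξ j : ℂ))).re)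
    (F : Matrix (Fin n ⊕ Fin n) (Fin n ⊕ Fin n) ℂ)
    (hF : ∀ X Y, sympForm X (F.mulVec Y) = qPolar A B C X Y)
    (lam : Fin n → ℂ) (hlam : ∀ j, 0 < (lam j).im)
    (hchar : F.charpoly =
      ∏ j, ((Polynomial.X - Polynomial.C (lam j)) * (Polynomial.X + Polynomial.C (lam j))))
    (R : ℝ) (hR1 : 1 ≤ R) :
    ∃ K ≥ 1, ∃ Q ≥ 1, ∀ N : ℝ, 1 ≤ N → ∃ m : ℕ, 1 ≤ m ∧ (m : ℝ) ≤ Q * N ∧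
      ∀ (δ : ℝ) (ζ : ℂ), 0 < δ → δ ≤ 1 → ‖ζ‖ ≤ R * N →
      (∀ α : Fin n → ℤ, (∀ j, 0 ≤ α j) → δ ≤ ‖eigv lam α - ζ‖) →
      ∀ u f : SchwartzMap (EE n) ℂ,
      (∀ x, f x = weylQuant A B C 1 (fun y => u y) x - ζ * u x) →
      l2Norm (fun x => u x) ^ 2 ≤
        (Q * (Q * N) ^ n * (2 ^ n * (2 * ((K * m / δ) ^ (n * m + 1) + K) * (K * Real.exp (Q * N)))) ^ 2 + Q)
          * l2Norm (fun x => f x) ^ 2 := by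
  obtain ⟨G, T, Ti, M, hGs, hGp, hT, hT', hMl, hMd, hR, hM⟩ :=
    la_main A B C hAs hCs hpos F hF lam hlam hchar
  obtain ⟨c, hc0, hc⟩ := quadG_lower G hGp
  obtain ⟨b, hb, K, hK, hmode⟩ := mode_bound A B C G T Ti M hCs lam hlam hGs c hc0 hc hT hMl hMd hR hM
  obtain ⟨C4, hC4, hst⟩ := stft_bound G T Ti hGs c hc0 hc hT' b hb
  obtain ⟨K2, hK2, hmain⟩ := stft_main G hGs c hc0 hc
  obtain ⟨c5, hc5, hen⟩ := energy A B C hAs hCs hpos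
  set q : ℝ := 2 * K2 * (1 + 2 * R / c5) with hq
  have hq1 : 1 ≤ q := by
    have : 0 ≤ 2 * R / c5 := by positivity
    rw [hq]; nlinarith
  set p : ℝ := K * (R + C4 ^ 2 * q) with hp
  have hp1 : 1 ≤ p := by
    have : 0 ≤ C4 ^ 2 * q := by positivity
    rw [hp]; nlinarith
  have hc5' : 0 ≤ 2 * K2 / c5 := by positivity
  set Q : ℝ := p + 1 + q + 2 * K2 + 2 * K2 / c5 with hQ
  refine ⟨K, hK, Q, by linarith, fun N hN => ?_⟩
  have hm0 : (⌈p * N⌉₊ : ℝ) ≤ p * N + 1 := (Nat.ceil_lt_add_one (by positivity)).le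
  have hm1 : p * N ≤ (⌈p * N⌉₊ : ℝ) := Nat.le_ceil _
  set m := ⌈p * N⌉₊
  refine ⟨m, ?_, ?_, fun δ ζ hδ hδ1 hζ hres u f hf => ?_⟩
  · have : (1:ℝ) ≤ m := by nlinarith
    exact_mod_cast this
  · have : (p + 1) * N ≤ Q * N := by
      refine mul_le_mul_of_nonneg_right ?_ (by linarith)
      linarith
    linarith
  have hN0 : 0 < N := by linarith
  set ρ : ℝ := Real.sqrt (q * N) with hρ
  have hqN : 0 < q * N := by positivity
  have hρ0 : 0 < ρ := Real.sqrt_pos.2 hqN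
  have hρ2 : ρ ^ 2 = q * N := Real.sq_sqrt hqN.le
  have hr2 : K * (C4 * ρ) ^ 2 = K * (C4 ^ 2 * q) * N := by rw [mul_pow, hρ2]; ring
  have hpN : p * N = K * (R * N) + K * (C4 ^ 2 * q) * N := by rw [hp]; ring
  have hnn1 : 0 ≤ K * (R * N) := by positivity
  have hnn2 : 0 ≤ K * (C4 ^ 2 * q) * N := by positivity
  have hm1' : 1 ≤ m := by
    have : (1:ℝ) ≤ m := by nlinarith
    exact_mod_cast this
  have hS := hmode (C4 * ρ) δ ζ m (by positivity) hδ hδ1 hm1'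
    (by have : K * ‖ζ‖ ≤ K * (R * N) := by gcongr
        linarith) (by linarith) u f hf hres
  have hD := hst ρ hρ0 _ u hS
  have h1 := hmain u ρ _ hρ0 hD
  have h2 := hen ζ u f hf
  have hl := l2Norm_nonneg (fun x => f x)
  rw [l2Norm_sq]
  have h3 := absorb K2 c5 R N ‖ζ‖ (ρ ^ 2) (∫ x, ‖u x‖ ^ 2) (∫ x, p2 u x) (∫ x, ‖f x‖ ^ 2) _ hK2 hc5 hR1 hN hζ
    (integral_nonneg fun x => by positivity) (integral_nonneg fun x => by positivity) hρ2
    (by rw [← mul_assoc]; exact h1) h2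
  refine h3.trans ?_
  rw [← l2Norm_sq]
  set Z := l2Norm (fun x => f x)
  have e1 : ρ ^ (2 * n) = (q * N) ^ n := by rw [pow_mul, hρ2]
  rw [e1, hr2]
  have hexp : Real.exp (K * (C4 ^ 2 * q) * N) ≤ Real.exp (Q * N) := by
    refine Real.exp_le_exp.2 (mul_le_mul_of_nonneg_right ?_ hN0.le)
    have : 0 ≤ K * R := by positivity
    have : p = K * R + K * (C4 ^ 2 * q) := by rw [hp]; ring
    linarith
  set Y := (K * m / δ) ^ (n * m + 1)
  have hY : 0 ≤ Y := by positivity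
  have e2 : 2 * ((q * N) ^ n * (2 ^ n * (2 * (Y + K) * (K * Real.exp (K * (C4 ^ 2 * q) * N) * Z))) ^ 2)
      = 2 * ((q * N) ^ n * (2 ^ n * (2 * (Y + K) * (K * Real.exp (K * (C4 ^ 2 * q) * N)))) ^ 2) * Z ^ 2 := by
    ring
  rw [mul_assoc 2 K2, mul_left_comm 2 K2, e2, add_mul, ← mul_assoc K2]
  have hqQ : q ≤ Q := by linarith
  have hkQ : 2 * K2 ≤ Q := by linarith
  have h4 : K2 * (2 * ((q * N) ^ n * (2 ^ n * (2 * (Y + K) * (K * Real.exp (K * (C4 ^ 2 * q) * N)))) ^ 2)) ≤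
      Q * (Q * N) ^ n * (2 ^ n * (2 * (Y + K) * (K * Real.exp (Q * N)))) ^ 2 := by
    calc _ = (2 * K2) * (q * N) ^ n * (2 ^ n * (2 * (Y + K) * (K * Real.exp (K * (C4 ^ 2 * q) * N)))) ^ 2 := by ring
      _ ≤ _ := by gcongr
  have h5 : 2 * K2 / c5 ≤ Q := by linarith
  gcongr

theorem ex_const (k t : ℝ) (hk : 0 ≤ k) (ht : 1 ≤ t) : k ≤ Real.exp (k * t) := by
  have := Real.add_one_le_exp (k * t)
  nlinarith

theorem ex_add (x y a b t : ℝ) (ha : 0 ≤ a) (hb : 0 ≤ b) (ht : 1 ≤ t)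
    (hx : x ≤ Real.exp (a * t)) (hy : y ≤ Real.exp (b * t)) : x + y ≤ Real.exp ((a + b + 1) * t) := by
  have e : Real.exp ((a + b + 1) * t) = Real.exp (a * t) * Real.exp (b * t) * Real.exp t := by
    rw [← Real.exp_add, ← Real.exp_add]; congr 1; ring
  have h1 : 1 ≤ Real.exp (a * t) := Real.one_le_exp (by positivity)
  have h2 : 1 ≤ Real.exp (b * t) := Real.one_le_exp (by positivity)
  have h3 : 2 ≤ Real.exp t := by have := Real.add_one_le_exp t; linarith
  rw [e]
  set p := Real.exp (a * t)
  set q := Real.exp (b * t)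
  have h4 : 1 ≤ p * q := by nlinarith
  have : p + q ≤ 2 * (p * q) := by nlinarith
  nlinarith

theorem ex_mul (x y a b t : ℝ) (hy0 : 0 ≤ y)
    (hx : x ≤ Real.exp (a * t)) (hy : y ≤ Real.exp (b * t)) : x * y ≤ Real.exp ((a + b) * t) := by
  rw [add_mul, Real.exp_add]
  exact mul_le_mul hx hy hy0 (Real.exp_pos _).le

theorem ex_pow (x a t : ℝ) (k : ℕ) (hx0 : 0 ≤ x) (hx : x ≤ Real.exp (a * t)) :
    x ^ k ≤ Real.exp ((k * a) * t) := by
  rw [mul_assoc, Real.exp_nat_mul]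
  exact pow_le_pow_left₀ hx0 hx k

theorem numer (n : ℕ) (K Q C' L : ℝ) (hK : 1 ≤ K) (hQ : 1 ≤ Q) (hC : 1 ≤ C') (hL : 1 ≤ L) :
    ∃ a ≥ 0, ∀ (N : ℝ) (m : ℕ), 3 ≤ N → 1 ≤ m → (m : ℝ) ≤ Q * N →
      Q * (Q * N) ^ n * (2 ^ n * (2 * ((K * m / (N ^ (-L) / C')) ^ (n * m + 1) + K) * (K * Real.exp (Q * N)))) ^ 2 + Q
        ≤ Real.exp (a * (N * Real.log N)) := by
  refine ⟨Q + n * (Q + 1) + ((2:ℕ):ℝ) * (n * 2 + (2 + (((K * Q * C' + 1 + L) * ((n:ℝ) * Q + 1)) + K + 1) + (K + Q))) + Q + 1,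
    by positivity, fun N m hN hm1 hm => ?_⟩
  have hN0 : 0 < N := by linarith
  have hlog : 1 ≤ Real.log N := by
    rw [Real.le_log_iff_exp_le hN0]
    have := Real.exp_one_lt_d9
    linarith
  have ht : 1 ≤ N * Real.log N := by nlinarith
  have hNt : N ≤ N * Real.log N := by nlinarith
  set t := N * Real.log N with htt
  have b1 : (K * m / (N ^ (-L) / C')) ^ (n * m + 1) ≤ Real.exp (((K * Q * C' + 1 + L) * ((n:ℝ) * Q + 1)) * t) := by
    have e : K * m / (N ^ (-L) / C') = K * m * C' * N ^ L := by
      rw [Real.rpow_neg hN0.le]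
      field_simp
    have hb : K * m / (N ^ (-L) / C') ≤ Real.exp ((K * Q * C' + 1 + L) * Real.log N) := by
      rw [e]
      have p1 : K * m * C' ≤ (K * Q * C') * N := by
        calc K * m * C' ≤ K * (Q * N) * C' := by gcongr
          _ = _ := by ring
      have p2 : K * Q * C' ≤ Real.exp (K * Q * C' * Real.log N) := ex_const _ _ (by positivity) hlog
      have p3 : N = Real.exp (Real.log N) := (Real.exp_log hN0).symm
      have p4 : N ^ L = Real.exp (L * Real.log N) := by rw [Real.rpow_def_of_pos hN0, mul_comm]
      calc K * m * C' * N ^ L ≤ (K * Q * C') * N * N ^ L := by gcongr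
        _ ≤ Real.exp (K * Q * C' * Real.log N) * Real.exp (Real.log N) * Real.exp (L * Real.log N) := by
            rw [p4, ← p3]; gcongr
        _ = _ := by rw [← Real.exp_add, ← Real.exp_add]; congr 1; ring
    refine (pow_le_pow_left₀ (by positivity) hb _).trans ?_
    rw [← Real.exp_nat_mul]
    refine Real.exp_le_exp.2 ?_
    have h1 : ((n * m + 1 : ℕ) : ℝ) ≤ (n * Q + 1) * N := by
      push_cast
      have : (n:ℝ) * m ≤ n * (Q * N) := by gcongr
      nlinarith
    calc _ ≤ (n * Q + 1) * N * ((K * Q * C' + 1 + L) * Real.log N) :=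
          mul_le_mul_of_nonneg_right h1 (by positivity)
      _ = _ := by rw [htt]; ring
  have b2 : Real.exp (Q * N) ≤ Real.exp (Q * t) := Real.exp_le_exp.2 (by gcongr)
  have b3 : N ≤ Real.exp (1 * t) := by have := Real.add_one_le_exp (1 * t); linarith
  have bK := ex_const K t (by linarith) ht
  have bQ := ex_const Q t (by linarith) ht
  have bt := ex_const 2 t (by norm_num) ht
  have hYp : 0 ≤ (K * m / (N ^ (-L) / C')) ^ (n * m + 1) := by positivity
  set Y := (K * m / (N ^ (-L) / C')) ^ (n * m + 1)
  have ha0 : 0 ≤ ((K * Q * C' + 1 + L) * ((n:ℝ) * Q + 1)) := by positivity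
  have s1 := ex_add _ _ _ _ t ha0 (by linarith) ht b1 bK
  have s2 := ex_mul _ _ _ _ t (by positivity) bt s1
  have s3 := ex_mul _ _ _ _ t (Real.exp_pos _).le bK b2
  have s4 := ex_mul _ _ _ _ t (by positivity) s2 s3
  have s5 := ex_mul _ _ _ _ t (by positivity) (ex_pow 2 _ t n (by norm_num) bt) s4
  have s6 := ex_pow _ _ t 2 (by positivity) s5
  have s7 := ex_pow _ _ t n (by positivity) (ex_mul _ _ _ _ t (by positivity) bQ b3)
  have s8 := ex_mul _ _ _ _ t (by positivity) (ex_mul _ _ _ _ t (by positivity) bQ s7) s6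
  exact ex_add _ _ _ _ t (by positivity) (by linarith) ht s8 bQ

theorem core {n : ℕ} (A B C : Matrix (Fin n) (Fin n) ℂ) (hAs : A.IsSymm) (hCs : C.IsSymm)
    (hpos : ∀ x ξ : Fin n → ℝ, ¬(x = 0 ∧ ξ = 0) →
      0 < (qForm A B C (fun j => (x j : ℂ)) (fun j => (ξ j : ℂ))).re)
    (F : Matrix (Fin n ⊕ Fin n) (Fin n ⊕ Fin n) ℂ)
    (hF : ∀ X Y, sympForm X (F.mulVec Y) = qPolar A B C X Y)
    (lam : Fin n → ℂ) (hlam : ∀ j, 0 < (lam j).im)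
    (hchar : F.charpoly =
      ∏ j, ((Polynomial.X - Polynomial.C (lam j)) * (Polynomial.X + Polynomial.C (lam j))))
    (R : ℝ) (hR1 : 1 ≤ R) (C' L : ℝ) (hC : 1 ≤ C') (hL : 1 ≤ L) :
    ∃ a ≥ 0, ∀ N : ℝ, 3 ≤ N → ∀ (ζ : ℂ), ‖ζ‖ ≤ R * N →
      (∀ α : Fin n → ℤ, (∀ j, 0 ≤ α j) → N ^ (-L) / C' ≤ ‖eigv lam α - ζ‖) →
      ∀ u f : SchwartzMap (EE n) ℂ,
      (∀ x, f x = weylQuant A B C 1 (fun y => u y) x - ζ * u x) →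
      l2Norm (fun x => u x) ≤ Real.exp (a * (N * Real.log N)) * l2Norm (fun x => f x) := by
  obtain ⟨K, hK, Q, hQ, h⟩ := core_raw A B C hAs hCs hpos F hF lam hlam hchar R hR1
  obtain ⟨a, ha, hnum⟩ := numer n K Q C' L hK hQ hC hL
  refine ⟨a, ha, fun N hN ζ hζ hres u f hf => ?_⟩
  obtain ⟨m, hm1, hm, hh⟩ := h N (by linarith)
  have hN0 : 0 < N := by linarith
  have hδ1 : N ^ (-L) / C' ≤ 1 := by
    rw [div_le_one (by linarith)]
    have : N ^ (-L) ≤ 1 := Real.rpow_le_one_of_one_le_of_nonpos (by linarith) (by linarith)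
    linarith
  have h1 := hh (N ^ (-L) / C') ζ (by positivity) hδ1 hζ hres u f hf
  have h2 := hnum N m hN hm1 hm
  have hl := l2Norm_nonneg (fun x => f x)
  have ht : 0 ≤ a * (N * Real.log N) := by
    have := Real.log_nonneg (by linarith : 1 ≤ N)
    positivity
  have h3 : 1 ≤ Real.exp (a * (N * Real.log N)) := Real.one_le_exp ht
  have h4 : l2Norm (fun x => u x) ^ 2 ≤ (Real.exp (a * (N * Real.log N)) * l2Norm (fun x => f x)) ^ 2 := by
    refine h1.trans ?_
    rw [mul_pow (Real.exp _)]
    refine mul_le_mul_of_nonneg_right (h2.trans ?_) (by positivity)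
    nlinarith
  exact (sq_le_sq₀ (l2Norm_nonneg _) (by positivity)).1 h4


noncomputable def scaleS {n : ℕ} (s : ℝ) (hs : s ≠ 0) (u : SchwartzMap (EE n) ℂ) : SchwartzMap (EE n) ℂ :=
  SchwartzMap.compCLMOfContinuousLinearEquiv ℂ (ContinuousLinearEquiv.smulLeft (Units.mk0 s hs)) u

theorem scaleS_apply {n : ℕ} (s : ℝ) (hs : s ≠ 0) (u : SchwartzMap (EE n) ℂ) (x : EE n) :
    scaleS s hs u x = u (s • x) := rfl

theorem weyl_scale {n : ℕ} (A B C : Matrix (Fin n) (Fin n) ℂ) (s : ℝ) (hs : s ≠ 0)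
    (u : SchwartzMap (EE n) ℂ) (y : EE n) :
    ((s ^ 2 : ℝ) : ℂ) * weylQuant A B C 1 (fun y => scaleS s hs u y) y =
      weylQuant A B C (s ^ 2) (fun y => u y) (s • y) := by
  have e0 : (fun y => scaleS s hs u y) = fun y => u (s • y) := rfl
  have e1 : ∀ (k : Fin n) (x : EE n), fderiv ℝ (fun y => u (s • y)) x (EuclideanSpace.single k 1) =
      (s : ℂ) * fderiv ℝ (fun y => u y) (s • x) (EuclideanSpace.single k 1) := by
    intro k x
    have := fderiv_comp_smul (𝕜 := ℝ) (f := fun y => u y) (c := s) (x := x)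
    rw [this]
    simp
  have e2 : ∀ (j k : Fin n) (x : EE n),
      fderiv ℝ (fun y => fderiv ℝ (fun y => u (s • y)) y (EuclideanSpace.single k 1)) x (EuclideanSpace.single j 1)
      = (s : ℂ) * ((s : ℂ) * fderiv ℝ (fun y => fderiv ℝ (fun y => u y) y (EuclideanSpace.single k 1)) (s • x)
        (EuclideanSpace.single j 1)) := by
    intro j k x
    have h : (fun y => fderiv ℝ (fun y => u (s • y)) y (EuclideanSpace.single k 1)) =
        fun y => (s : ℂ) * (sd k u) (s • y) := by
      ext y; rw [e1]; rfl
    rw [h]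
    have hd : DifferentiableAt ℝ (fun y => (sd k u) (s • y)) x := (scaleS s hs (sd k u)).differentiableAt
    rw [fderiv_const_mul hd]
    have := fderiv_comp_smul (𝕜 := ℝ) (f := fun y => sd k u y) (c := s) (x := x)
    rw [this]
    simp only [smul_apply, smul_eq_mul, Complex.real_smul]
    rfl
  unfold weylQuant
  rw [e0]
  simp only [e2]
  simp only [e1]
  have hA : ∑ j, ∑ k, A j k * ((s • y) j : ℂ) * ((s • y) k : ℂ) =
      (s:ℂ) ^ 2 * ∑ j, ∑ k, A j k * (y j : ℂ) * (y k : ℂ) := by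
    simp only [Finset.mul_sum]
    refine Finset.sum_congr rfl fun j _ => Finset.sum_congr rfl fun k _ => ?_
    simp; ring
  have hB : ∑ k, (∑ l, B k l * ((s • y) l : ℂ)) * fderiv ℝ (fun y => u y) (s • y) (EuclideanSpace.single k 1)
      = ∑ k, (∑ l, B k l * (y l : ℂ)) * ((s:ℂ) * fderiv ℝ (fun y => u y) (s • y) (EuclideanSpace.single k 1)) := by
    refine Finset.sum_congr rfl fun k _ => ?_
    have : ∑ l, B k l * ((s • y) l : ℂ) = (s:ℂ) * ∑ l, B k l * (y l : ℂ) := by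
      rw [Finset.mul_sum]
      refine Finset.sum_congr rfl fun l _ => ?_
      simp; ring
    rw [this]; ring
  have hCC : ∑ j, ∑ k, C j k * ((s : ℂ) * ((s : ℂ) * fderiv ℝ (fun y => fderiv ℝ (fun y => u y) y (EuclideanSpace.single k 1)) (s • y)
        (EuclideanSpace.single j 1))) = (s:ℂ) ^ 2 * ∑ j, ∑ k, C j k * fderiv ℝ (fun y => fderiv ℝ (fun y => u y) y (EuclideanSpace.single k 1)) (s • y)
        (EuclideanSpace.single j 1) := by
    simp only [Finset.mul_sum]
    refine Finset.sum_congr rfl fun j _ => Finset.sum_congr rfl fun k _ => ?_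
    ring
  rw [hA, hB, hCC]
  push_cast
  ring

theorem l2_scale {n : ℕ} (s : ℝ) (hs : 0 < s) (φ : EE n → ℂ) :
    l2Norm (fun y => φ (s • y)) = Real.sqrt ((s ^ n)⁻¹) * l2Norm φ := by
  unfold l2Norm
  rw [Measure.integral_comp_smul volume (fun y => ‖φ y‖ ^ 2) s, smul_eq_mul,
    abs_of_nonneg (by positivity), Real.sqrt_mul (by positivity)]
  simp

theorem l2_const {n : ℕ} (a : ℂ) (φ : EE n → ℂ) : l2Norm (fun y => a * φ y) = ‖a‖ * l2Norm φ := by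
  unfold l2Norm
  simp only [norm_mul, mul_pow]
  rw [integral_const_mul, Real.sqrt_mul (by positivity), Real.sqrt_sq (norm_nonneg _)]

theorem spec_gap {n : ℕ} (lam : Fin n → ℂ) (h C' L : ℝ) (hh : 0 < h) (hh1 : h ≤ 1) (hC : 0 < C') (z : ℂ)
    (hd : h ^ L / C' ≤ Metric.infDist z (specSet lam h)) (α : Fin n → ℤ) (hα : ∀ j, 0 ≤ α j) :
    (1 / h) ^ (-L) / max 1 C' ≤ ‖eigv lam α - z / h‖ := by
  have hmem : (h : ℂ) * eigv lam α ∈ specSet lam h := by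
    refine ⟨fun j => (α j).toNat, ?_⟩
    have : ∀ j, (((α j).toNat : ℕ) : ℂ) = (α j : ℂ) := by
      intro j
      have := Int.toNat_of_nonneg (hα j)
      exact_mod_cast congrArg (fun t : ℤ => (t : ℂ)) this
    simp only [this]
    unfold eigv
    rw [div_eq_mul_inv, Complex.inv_I]
    ring
  have h1 := hd.trans (Metric.infDist_le_dist_of_mem hmem)
  have hc : (h : ℂ) ≠ 0 := by exact_mod_cast hh.ne'
  have e : z - (h : ℂ) * eigv lam α = -(h : ℂ) * (eigv lam α - z / h) := by
    field_simp; ring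
  rw [dist_eq_norm, e, norm_mul, norm_neg, Complex.norm_real, Real.norm_eq_abs, abs_of_pos hh] at h1
  have e2 : (1 / h) ^ (-L) = h ^ L := by
    rw [one_div, Real.inv_rpow hh.le, Real.rpow_neg hh.le, inv_inv]
  rw [e2]
  have h2 : h ^ L / max 1 C' ≤ h ^ L / C' := by
    have := Real.rpow_pos_of_pos hh L
    gcongr
    exact le_max_right _ _
  have h3 : h * ‖eigv lam α - z / h‖ ≤ 1 * ‖eigv lam α - z / h‖ := by gcongr
  linarith

theorem statement_1 {n : ℕ} (hn : 1 ≤ n)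
    (A B C : Matrix (Fin n) (Fin n) ℂ) (hAs : A.IsSymm) (hCs : C.IsSymm)
    (hpos : ∀ x ξ : Fin n → ℝ, ¬(x = 0 ∧ ξ = 0) →
      0 < (qForm A B C (fun j => (x j : ℂ)) (fun j => (ξ j : ℂ))).re)
    (F : Matrix (Fin n ⊕ Fin n) (Fin n ⊕ Fin n) ℂ)
    (hF : ∀ X Y, sympForm X (F.mulVec Y) = qPolar A B C X Y)
    (lam : Fin n → ℂ) (hlam : ∀ j, 0 < (lam j).im)
    (hchar : F.charpoly =
      ∏ j, ((Polynomial.X - Polynomial.C (lam j)) * (Polynomial.X + Polynomial.C (lam j))))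
    (Ω : Set ℂ) (hΩ : Bornology.IsBounded Ω) :
    ∃ h₀ > 0, ∀ C' > 0, ∀ L : ℝ, 1 ≤ L → ∃ A' > 0, ∀ h : ℝ, 0 < h → h ≤ h₀ →
      ∀ z ∈ Ω, h ^ L / C' ≤ Metric.infDist z (specSet lam h) →
      ∀ u : SchwartzMap (EuclideanSpace ℝ (Fin n)) ℂ,
        l2Norm (fun x => u x) ≤ A' * Real.exp (A' / h * Real.log (1 / h)) *
          l2Norm (fun x => weylQuant A B C h (fun y => u y) x - z * u x) := by
  obtain ⟨R0, hR0⟩ := hΩ.exists_norm_le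
  refine ⟨1 / 3, by norm_num, fun C' hC' L hL => ?_⟩
  obtain ⟨a, ha, hcore⟩ := core A B C hAs hCs hpos F hF lam hlam hchar (max 1 R0) (le_max_left _ _)
    (max 1 C') L (le_max_left _ _) hL
  refine ⟨a + 1, by linarith, fun h hh hh3 z hz hd u => ?_⟩
  have hN : 3 ≤ 1 / h := by
    rw [le_div_iff₀ hh]; linarith
  have hc : (h : ℂ) ≠ 0 := by exact_mod_cast hh.ne'
  have hs0 : 0 < Real.sqrt h := Real.sqrt_pos.2 hh
  have hs2 : Real.sqrt h ^ 2 = h := Real.sq_sqrt hh.le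
  set s := Real.sqrt h
  obtain ⟨f, hf⟩ := weyl_schwartz A B C (z / h) (scaleS s hs0.ne' u)
  have hζ : ‖z / (h : ℂ)‖ ≤ max 1 R0 * (1 / h) := by
    rw [norm_div, Complex.norm_real, Real.norm_eq_abs, abs_of_pos hh, div_eq_mul_one_div]
    have := (hR0 z hz).trans (le_max_right 1 R0)
    gcongr
  have key := hcore (1 / h) hN (z / h) hζ
    (spec_gap lam h C' L hh (by linarith) hC' z hd) (scaleS s hs0.ne' u) f hf
  set Φ : EE n → ℂ := fun x => weylQuant A B C h (fun y => u y) x - z * u x with hΦ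
  have ef : (fun y => f y) = fun y => (1 / (h:ℂ)) * Φ (s • y) := by
    ext y
    rw [hf y]
    have := weyl_scale A B C s hs0.ne' u y
    rw [hs2] at this
    simp only [hΦ]
    rw [← this, scaleS_apply]
    field_simp
  have eu : (fun y => scaleS s hs0.ne' u y) = fun y => (fun x => u x) (s • y) := rfl
  rw [ef, eu, l2_scale s hs0, l2_const (1 / (h:ℂ)) (fun y => Φ (s • y)), l2_scale s hs0] at key
  have hk0 : 0 < Real.sqrt ((s ^ n)⁻¹) := Real.sqrt_pos.2 (by positivity)
  have hnorm : ‖(1 / (h:ℂ))‖ = 1 / h := by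
    rw [norm_div, Complex.norm_real, Real.norm_eq_abs, abs_of_pos hh, norm_one]
  rw [hnorm] at key
  have hl := l2Norm_nonneg Φ
  set N := 1 / h with hNdef
  have hlog : 1 ≤ Real.log N := by
    rw [Real.le_log_iff_exp_le (by linarith)]
    have := Real.exp_one_lt_d9
    linarith
  set t := N * Real.log N with ht
  have hNt : N ≤ Real.exp t := by
    have := Real.add_one_le_exp t
    nlinarith
  have key2 : l2Norm (fun x => u x) ≤ Real.exp (a * t) * (N * l2Norm Φ) := by
    refine le_of_mul_le_mul_left (key.trans (le_of_eq ?_)) hk0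
    ring
  refine key2.trans ?_
  have e3 : (a + 1) / h * Real.log N = a * t + t := by rw [ht, hNdef]; ring
  rw [e3, Real.exp_add]
  calc Real.exp (a * t) * (N * l2Norm Φ) ≤ Real.exp (a * t) * (Real.exp t * l2Norm Φ) := by gcongr
    _ = 1 * (Real.exp (a * t) * Real.exp t) * l2Norm Φ := by ring
    _ ≤ _ := by gcongr; linarith
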